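/- arXiv:math/0502142 — 3 statements merged into one kernel-verified Lean document; each statement's English description precedes it below -/
import Mathlib

section
/- Problem (P') has a classical solution if and only if λ(a + μ) < λ₁. -/
open Set MeasureTheory Filter Topology

/-- The Laplace operator: sum of second partial derivatives. -/
noncomputable def lap {N : ℕ} (u : EuclideanSpace ℝ (Fin N) → ℝ)
    (x : EuclideanSpace ℝ (Fin N)) : ℝ :=
  ∑ i : Fin N,
    fderiv ℝ (fun y => fderiv ℝ u y (EuclideanSpace.single i 1)) x (EuclideanSpace.single i 1)

/-- Locally Hölder continuous (with some exponent `r ∈ (0,1]`) on a set. -/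
def LocHolderOn {X Y : Type*} [PseudoMetricSpace X] [PseudoMetricSpace Y]
    (f : X → Y) (s : Set X) : Prop :=
  ∃ r : NNReal, 0 < r ∧ r ≤ 1 ∧
    ∀ x ∈ s, ∃ t ∈ nhdsWithin x s, ∃ C : NNReal, HolderOnWith C r f t
/-- A classical solution of `−Δu = g(u) + λ |∇u|² + μ` in `Ω`, `u > 0` in `Ω`,
`u = 0` on `∂Ω`. -/
def IsSolP' {N : ℕ} (Ω : Set (EuclideanSpace ℝ (Fin N)))
    (g : ℝ → ℝ) (lam mu : ℝ) (u : EuclideanSpace ℝ (Fin N) → ℝ) : Prop :=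
  ContDiffOn ℝ 2 u Ω ∧ ContinuousOn u (closure Ω) ∧
  (∀ x ∈ Ω, 0 < u x) ∧ (∀ x ∈ frontier Ω, u x = 0) ∧
  (∀ x ∈ Ω, -(lap u x) = g (u x) + lam * ‖gradient u x‖ ^ 2 + mu)

open Set MeasureTheory Filter Topology

/-- Euclidean space. -/
abbrev EN (N : ℕ) := EuclideanSpace ℝ (Fin N)

/-- A pair of radial kernels with `∇θ(z) = - η(z) z`. -/
structure Ker {N : ℕ} (θ η : EN N → ℝ) : Prop where
  cd : ContDiff ℝ 1 θ
  der : ∀ z v, fderiv ℝ θ z v = - (η z * inner ℝ z v)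
  cη : Continuous η
  θ0 : ∀ z, 0 ≤ θ z
  η0 : ∀ z, 0 ≤ η z
  iθ : Integrable θ
  iη : Integrable η
  izη : Integrable (fun z => ‖z‖ * η z)
  one : ∫ z, η z = 1

theorem pd_contDiff {N : ℕ} {h : EN N → ℝ} (hh : ContDiff ℝ 2 h) (v : EN N) :
    ContDiff ℝ 1 (fun y => fderiv ℝ h y v) :=
  (hh.fderiv_right (m := 1) (by norm_num)).clm_apply contDiff_const

theorem pd_supp {N : ℕ} {h : EN N → ℝ} (hs : HasCompactSupport h) (v : EN N) :
    HasCompactSupport (fun y => fderiv ℝ h y v) := hs.fderiv_apply (𝕜 := ℝ) v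

theorem lap_cont {N : ℕ} {h : EN N → ℝ} (hh : ContDiff ℝ 2 h) : Continuous (lap h) := by
  unfold lap
  refine continuous_finsetSum _ fun i _ => ?_
  exact ((pd_contDiff hh _).continuous_fderiv (by norm_num)).clm_apply continuous_const

theorem lap_supp {N : ℕ} {h : EN N → ℝ} (hs : HasCompactSupport h) :
    HasCompactSupport (lap h) := by
  have : lap h = fun x => ∑ i : Fin N,
    fderiv ℝ (fun y => fderiv ℝ h y (EuclideanSpace.single i 1)) x (EuclideanSpace.single i 1) := rfl
  rw [this]
  refine HasCompactSupport.intro (K := tsupport h) hs fun x hx => ?_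
  refine Finset.sum_eq_zero fun i _ => ?_
  have h1 : (fun y => fderiv ℝ h y (EuclideanSpace.single i (1:ℝ))) =ᶠ[𝓝 x] fun _ => 0 := by
    have : ∀ᶠ y in 𝓝 x, y ∉ tsupport h := (isClosed_tsupport h).isOpen_compl.mem_nhds hx
    filter_upwards [this] with y hy
    have : fderiv ℝ h y = 0 := by
      by_contra hne
      exact hy (support_fderiv_subset ℝ hne)
    rw [this]; rfl
  rw [h1.fderiv_eq]; simp

theorem bdd_of_cs {X : Type*} [TopologicalSpace X] {h : X → ℝ} (hc : Continuous h)
    (hs : HasCompactSupport h) : ∃ C, 0 ≤ C ∧ ∀ x, |h x| ≤ C := by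
  obtain ⟨C, hC⟩ := hc.bounded_above_of_compact_support hs
  exact ⟨max C 0, le_max_right _ _, fun x => (hC x).trans (le_max_left _ _)⟩

theorem fderiv_sum_coord {N : ℕ} (L : EN N →L[ℝ] ℝ) (z : EN N) :
    L z = ∑ i : Fin N, z i * L (EuclideanSpace.single i 1) := by
  conv_lhs => rw [← (EuclideanSpace.basisFun (Fin N) ℝ).sum_repr z]
  simp [map_sum]

theorem inner_single {N : ℕ} (z : EN N) (i : Fin N) :
    inner ℝ z (EuclideanSpace.single i (1:ℝ)) = z i := by
  simp [EuclideanSpace.inner_single_right]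

theorem integrable_mul_bdd {X : Type*} [MeasurableSpace X] {μ : Measure X} {f g : X → ℝ}
    (hf : Integrable f μ) (hg : AEStronglyMeasurable g μ) {C : ℝ} (hC : ∀ x, |g x| ≤ C) :
    Integrable (fun x => f x * g x) μ := by
  have := hf.bdd_mul hg (c := C) (Eventually.of_forall fun x => by simpa using hC x)
  simpa [mul_comm] using this

theorem Ker.ibp {N : ℕ} {θ η : EN N → ℝ} (K : Ker θ η) {h : EN N → ℝ} (hh : ContDiff ℝ 2 h)
    (hs : HasCompactSupport h) (x : EN N) (s : ℝ) :
    ∫ z, η z * fderiv ℝ h (x - s • z) (-z) = s * ∫ z, θ z * lap h (x - s • z) := by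
  set e : Fin N → EN N := fun i => EuclideanSpace.single i (1:ℝ) with he
  have aff : ContDiff ℝ 1 (fun z : EN N => x - s • z) := by fun_prop
  have hg : ∀ i, ContDiff ℝ 1 (fun z => fderiv ℝ h (x - s • z) (e i)) := fun i =>
    (pd_contDiff hh (e i)).comp aff
  have hgd : ∀ i z, fderiv ℝ (fun z => fderiv ℝ h (x - s • z) (e i)) z (e i)
      = - s * fderiv ℝ (fun y => fderiv ℝ h y (e i)) (x - s • z) (e i) := by
    intro i z
    have h1 : HasFDerivAt (fun y => fderiv ℝ h y (e i))
        (fderiv ℝ (fun y => fderiv ℝ h y (e i)) (x - s • z)) (x - s • z) :=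
      ((pd_contDiff hh (e i)).differentiable (by norm_num) _).hasFDerivAt
    have h2 : HasFDerivAt (fun z : EN N => x - s • z) (-(s • ContinuousLinearMap.id ℝ (EN N))) z := by
      simpa using ((hasFDerivAt_id z).const_smul s).const_sub x
    have h3 := h1.comp z h2
    have h4 : (fun z => fderiv ℝ h (x - s • z) (e i)) =
      (fun y => fderiv ℝ h y (e i)) ∘ (fun z : EN N => x - s • z) := rfl
    rw [h4, h3.fderiv]
    simp
  have bg : ∀ i, ∃ C, ∀ y, |fderiv ℝ h y (e i)| ≤ C := fun i => by
    obtain ⟨C, -, hC⟩ := bdd_of_cs (pd_contDiff hh (e i)).continuous (pd_supp hs (e i))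
    exact ⟨C, hC⟩
  have bgg : ∀ i, ∃ C, ∀ y, |fderiv ℝ (fun y => fderiv ℝ h y (e i)) y (e i)| ≤ C := fun i => by
    obtain ⟨C, -, hC⟩ := bdd_of_cs
      (((pd_contDiff hh (e i)).continuous_fderiv (by norm_num)).clm_apply continuous_const)
      ((pd_supp hs (e i)).fderiv_apply (𝕜 := ℝ) (e i))
    exact ⟨C, hC⟩
  have cgg : ∀ i, Continuous fun z => fderiv ℝ (fun y => fderiv ℝ h y (e i)) (x - s • z) (e i) :=
    fun i => (((pd_contDiff hh (e i)).continuous_fderiv (by norm_num)).comp aff.continuous).clm_apply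
      continuous_const
  have hηi : ∀ i, Integrable fun z => fderiv ℝ θ z (e i) := by
    intro i
    refine K.izη.mono' ?_ (Eventually.of_forall fun z => ?_)
    · exact ((K.cd.continuous_fderiv (by norm_num)).clm_apply continuous_const).aestronglyMeasurable
    · rw [K.der, inner_single, norm_neg, norm_mul, mul_comm, Real.norm_of_nonneg (K.η0 z)]
      exact mul_le_mul_of_nonneg_right (PiLp.norm_apply_le z i) (K.η0 z)
  have I1 : ∀ i, Integrable fun z => fderiv ℝ θ z (e i) * fderiv ℝ h (x - s • z) (e i) := by
    intro i
    obtain ⟨C, hC⟩ := bg i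
    exact integrable_mul_bdd (hηi i) (hg i).continuous.aestronglyMeasurable (C := C) fun z => hC _
  have I2 : ∀ i, Integrable fun z => θ z *
      fderiv ℝ (fun y => fderiv ℝ h y (e i)) (x - s • z) (e i) := by
    intro i
    obtain ⟨C, hC⟩ := bgg i
    exact integrable_mul_bdd K.iθ (cgg i).aestronglyMeasurable (C := C) fun z => hC _
  have key : ∀ i, ∫ z, fderiv ℝ θ z (e i) * fderiv ℝ h (x - s • z) (e i)
      = s * ∫ z, θ z * fderiv ℝ (fun y => fderiv ℝ h y (e i)) (x - s • z) (e i) := by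
    intro i
    have := integral_mul_fderiv_eq_neg_fderiv_mul_of_integrable (μ := volume) (f := θ)
      (g := fun z => fderiv ℝ h (x - s • z) (e i)) (v := e i) (I1 i) ?_ ?_ ?_ ?_
    · rw [eq_neg_iff_add_eq_zero, add_comm, ← eq_neg_iff_add_eq_zero] at this
      rw [this, ← integral_const_mul, ← integral_neg]
      congr 1; ext z
      rw [hgd]; ring
    · have := (I2 i).const_mul (-s)
      refine this.congr (Eventually.of_forall fun z => ?_)
      simp only [hgd]; ring
    · obtain ⟨C, hC⟩ := bg i
      exact integrable_mul_bdd K.iθ (hg i).continuous.aestronglyMeasurable (C := C) fun z => hC _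
    · exact fun z _ => K.cd.differentiable (by norm_num) z
    · exact fun z _ => (hg i).differentiable (by norm_num) z
  have L : ∀ z, η z * fderiv ℝ h (x - s • z) (-z)
      = ∑ i, fderiv ℝ θ z (e i) * fderiv ℝ h (x - s • z) (e i) := by
    intro z
    rw [map_neg, fderiv_sum_coord (fderiv ℝ h (x - s • z)) z, mul_neg, Finset.mul_sum,
      ← Finset.sum_neg_distrib]
    refine Finset.sum_congr rfl fun i _ => ?_
    rw [K.der, inner_single]; ring
  have R : ∀ z, θ z * lap h (x - s • z)
      = ∑ i, θ z * fderiv ℝ (fun y => fderiv ℝ h y (e i)) (x - s • z) (e i) := by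
    intro z; rw [lap, Finset.mul_sum]
  simp_rw [L, R]
  rw [integral_finsetSum _ fun i _ => I1 i, integral_finsetSum _ fun i _ => I2 i, Finset.mul_sum]
  exact Finset.sum_congr rfl fun i _ => key i

theorem Ker.flow {N : ℕ} {θ η : EN N → ℝ} (K : Ker θ η) {h : EN N → ℝ} (hh : ContDiff ℝ 2 h)
    (hs : HasCompactSupport h) (x : EN N) (s : ℝ) :
    HasDerivAt (fun s : ℝ => ∫ z, η z * h (x - s • z)) (s * ∫ z, θ z * lap h (x - s • z)) s := by
  rw [← K.ibp hh hs x s]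
  obtain ⟨C, hC⟩ : ∃ C, ∀ y, ‖fderiv ℝ h y‖ ≤ C :=
    (hh.continuous_fderiv (by norm_num)).bounded_above_of_compact_support (hs.fderiv (𝕜 := ℝ))
  obtain ⟨C', -, hC'⟩ := bdd_of_cs hh.continuous hs
  have cont : ∀ s : ℝ, Continuous fun z : EN N => x - s • z := fun s => by fun_prop
  refine (hasDerivAt_integral_of_dominated_loc_of_deriv_le (s := univ)
    (F' := fun s z => η z * fderiv ℝ h (x - s • z) (-z))
    (bound := fun z => ‖z‖ * η z * C) univ_mem ?_ ?_ ?_ ?_ ?_ ?_).2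
  · exact Eventually.of_forall fun s =>
      (K.cη.mul (hh.continuous.comp (cont s))).aestronglyMeasurable
  · exact integrable_mul_bdd K.iη (hh.continuous.comp (cont s)).aestronglyMeasurable
      (C := C') fun z => hC' _
  · exact (K.cη.mul (((hh.continuous_fderiv (by norm_num)).comp (cont s)).clm_apply
      continuous_neg)).aestronglyMeasurable
  · refine Eventually.of_forall fun z s _ => ?_
    rw [norm_mul, Real.norm_of_nonneg (K.η0 z)]
    have := (fderiv ℝ h (x - s • z)).le_opNorm (-z)
    rw [norm_neg] at this
    have h2 : ‖fderiv ℝ h (x - s • z)‖ * ‖z‖ ≤ C * ‖z‖ :=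
      mul_le_mul_of_nonneg_right (hC _) (norm_nonneg _)
    calc _ ≤ η z * (C * ‖z‖) := mul_le_mul_of_nonneg_left (this.trans h2) (K.η0 z)
      _ = _ := by ring
  · exact K.izη.mul_const C
  · refine Eventually.of_forall fun z s _ => ?_
    have h1 : HasFDerivAt h (fderiv ℝ h (x - s • z)) (x - s • z) :=
      (hh.differentiable (by norm_num) _).hasFDerivAt
    have h2 : HasDerivAt (fun s : ℝ => x - s • z) (-z) s := by
      simpa using ((hasDerivAt_id s).smul_const z).const_sub x
    exact (h1.comp_hasDerivAt s h2).const_mul (η z)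

open Set MeasureTheory Filter Topology
open scoped ContDiff

/-! ### The compactly supported kernel and the Gaussian kernel -/

theorem exists_compact_kernel (N : ℕ) [NeZero N] : ∃ θ η : EN N → ℝ, Ker θ η ∧
    ContDiff ℝ ∞ θ ∧ ContDiff ℝ ∞ η ∧ (∀ z, 1 ≤ ‖z‖ → θ z = 0) ∧ (∀ z, 1 ≤ ‖z‖ → η z = 0) ∧
    0 < θ 0 := by
  set st := Real.smoothTransition
  have hst : ContDiff ℝ ∞ st := Real.smoothTransition.contDiff
  have hst' : ContDiff ℝ ∞ (deriv st) := (contDiff_infty_iff_deriv.1 hst).2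
  set θ0 : EN N → ℝ := fun z => st (1 - ‖z‖ ^ 2)
  set η0 : EN N → ℝ := fun z => 2 * deriv st (1 - ‖z‖ ^ 2)
  have hn : ContDiff ℝ ∞ fun z : EN N => 1 - ‖z‖ ^ 2 := contDiff_const.sub (contDiff_norm_sq ℝ)
  have hθ : ContDiff ℝ ∞ θ0 := hst.comp hn
  have hη : ContDiff ℝ ∞ η0 := contDiff_const.mul (hst'.comp hn)
  have hder0 : ∀ t ≤ 0, deriv st t = 0 := by
    intro t ht
    have h1 : ∀ t < 0, deriv st t = 0 := by
      intro t ht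
      have : st =ᶠ[𝓝 t] fun _ => 0 := by
        filter_upwards [gt_mem_nhds ht] with y hy
        exact Real.smoothTransition.zero_of_nonpos hy.le
      rw [this.deriv_eq]; simp
    rcases ht.lt_or_eq with h | h
    · exact h1 t h
    · subst h
      have hc : Tendsto (deriv st) (𝓝[<] 0) (𝓝 (deriv st 0)) :=
        (hst'.continuous.tendsto 0).mono_left nhdsWithin_le_nhds
      have hc' : Tendsto (deriv st) (𝓝[<] 0) (𝓝 0) := by
        refine tendsto_const_nhds.congr' ?_
        filter_upwards [self_mem_nhdsWithin] with y hy
        exact (h1 y hy).symm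
      exact tendsto_nhds_unique hc hc'
  have hθz : ∀ z : EN N, 1 ≤ ‖z‖ → θ0 z = 0 := fun z hz =>
    Real.smoothTransition.zero_of_nonpos (by nlinarith)
  have hηz : ∀ z : EN N, 1 ≤ ‖z‖ → η0 z = 0 := fun z hz => by
    simp only [η0]; rw [hder0 _ (by nlinarith)]; simp
  have csθ : HasCompactSupport θ0 := HasCompactSupport.intro (isCompact_closedBall 0 1) fun z hz =>
    hθz z (by simp at hz; exact hz.le)
  have csη : HasCompactSupport η0 := HasCompactSupport.intro (isCompact_closedBall 0 1) fun z hz =>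
    hηz z (by simp at hz; exact hz.le)
  have η0n : ∀ z, 0 ≤ η0 z := fun z =>
    mul_nonneg (by norm_num) (Real.smoothTransition.monotone.deriv_nonneg)
  have hd : ∀ z v : EN N, fderiv ℝ θ0 z v = - (η0 z * inner ℝ z v) := by
    intro z v
    have h1 : HasFDerivAt (fun z : EN N => 1 - ‖z‖ ^ 2) (-(2 • innerSL ℝ z)) z :=
      (hasStrictFDerivAt_norm_sq z).hasFDerivAt.const_sub 1
    have h2 : HasDerivAt st (deriv st (1 - ‖z‖ ^ 2)) (1 - ‖z‖ ^ 2) :=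
      (hst.differentiable (by simp) _).hasDerivAt
    have h3 := h2.comp_hasFDerivAt z h1
    have h4 : θ0 = st ∘ fun z : EN N => 1 - ‖z‖ ^ 2 := rfl
    rw [h4, h3.fderiv]
    simp [η0]; ring
  have iη : Integrable η0 := hη.continuous.integrable_of_hasCompactSupport csη
  have cpos : 0 < ∫ z, η0 z := by
    rw [integral_pos_iff_support_of_nonneg η0n iη]
    refine hη.continuous.isOpen_support.measure_pos _ ?_
    by_contra hne
    rw [Set.not_nonempty_iff_eq_empty, Function.support_eq_empty_iff] at hne
    have hz : ∀ z, fderiv ℝ θ0 z = 0 := fun z => by ext v; rw [hd, hne]; simp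
    have hc := is_const_of_fderiv_eq_zero (𝕜 := ℝ) (hθ.differentiable (by simp)) hz 0
      (EuclideanSpace.single (0 : Fin N) 1)
    rw [hθz (EuclideanSpace.single (0 : Fin N) 1) (by simp)] at hc
    simp [θ0, st] at hc
  set c := ∫ z, η0 z
  refine ⟨fun z => c⁻¹ * θ0 z, fun z => c⁻¹ * η0 z, ?_, contDiff_const.mul hθ, contDiff_const.mul hη,
    fun z hz => by simp [hθz z hz], fun z hz => by simp [hηz z hz], ?_⟩
  · refine ⟨(contDiff_const.mul hθ).of_le (by exact_mod_cast le_top), ?_, (contDiff_const.mul hη).continuous, ?_, ?_, ?_, ?_, ?_, ?_⟩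
    · intro z v
      rw [fderiv_const_mul (hθ.differentiable (by simp) z)]
      simp [hd]; ring
    · exact fun z => mul_nonneg (inv_nonneg.2 cpos.le) (Real.smoothTransition.nonneg _)
    · exact fun z => mul_nonneg (inv_nonneg.2 cpos.le) (η0n z)
    · exact (hθ.continuous.integrable_of_hasCompactSupport csθ).const_mul _
    · exact iη.const_mul _
    · refine Continuous.integrable_of_hasCompactSupport ?_ ?_
      · exact continuous_norm.mul (continuous_const.mul hη.continuous)
      · exact (csη.mul_left (f := fun _ => c⁻¹)).mul_left (f := fun z => ‖z‖)
    · rw [integral_const_mul]; exact inv_mul_cancel₀ cpos.ne'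
  · have : 0 < θ0 0 := by simp [θ0, st]
    positivity

theorem integrable_gauss (N : ℕ) (b : ℝ) (hb : 0 < b) :
    Integrable fun z : EN N => Real.exp (-b * ‖z‖ ^ 2) := by
  have := (GaussianFourier.integrable_cexp_neg_mul_sq_norm_add (V := EN N) (b := (b : ℂ))
    (by simpa using hb) 0 0).norm
  refine this.congr (Eventually.of_forall fun z => ?_)
  simp [Complex.norm_exp]
  norm_cast
  exact Or.inl rfl

theorem exists_gauss_kernel (N : ℕ) : ∃ γ : EN N → ℝ, Ker γ γ := by
  set g0 : EN N → ℝ := fun z => Real.exp (-(1/2) * ‖z‖ ^ 2)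
  have hn : ContDiff ℝ ∞ fun z : EN N => -(1/2) * ‖z‖ ^ 2 := contDiff_const.mul (contDiff_norm_sq ℝ)
  have hg : ContDiff ℝ ∞ g0 := Real.contDiff_exp.comp hn
  have ig : Integrable g0 := integrable_gauss N (1/2) (by norm_num)
  have hd : ∀ z v : EN N, fderiv ℝ g0 z v = - (g0 z * inner ℝ z v) := by
    intro z v
    have h1 : HasFDerivAt (fun z : EN N => -(1/2) * ‖z‖ ^ 2) ((-(1/2) : ℝ) • (2 • innerSL ℝ z)) z :=
      (hasStrictFDerivAt_norm_sq z).hasFDerivAt.const_mul _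
    have h3 := h1.exp
    rw [show fderiv ℝ g0 z = _ from h3.fderiv]
    simp [g0]
  have cpos : 0 < ∫ z, g0 z := by
    have : 0 < ∫ z : EN N, Real.exp (-(1/2) * ‖z‖ ^ 2) := by
      rw [GaussianFourier.integral_rexp_neg_mul_sq_norm (by norm_num : (0:ℝ) < 1/2)]
      positivity
    exact this
  set c := ∫ z, g0 z
  have ci : 0 ≤ c⁻¹ := inv_nonneg.2 cpos.le
  refine ⟨fun z => c⁻¹ * g0 z, (contDiff_const.mul hg).of_le (by exact_mod_cast le_top), ?_, (contDiff_const.mul hg).continuous,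
    fun z => mul_nonneg ci (Real.exp_pos _).le, fun z => mul_nonneg ci (Real.exp_pos _).le,
    ig.const_mul _, ig.const_mul _, ?_, ?_⟩
  · intro z v
    rw [fderiv_const_mul (hg.differentiable (by simp) z)]
    simp [hd]; ring
  · have := ((integrable_gauss N (1/4) (by norm_num)).const_mul (2 * c⁻¹))
    refine this.mono' ?_ (Eventually.of_forall fun z => ?_)
    · exact (continuous_norm.mul (continuous_const.mul hg.continuous)).aestronglyMeasurable
    · rw [Real.norm_of_nonneg (mul_nonneg (norm_nonneg _) (mul_nonneg ci (Real.exp_pos _).le))]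
      have h1 : g0 z = Real.exp (-(1/4) * ‖z‖ ^ 2) * Real.exp (-(1/4) * ‖z‖ ^ 2) := by
        simp only [g0]; rw [← Real.exp_add]; ring_nf
      have h2 : ‖z‖ * Real.exp (-(1/4) * ‖z‖ ^ 2) ≤ 2 := by
        have h3 := Real.add_one_le_exp ((1/4) * ‖z‖ ^ 2)
        have h4 : Real.exp (-(1/4) * ‖z‖ ^ 2) * Real.exp ((1/4) * ‖z‖ ^ 2) = 1 := by
          rw [← Real.exp_add]; simp
        have h5 : ‖z‖ ≤ 2 * Real.exp ((1/4) * ‖z‖ ^ 2) := by nlinarith [sq_nonneg (‖z‖ - 2)]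
        calc _ ≤ 2 * Real.exp ((1/4) * ‖z‖ ^ 2) * Real.exp (-(1/4) * ‖z‖ ^ 2) :=
              mul_le_mul_of_nonneg_right h5 (Real.exp_pos _).le
          _ = 2 := by rw [mul_assoc, mul_comm (Real.exp _), h4, mul_one]
      change ‖z‖ * (c⁻¹ * g0 z) ≤ _
      rw [h1]
      have h6 := (Real.exp_pos (-(1/4) * ‖z‖ ^ 2)).le
      calc _ = c⁻¹ * (Real.exp (-(1/4) * ‖z‖ ^ 2)) * (‖z‖ * Real.exp (-(1/4) * ‖z‖ ^ 2)) := by ring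
        _ ≤ c⁻¹ * (Real.exp (-(1/4) * ‖z‖ ^ 2)) * 2 := mul_le_mul_of_nonneg_left h2 (by positivity)
        _ = _ := by ring
  · rw [integral_const_mul]; exact inv_mul_cancel₀ cpos.ne'

open Set MeasureTheory Filter Topology
open scoped ContDiff

/-- compact kernel `θ` -/
noncomputable def thC (N : ℕ) [NeZero N] : EN N → ℝ := (exists_compact_kernel N).choose
/-- compact kernel `η` -/
noncomputable def etC (N : ℕ) [NeZero N] : EN N → ℝ := (exists_compact_kernel N).choose_spec.choose
theorem thC_spec (N : ℕ) [NeZero N] : Ker (thC N) (etC N) ∧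
    ContDiff ℝ ∞ (thC N) ∧ ContDiff ℝ ∞ (etC N) ∧ (∀ z, 1 ≤ ‖z‖ → thC N z = 0) ∧
    (∀ z, 1 ≤ ‖z‖ → etC N z = 0) ∧ 0 < thC N 0 := (exists_compact_kernel N).choose_spec.choose_spec
/-- Gaussian kernel -/
noncomputable def gaK (N : ℕ) : EN N → ℝ := (exists_gauss_kernel N).choose
theorem gaK_spec (N : ℕ) : Ker (gaK N) (gaK N) := (exists_gauss_kernel N).choose_spec

/-- The finite measure with density given by a nonnegative function. -/
noncomputable def dens {X : Type*} [MeasureSpace X] (m : X → ℝ) : Measure X :=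
  volume.withDensity fun s => ENNReal.ofReal (m s)

theorem dens_finite {X : Type*} [MeasureSpace X] {m : X → ℝ} (hm : Integrable m) :
    IsFiniteMeasure (dens m) := by
  unfold dens
  exact isFiniteMeasure_withDensity_ofReal hm.2

theorem integral_dens {X : Type*} [MeasureSpace X] {m : X → ℝ} (hm : Measurable m)
    (h0 : ∀ s, 0 ≤ m s) (f : X → ℝ) : ∫ s, f s ∂(dens m) = ∫ s, m s * f s := by
  unfold dens
  rw [integral_withDensity_eq_integral_toReal_smul (by fun_prop) (by simp)]
  simp [ENNReal.toReal_ofReal (h0 _)]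

/-- Push-forward of `m(s) θ(z)` under `(s, z) ↦ s z`. -/
noncomputable def gm {N : ℕ} (m : ℝ → ℝ) (θ : EN N → ℝ) : Measure (EN N) :=
  ((dens m).prod (dens θ)).map fun p => p.1 • p.2

theorem gm_finite {N : ℕ} {m : ℝ → ℝ} {θ : EN N → ℝ} (hm : Integrable m) (hθ : Integrable θ) :
    IsFiniteMeasure (gm m θ) := by
  have := dens_finite hm
  have := dens_finite hθ
  unfold gm
  infer_instance

theorem integral_gm {N : ℕ} {m : ℝ → ℝ} {θ : EN N → ℝ} (hm : Integrable m) (hθ : Integrable θ)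
    (mm : Measurable m) (mθ : Measurable θ) (m0 : ∀ s, 0 ≤ m s) (θ0 : ∀ s, 0 ≤ θ s)
    {f : EN N → ℝ} (hf : Measurable f) {C : ℝ} (hC : ∀ x, |f x| ≤ C) :
    ∫ y, f y ∂(gm m θ) = ∫ s, m s * ∫ z, θ z * f (s • z) := by
  have i1 := dens_finite hm
  have i2 := dens_finite hθ
  unfold gm
  have mf : Measurable fun p : ℝ × EN N => p.1 • p.2 := by fun_prop
  rw [integral_map mf.aemeasurable hf.aestronglyMeasurable, integral_prod, integral_dens mm m0]
  · congr 1; ext s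
    rw [integral_dens mθ θ0]
  · exact Integrable.of_bound (hf.comp mf).aestronglyMeasurable C
      (Eventually.of_forall fun x => hC _)

theorem gm_univ {N : ℕ} {m : ℝ → ℝ} {θ : EN N → ℝ} (hm : Integrable m) (hθ : Integrable θ)
    (mm : Measurable m) (mθ : Measurable θ) (m0 : ∀ s, 0 ≤ m s) (θ0 : ∀ s, 0 ≤ θ s) :
    (gm m θ).real univ = (∫ s, m s) * ∫ z, θ z := by
  have := integral_gm hm hθ mm mθ m0 θ0 (f := fun _ => 1) measurable_const (C := 1) (by simp)
  have h := gm_finite (N := N) hm hθ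
  simp only [integral_const, smul_eq_mul, mul_one] at this
  rw [this, integral_mul_const]

theorem dens_null {X : Type*} [MeasureSpace X] {m : X → ℝ} (hm : Measurable m) {S : Set X}
    (hS : MeasurableSet S) (h : ∀ x ∈ S, m x = 0) : dens m S = 0 := by
  unfold dens
  rw [withDensity_apply _ hS]
  rw [setLIntegral_congr_fun hS (g := fun _ => 0) fun x hx => by simp [h x hx]]
  simp

theorem gm_null {N : ℕ} {m : ℝ → ℝ} {θ : EN N → ℝ} (hm : Integrable m) (hθ : Integrable θ)
    (mm : Measurable m) (mθ : Measurable θ) {r : ℝ}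
    (hr : ∀ s, s ∉ Ioc 0 r → m s = 0) (h1 : ∀ z, 1 ≤ ‖z‖ → θ z = 0) :
    gm m θ (Metric.closedBall 0 r)ᶜ = 0 := by
  have i1 := dens_finite hm
  have i2 := dens_finite hθ
  unfold gm
  have mf : Measurable fun p : ℝ × EN N => p.1 • p.2 := by fun_prop
  rw [Measure.map_apply mf Metric.isClosed_closedBall.measurableSet.compl]
  have sub : (fun p : ℝ × EN N => p.1 • p.2) ⁻¹' (Metric.closedBall 0 r)ᶜ ⊆
      (Ioc 0 r)ᶜ ×ˢ univ ∪ univ ×ˢ {z | 1 ≤ ‖z‖} := by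
    rintro ⟨s, z⟩ h
    by_contra hc
    simp only [mem_union, mem_prod, mem_compl_iff, mem_univ, and_true, true_and, mem_ofPred_eq,
      not_or, not_not, not_le] at hc
    apply h
    simp only [Metric.mem_closedBall, dist_zero_right, norm_smul, Real.norm_eq_abs,
      abs_of_pos hc.1.1]
    nlinarith [hc.1.1, hc.1.2, hc.2, norm_nonneg z]
  refine measure_mono_null sub (measure_union_null ?_ ?_)
  · rw [Measure.prod_prod, dens_null mm measurableSet_Ioc.compl fun s hs => hr s hs, zero_mul]
  · rw [Measure.prod_prod, dens_null mθ (measurableSet_le measurable_const measurable_norm)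
      fun z hz => h1 z hz, mul_zero]

section
variable {N : ℕ} [NeZero N]

/-- averaging measure at scale `r` -/
noncomputable def am (N : ℕ) [NeZero N] (r : ℝ) : Measure (EN N) :=
  (dens (etC N)).map fun z => r • z

/-- weight -/
noncomputable def wP (r : ℝ) : ℝ → ℝ := (Ioc 0 r).indicator id

/-- potential measure at scale `r` -/
noncomputable def pm (N : ℕ) [NeZero N] (r : ℝ) : Measure (EN N) := gm (wP r) (thC N)

theorem wP_meas (r : ℝ) : Measurable (wP r) := measurable_id.indicator measurableSet_Ioc
theorem wP_nonneg (r s : ℝ) : 0 ≤ wP r s := indicator_nonneg (fun _ h => h.1.le) _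
theorem wP_int (r : ℝ) : Integrable (wP r) := by
  unfold wP
  rw [integrable_indicator_iff measurableSet_Ioc]
  exact (continuous_id.integrableOn_Icc (a := 0) (b := r)).mono_set Ioc_subset_Icc_self

instance {r : ℝ} : IsProbabilityMeasure (am N r) := by
  have K := (thC_spec N).1
  have h1 : IsProbabilityMeasure (dens (etC N)) := by
    refine ⟨?_⟩
    unfold dens
    rw [withDensity_apply _ MeasurableSet.univ, Measure.restrict_univ,
      ← ofReal_integral_eq_lintegral_ofReal K.iη (Eventually.of_forall K.η0), K.one]
    simp
  unfold am
  exact Measure.isProbabilityMeasure_map (by fun_prop)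

instance {r : ℝ} : IsFiniteMeasure (pm N r) := gm_finite (wP_int r) (thC_spec N).1.iθ

theorem am_null {r : ℝ} (hr : 0 < r) : am N r (Metric.closedBall 0 r)ᶜ = 0 := by
  unfold am
  rw [Measure.map_apply (by fun_prop) Metric.isClosed_closedBall.measurableSet.compl]
  refine dens_null (thC_spec N).1.cη.measurable ?_ ?_
  · exact (Metric.isClosed_closedBall.measurableSet.compl).preimage (by fun_prop)
  · intro z hz
    refine (thC_spec N).2.2.2.2.1 z ?_
    by_contra hc
    apply hz
    simp only [Metric.mem_closedBall, dist_zero_right, norm_smul, Real.norm_eq_abs, abs_of_pos hr]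
    nlinarith [norm_nonneg z]

theorem pm_null {r : ℝ} : pm N r (Metric.closedBall 0 r)ᶜ = 0 :=
  gm_null (wP_int r) (thC_spec N).1.iθ (wP_meas r) (thC_spec N).1.cd.continuous.measurable
    (fun _ hs => indicator_of_notMem hs _) (thC_spec N).2.2.2.1

theorem integral_am (r : ℝ) {f : EN N → ℝ} (hf : Measurable f) :
    ∫ y, f y ∂(am N r) = ∫ z, etC N z * f (r • z) := by
  unfold am
  rw [integral_map (by fun_prop) hf.aestronglyMeasurable,
    integral_dens (thC_spec N).1.cη.measurable (thC_spec N).1.η0]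

theorem integral_pm (r : ℝ) {f : EN N → ℝ} (hf : Measurable f) {C : ℝ} (hC : ∀ x, |f x| ≤ C) :
    ∫ y, f y ∂(pm N r) = ∫ s in Ioc 0 r, s * ∫ z, thC N z * f (s • z) := by
  unfold pm
  rw [integral_gm (wP_int r) (thC_spec N).1.iθ (wP_meas r) (thC_spec N).1.cd.continuous.measurable
    (wP_nonneg r) (thC_spec N).1.θ0 hf hC, ← integral_indicator measurableSet_Ioc]
  congr 1; ext s
  by_cases hs : s ∈ Ioc 0 r <;> simp [wP, hs]

theorem pm_pos {r : ℝ} (hr : 0 < r) : 0 < (pm N r).real univ := by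
  have K := (thC_spec N).1
  unfold pm
  rw [gm_univ (wP_int r) K.iθ (wP_meas r) K.cd.continuous.measurable (wP_nonneg r) K.θ0]
  refine mul_pos ?_ ?_
  · unfold wP
    rw [integral_indicator measurableSet_Ioc, ← intervalIntegral.integral_of_le hr.le]
    simp only [id, integral_id]
    have := pow_pos hr 2
    linarith
  · rw [integral_pos_iff_support_of_nonneg K.θ0 K.iθ]
    exact K.cd.continuous.isOpen_support.measure_pos _ ⟨0, (thC_spec N).2.2.2.2.2.ne'⟩

/-- locally bounded and measurable on `U` -/
def Good (U : Set (EN N)) (f : EN N → ℝ) : Prop :=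
  Measurable (U.indicator f) ∧ ∀ K ⊆ U, IsCompact K → ∃ C, ∀ x ∈ K, |f x| ≤ C

theorem ContinuousOn.good {U : Set (EN N)} (hU : IsOpen U) {f : EN N → ℝ} (hf : ContinuousOn f U) :
    Good U f := by
  refine ⟨?_, fun K hK hc => ?_⟩
  · classical
    have := hf.measurable_piecewise (continuousOn_const (c := (0:ℝ)) (s := Uᶜ)) hU.measurableSet
    convert this using 1
    ext x; by_cases hx : x ∈ U <;> simp [hx]
  · obtain ⟨C, hC⟩ := hc.exists_bound_of_continuousOn (hf.mono hK)
    exact ⟨C, hC⟩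

theorem ae_of_null {μ : Measure (EN N)} {r : ℝ} (h : μ (Metric.closedBall 0 r)ᶜ = 0) (x : EN N) :
    ∀ᵐ y ∂μ, x - y ∈ Metric.closedBall x r := by
  have : ∀ᵐ y ∂μ, y ∈ Metric.closedBall (0 : EN N) r := h
  filter_upwards [this] with y hy
  simpa using hy

theorem Good.aesm {U : Set (EN N)} {f : EN N → ℝ} (hf : Good U f) {μ : Measure (EN N)}
    {r : ℝ} (h : μ (Metric.closedBall 0 r)ᶜ = 0) {x : EN N}
    (hx : Metric.closedBall x r ⊆ U) : AEStronglyMeasurable (fun y => f (x - y)) μ := by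
  have m : Measurable fun y => U.indicator f (x - y) := hf.1.comp (by fun_prop)
  refine m.aestronglyMeasurable.congr ?_
  filter_upwards [ae_of_null h x] with y hy
  simp [hx hy]

theorem Good.integrable {U : Set (EN N)} {f : EN N → ℝ} (hf : Good U f) {μ : Measure (EN N)}
    [IsFiniteMeasure μ] {r : ℝ} (h : μ (Metric.closedBall 0 r)ᶜ = 0) {x : EN N}
    (hx : Metric.closedBall x r ⊆ U) : Integrable (fun y => f (x - y)) μ := by
  obtain ⟨C, hC⟩ := hf.2 _ hx (isCompact_closedBall x r)
  refine Integrable.of_bound (hf.aesm h hx) C ?_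
  filter_upwards [ae_of_null h x] with y hy
  exact hC _ hy

/-- `u` satisfies the mean value form of `-Δu = f` in `U`. -/
def MV (U : Set (EN N)) (u f : EN N → ℝ) : Prop :=
  ∀ x r, 0 < r → Metric.closedBall x r ⊆ U →
    u x = ∫ y, u (x - y) ∂(am N r) + ∫ y, f (x - y) ∂(pm N r)

theorem MV.mono {U V : Set (EN N)} {u f : EN N → ℝ} (h : MV U u f) (hV : V ⊆ U) : MV V u f :=
  fun x r hr hx => h x r hr (hx.trans hV)

theorem MV.congr {U : Set (EN N)} {u f u' f' : EN N → ℝ} (h : MV U u f)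
    (hu : ∀ x ∈ U, u x = u' x) (hf : ∀ x ∈ U, f x = f' x) : MV U u' f' := by
  intro x r hr hx
  rw [← hu x (hx (Metric.mem_closedBall_self hr.le)), h x r hr hx]
  congr 1
  · refine integral_congr_ae ?_
    filter_upwards [ae_of_null (am_null hr) x] with y hy using hu _ (hx hy)
  · refine integral_congr_ae ?_
    filter_upwards [ae_of_null (pm_null (r := r)) x] with y hy using hf _ (hx hy)

theorem MV.comb {U : Set (EN N)} {u f v g : EN N → ℝ} (h : MV U u f) (h' : MV U v g)
    (hu : Good U u) (hf : Good U f) (hv : Good U v) (hg : Good U g) (a b : ℝ) :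
    MV U (fun x => a * u x + b * v x) (fun x => a * f x + b * g x) := by
  intro x r hr hx
  show a * u x + b * v x = _
  rw [integral_add ((hu.integrable (am_null hr) hx).const_mul a)
    ((hv.integrable (am_null hr) hx).const_mul b),
    integral_add ((hf.integrable pm_null hx).const_mul a)
    ((hg.integrable pm_null hx).const_mul b), integral_const_mul, integral_const_mul,
    integral_const_mul, integral_const_mul, h x r hr hx, h' x r hr hx]
  ring

theorem MV.const (U : Set (EN N)) (c : ℝ) : MV U (fun _ => c) (fun _ => 0) := by
  intro x r hr hx; simp

theorem MV.limit {U : Set (EN N)} {u f : ℕ → EN N → ℝ} {v g : EN N → ℝ}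
    (h : ∀ n, MV U (u n) (f n)) (hu : ∀ n, Good U (u n)) (hf : ∀ n, Good U (f n))
    (hub : ∀ K ⊆ U, IsCompact K → ∃ C, ∀ n, ∀ x ∈ K, |u n x| ≤ C)
    (hfb : ∀ K ⊆ U, IsCompact K → ∃ C, ∀ n, ∀ x ∈ K, |f n x| ≤ C)
    (hv : ∀ x ∈ U, Tendsto (fun n => u n x) atTop (𝓝 (v x)))
    (hg : ∀ x ∈ U, Tendsto (fun n => f n x) atTop (𝓝 (g x))) :
    MV U v g ∧ Good U v ∧ Good U g := by
  refine ⟨?_, ?_, ?_⟩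
  · intro x r hr hx
    have h1 := hv x (hx (Metric.mem_closedBall_self hr.le))
    have h2 : Tendsto (fun n => u n x) atTop
        (𝓝 (∫ y, v (x - y) ∂(am N r) + ∫ y, g (x - y) ∂(pm N r))) := by
      simp_rw [fun n => h n x r hr hx]
      obtain ⟨C, hC⟩ := hub _ hx (isCompact_closedBall x r)
      obtain ⟨C', hC'⟩ := hfb _ hx (isCompact_closedBall x r)
      refine Tendsto.add ?_ ?_
      · refine tendsto_integral_of_dominated_convergence (fun _ => C)
          (fun n => (hu n).aesm (am_null hr) hx) (integrable_const _) (fun n => ?_) ?_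
        · filter_upwards [ae_of_null (am_null hr) x] with y hy using hC n _ hy
        · filter_upwards [ae_of_null (am_null hr) x] with y hy using hv _ (hx hy)
      · refine tendsto_integral_of_dominated_convergence (fun _ => C')
          (fun n => (hf n).aesm pm_null hx) (integrable_const _) (fun n => ?_) ?_
        · filter_upwards [ae_of_null (pm_null (r := r)) x] with y hy using hC' n _ hy
        · filter_upwards [ae_of_null (pm_null (r := r)) x] with y hy using hg _ (hx hy)
    exact tendsto_nhds_unique h1 h2
  · refine ⟨?_, fun K hK hc => ?_⟩
    · refine measurable_of_tendsto_metrizable (fun n => (hu n).1) (tendsto_pi_nhds.2 fun x => ?_)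
      by_cases hx : x ∈ U
      · simpa [hx] using hv x hx
      · simp [hx]
    · obtain ⟨C, hC⟩ := hub K hK hc
      exact ⟨C, fun x hx => le_of_tendsto (hv x (hK hx)).abs (Eventually.of_forall fun n => hC n x hx)⟩
  · refine ⟨?_, fun K hK hc => ?_⟩
    · refine measurable_of_tendsto_metrizable (fun n => (hf n).1) (tendsto_pi_nhds.2 fun x => ?_)
      by_cases hx : x ∈ U
      · simpa [hx] using hg x hx
      · simp [hx]
    · obtain ⟨C, hC⟩ := hfb K hK hc
      exact ⟨C, fun x hx => le_of_tendsto (hg x (hK hx)).abs (Eventually.of_forall fun n => hC n x hx)⟩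

/-- Interior maximum principle. -/
theorem MV.no_max {U : Set (EN N)} (hU : IsOpen U) {D k : EN N → ℝ} (h : MV U D k)
    (hD : Good U D) (hk : Good U k) {x : EN N} (hx : x ∈ U) (hkc : ContinuousAt k x)
    (hmax : ∀ y ∈ U, D y ≤ D x) : 0 ≤ k x := by
  by_contra! hneg
  have h1 : ∀ᶠ y in 𝓝 x, k y < k x / 2 := hkc.eventually_lt continuousAt_const (by linarith)
  obtain ⟨r, hr, hb⟩ := Metric.nhds_basis_closedBall.mem_iff.1 (h1.and (hU.mem_nhds hx))
  have hbU : Metric.closedBall x r ⊆ U := fun y hy => (hb hy).2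
  have e := h x r hr hbU
  have e1 : ∫ y, D (x - y) ∂(am N r) ≤ ∫ y, D x ∂(am N r) := by
    refine integral_mono_ae (hD.integrable (am_null hr) hbU) (integrable_const _) ?_
    filter_upwards [ae_of_null (am_null hr) x] with y hy using hmax _ (hbU hy)
  have e2 : ∫ y, k (x - y) ∂(pm N r) ≤ ∫ y, k x / 2 ∂(pm N r) := by
    refine integral_mono_ae (hk.integrable pm_null hbU) (integrable_const _) ?_
    filter_upwards [ae_of_null (pm_null (r := r)) x] with y hy using (hb hy).1.le
  simp only [integral_const, smul_eq_mul, probReal_univ, one_mul] at e1 e2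
  have := pm_pos (N := N) hr
  nlinarith

/-- Comparison on a bounded open set. -/
theorem MV.comparison {U : Set (EN N)} (hU : IsOpen U) (hb : Bornology.IsBounded U)
    {D k : EN N → ℝ} (h : MV U D k) (hD : ContinuousOn D (closure U)) (hk : ContinuousOn k U)
    (hbd : ∀ x ∈ frontier U, D x ≤ 0) (hneg : ∀ x ∈ U, 0 < D x → k x < 0) :
    ∀ x ∈ U, D x ≤ 0 := by
  by_contra! hc
  obtain ⟨x1, hx1, hpos⟩ := hc
  obtain ⟨x0, hx0, hmax⟩ := hb.isCompact_closure.exists_isMaxOn ⟨x1, subset_closure hx1⟩ hD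
  have h0 : 0 < D x0 := hpos.trans_le (hmax (subset_closure hx1))
  have hx0U : x0 ∈ U := by
    by_contra hn
    have : x0 ∈ frontier U := ⟨hx0, by rwa [hU.interior_eq]⟩
    linarith [hbd x0 this]
  have := MV.no_max hU h ((hD.mono subset_closure).good hU) (hk.good hU) hx0U
    (hk.continuousAt (hU.mem_nhds hx0U)) fun y hy => hmax (subset_closure hy)
  linarith [hneg x0 hx0U h0]
end

open Set MeasureTheory Filter Topology
open scoped ContDiff
set_option linter.unusedSectionVars false

section
variable {N : ℕ}

theorem lap_congr {u v : EN N → ℝ} {x : EN N} (h : u =ᶠ[𝓝 x] v) : lap u x = lap v x := by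
  unfold lap
  refine Finset.sum_congr rfl fun i _ => ?_
  have : (fun y => fderiv ℝ u y (EuclideanSpace.single i 1)) =ᶠ[𝓝 x]
      (fun y => fderiv ℝ v y (EuclideanSpace.single i 1)) := by
    filter_upwards [h.fderiv (𝕜 := ℝ)] with y hy
    rw [hy]
  rw [this.fderiv_eq]

theorem exists_cutoff {U : Set (EN N)} (hU : IsOpen U) {u : EN N → ℝ} (hu : ContDiffOn ℝ 2 u U)
    {x : EN N} {r : ℝ} (hr : 0 < r) (hx : Metric.closedBall x r ⊆ U) :
    ∃ h : EN N → ℝ, ContDiff ℝ 2 h ∧ HasCompactSupport h ∧ ∃ R, r < R ∧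
      ∀ y ∈ Metric.ball x R, h y = u y := by
  obtain ⟨δ, hδ, hδU⟩ := (isCompact_closedBall x r).exists_cthickening_subset_open hU hx
  rw [cthickening_closedBall hδ.le hr.le] at hδU
  let b : ContDiffBump x := ⟨r + δ / 2, r + δ, by linarith, by linarith⟩
  have hsub : tsupport b ⊆ U := by
    rw [b.tsupport_eq]
    convert hδU using 2
    show r + δ = _
    ring
  refine ⟨fun y => b y * u y, ?_, b.hasCompactSupport.mul_right, r + δ / 2, by linarith, ?_⟩
  · rw [contDiff_iff_contDiffAt]
    intro y
    by_cases hy : y ∈ tsupport b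
    · exact b.contDiff.contDiffAt.mul (hu.contDiffAt (hU.mem_nhds (hsub hy)))
    · have : (fun y => b y * u y) =ᶠ[𝓝 y] fun _ => 0 := by
        filter_upwards [notMem_tsupport_iff_eventuallyEq.1 hy] with z hz
        simp [hz]
      exact contDiffAt_const.congr_of_eventuallyEq this
  · intro y hy
    have : b y = 1 := b.one_of_mem_closedBall (Metric.ball_subset_closedBall hy)
    simp [this]

theorem lap_continuousOn {U : Set (EN N)} (hU : IsOpen U) {u : EN N → ℝ}
    (hu : ContDiffOn ℝ 2 u U) : ContinuousOn (lap u) U := by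
  intro x hx
  obtain ⟨r, hr, hb⟩ := Metric.nhds_basis_closedBall.mem_iff.1 (hU.mem_nhds hx)
  obtain ⟨h, h1, h2, R, hR, h3⟩ := exists_cutoff hU hu hr hb
  have : lap u =ᶠ[𝓝 x] lap h := by
    filter_upwards [Metric.ball_mem_nhds x (hr.trans hR)] with y hy
    refine lap_congr ?_
    filter_upwards [Metric.isOpen_ball.mem_nhds hy] with z hz using (h3 z hz).symm
  exact ((lap_cont h1).continuousAt.congr this.symm).continuousWithinAt

variable [NeZero N]

theorem MV_of_Cc {h : EN N → ℝ} (h1 : ContDiff ℝ 2 h) (h2 : HasCompactSupport h)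
    (U : Set (EN N)) : MV U h (fun x => - lap h x) := by
  intro x r hr _
  have K := (thC_spec N).1
  obtain ⟨C, hC0, hC⟩ := bdd_of_cs (lap_cont h1) (lap_supp h2)
  have hl := lap_cont h1
  have hc := h1.continuous
  rw [integral_neg, integral_am r (f := fun y => h (x - y)) (by fun_prop),
    integral_pm r (f := fun y => lap h (x - y)) (C := C) (by fun_prop) fun y => hC _]
  have ct : Continuous fun s : ℝ => s * ∫ z, thC N z * lap h (x - s • z) := by
    refine continuous_id.mul ?_
    refine continuous_of_dominated (bound := fun z => thC N z * C) (fun s => ?_) (fun s => ?_) ?_ ?_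
    · exact (K.cd.continuous.mul (by fun_prop)).aestronglyMeasurable
    · refine Eventually.of_forall fun z => ?_
      rw [norm_mul, Real.norm_of_nonneg (K.θ0 z)]
      exact mul_le_mul_of_nonneg_left (hC _) (K.θ0 z)
    · exact K.iθ.mul_const C
    · exact Eventually.of_forall fun z => by fun_prop
  have := intervalIntegral.integral_eq_sub_of_hasDerivAt (a := 0) (b := r)
    (fun s _ => K.flow h1 h2 x s) (ct.intervalIntegrable 0 r)
  rw [intervalIntegral.integral_of_le hr.le] at this
  rw [this]
  simp [integral_mul_const, K.one]

theorem MV_of_C2 {U : Set (EN N)} (hU : IsOpen U) {u : EN N → ℝ} (hu : ContDiffOn ℝ 2 u U) :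
    MV U u (fun x => - lap u x) := by
  intro x r hr hx
  obtain ⟨h, h1, h2, R, hR, h3⟩ := exists_cutoff hU hu hr hx
  refine (MV_of_Cc h1 h2 (Metric.ball x R)).congr (f' := fun x => - lap u x) h3 ?_ x r hr
    (Metric.closedBall_subset_ball hR)
  intro y hy
  congr 1
  refine lap_congr ?_
  filter_upwards [Metric.isOpen_ball.mem_nhds hy] with z hz using (h3 z hz)

/-- weight for the Yukawa potential -/
noncomputable def wK (K : ℝ) : ℝ → ℝ := (Ioi 0).indicator fun s => s * Real.exp (-(K / 2) * s ^ 2)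

/-- Yukawa measure -/
noncomputable def nuK (N : ℕ) (K : ℝ) : Measure (EN N) := gm (wK K) (gaK N)

theorem wK_meas (K : ℝ) : Measurable (wK K) :=
  (Continuous.measurable (by fun_prop)).indicator measurableSet_Ioi
theorem wK_nonneg (K s : ℝ) : 0 ≤ wK K s :=
  indicator_nonneg (fun _ h => mul_nonneg (le_of_lt h) (Real.exp_nonneg _)) _
theorem wK_int {K : ℝ} (hK : 0 < K) : Integrable (wK K) :=
  (integrable_mul_exp_neg_mul_sq (half_pos hK)).indicator measurableSet_Ioi

theorem nuK_finite {K : ℝ} (hK : 0 < K) : IsFiniteMeasure (nuK N K) :=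
  gm_finite (wK_int hK) (gaK_spec N).iθ

theorem exp_tendsto {K : ℝ} (hK : 0 < K) :
    Tendsto (fun s : ℝ => Real.exp (-(K / 2) * s ^ 2)) atTop (𝓝 0) := by
  refine Real.tendsto_exp_atBot.comp ?_
  exact (tendsto_pow_atTop two_ne_zero).const_mul_atTop_of_neg (by linarith)

theorem exp_deriv (K s : ℝ) : HasDerivAt (fun s : ℝ => Real.exp (-(K / 2) * s ^ 2))
    (-K * (s * Real.exp (-(K / 2) * s ^ 2))) s := by
  refine (((hasDerivAt_pow 2 s).const_mul (-(K/2))).exp).congr_deriv ?_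
  simp only [Nat.cast_ofNat, Nat.add_one_sub_one, pow_one]
  ring

theorem integral_wK {K : ℝ} (f : ℝ → ℝ) :
    ∫ s, wK K s * f s = ∫ s in Ioi 0, s * Real.exp (-(K / 2) * s ^ 2) * f s := by
  rw [← integral_indicator measurableSet_Ioi]
  congr 1; ext s
  by_cases hs : s ∈ Ioi (0:ℝ) <;> simp [wK, hs]

theorem nuK_univ {K : ℝ} (hK : 0 < K) : (nuK N K).real univ = 1 / K := by
  have k := gaK_spec N
  unfold nuK
  rw [gm_univ (wK_int hK) k.iθ (wK_meas K) k.cη.measurable (wK_nonneg K) k.θ0, k.one, mul_one]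
  have := integral_Ioi_of_hasDerivAt_of_tendsto' (a := 0) (fun s _ => exp_deriv K s)
    (((integrable_mul_exp_neg_mul_sq (half_pos hK)).const_mul (-K)).integrableOn) (exp_tendsto hK)
  rw [integral_const_mul] at this
  have h2 := integral_wK (K := K) (fun _ => 1)
  simp only [mul_one] at h2
  rw [h2, eq_div_iff hK.ne']
  simp [-neg_mul] at this
  linarith

/-- Yukawa potential -/
noncomputable def Yk (K : ℝ) (h : EN N → ℝ) (x : EN N) : ℝ := ∫ y, h (x - y) ∂(nuK N K)

theorem Yk_lap {K : ℝ} (hK : 0 < K) {h : EN N → ℝ} (h1 : ContDiff ℝ 2 h)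
    (h2 : HasCompactSupport h) (x : EN N) : Yk K (lap h) x = K * Yk K h x - h x := by
  have k := gaK_spec N
  obtain ⟨C, hC0, hC⟩ := bdd_of_cs (lap_cont h1) (lap_supp h2)
  obtain ⟨C', hC0', hC'⟩ := bdd_of_cs h1.continuous h2
  have hl := lap_cont h1
  have hc := h1.continuous
  unfold Yk nuK
  rw [integral_gm (wK_int hK) k.iθ (wK_meas K) k.cη.measurable (wK_nonneg K) k.θ0
    (f := fun y => h (x - y)) (by fun_prop) (fun y => hC' _),
    integral_gm (wK_int hK) k.iθ (wK_meas K) k.cη.measurable (wK_nonneg K) k.θ0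
    (f := fun y => lap h (x - y)) (by fun_prop) (fun y => hC _), integral_wK, integral_wK]
  have bd : ∀ (f : EN N → ℝ) (C : ℝ), Continuous f → (∀ y, |f y| ≤ C) → ∀ s : ℝ,
      |∫ z, gaK N z * f (x - s • z)| ≤ C := by
    intro f C hf hC s
    rw [← Real.norm_eq_abs]
    calc _ ≤ ∫ z, gaK N z * C := by
          refine norm_integral_le_of_norm_le (k.iθ.mul_const C) (Eventually.of_forall fun z => ?_)
          rw [norm_mul, Real.norm_of_nonneg (k.θ0 z)]
          exact mul_le_mul_of_nonneg_left (hC _) (k.θ0 z)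
      _ = C := by rw [integral_mul_const, k.one, one_mul]
  have ct : ∀ (f : EN N → ℝ) (C : ℝ), Continuous f → (∀ y, |f y| ≤ C) →
      Continuous fun s : ℝ => ∫ z, gaK N z * f (x - s • z) := by
    intro f C hf hC
    refine continuous_of_dominated (bound := fun z => gaK N z * C) (fun s => ?_) (fun s => ?_) ?_ ?_
    · exact (k.cη.mul (by fun_prop)).aestronglyMeasurable
    · refine Eventually.of_forall fun z => ?_
      rw [norm_mul, Real.norm_of_nonneg (k.θ0 z)]
      exact mul_le_mul_of_nonneg_left (hC _) (k.θ0 z)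
    · exact k.iθ.mul_const C
    · exact Eventually.of_forall fun z => by fun_prop
  have ig : ∀ (f : EN N → ℝ) (C : ℝ), Continuous f → (∀ y, |f y| ≤ C) →
      Integrable fun s : ℝ => s * Real.exp (-(K / 2) * s ^ 2) * ∫ z, gaK N z * f (x - s • z) := by
    intro f C hf hC
    exact (integrable_mul_exp_neg_mul_sq (half_pos hK)).mul_bdd (c := C)
      (ct f C hf hC).aestronglyMeasurable (Eventually.of_forall (bd f C hf hC))
  have hd : ∀ s : ℝ, HasDerivAt (fun s : ℝ => Real.exp (-(K / 2) * s ^ 2) *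
      ∫ z, gaK N z * h (x - s • z))
      (s * Real.exp (-(K / 2) * s ^ 2) * (∫ z, gaK N z * lap h (x - s • z)) -
      K * (s * Real.exp (-(K / 2) * s ^ 2) * (∫ z, gaK N z * h (x - s • z)))) s := by
    intro s
    refine ((exp_deriv K s).mul (k.flow h1 h2 x s)).congr_deriv ?_
    ring
  have tend : Tendsto (fun s : ℝ => Real.exp (-(K / 2) * s ^ 2) *
      ∫ z, gaK N z * h (x - s • z)) atTop (𝓝 0) := by
    refine squeeze_zero_norm (a := fun s => Real.exp (-(K / 2) * s ^ 2) * C') (fun s => ?_) ?_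
    · rw [norm_mul, Real.norm_of_nonneg (Real.exp_nonneg _)]
      exact mul_le_mul_of_nonneg_left (bd h C' hc hC' s) (Real.exp_nonneg _)
    · simpa using (exp_tendsto hK).mul_const C'
  have := integral_Ioi_of_hasDerivAt_of_tendsto' (a := 0) (fun s _ => hd s)
    (((ig _ C hl hC).sub ((ig _ C' hc hC').const_mul K)).integrableOn) tend
  rw [integral_sub (ig _ C hl hC).integrableOn ((ig _ C' hc hC').const_mul K).integrableOn,
    integral_const_mul] at this
  simp [integral_mul_const, k.one, -neg_mul] at this
  linarith
end

open Set MeasureTheory Filter Topology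
open scoped ContDiff
set_option linter.unusedSectionVars false

section
variable {N : ℕ} [NeZero N]

theorem bint {μ : Measure (EN N)} [IsFiniteMeasure μ] {f : EN N → ℝ} (hf : Measurable f) {C : ℝ}
    (hC : ∀ x, |f x| ≤ C) (x : EN N) : Integrable (fun y => f (x - y)) μ :=
  Integrable.of_bound (hf.comp (by fun_prop)).aestronglyMeasurable C
    (Eventually.of_forall fun y => hC _)

theorem Yk_meas (K : ℝ) (hK : 0 < K) {h : EN N → ℝ} (hm : Measurable h) : Measurable (Yk K h) := by
  have := nuK_finite (N := N) hK
  unfold Yk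
  have : StronglyMeasurable (Function.uncurry fun (x y : EN N) => h (x - y)) :=
    (hm.comp (measurable_fst.sub measurable_snd)).stronglyMeasurable
  exact this.integral_prod_right.measurable

theorem Yk_bdd {K : ℝ} (hK : 0 < K) {h : EN N → ℝ} (_ : Measurable h) {C : ℝ}
    (hC : ∀ x, |h x| ≤ C) (x : EN N) : |Yk K h x| ≤ C / K := by
  have := nuK_finite (N := N) hK
  have := norm_integral_le_of_norm_le_const (μ := nuK N K) (f := fun y => h (x - y)) (C := C)
    (Eventually.of_forall fun y => hC _)
  rw [nuK_univ hK] at this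
  calc _ ≤ _ := this
    _ = _ := by ring

theorem Yk_mono {K : ℝ} (hK : 0 < K) {h h' : EN N → ℝ} (hm : Measurable h) {C : ℝ}
    (hC : ∀ x, |h x| ≤ C) (hm' : Measurable h') {C' : ℝ}
    (hC' : ∀ x, |h' x| ≤ C') (hle : ∀ x, h x ≤ h' x) (x : EN N) : Yk K h x ≤ Yk K h' x := by
  have := nuK_finite (N := N) hK
  exact integral_mono (bint hm hC x) (bint hm' hC' x) fun y => hle _

theorem int_swap {μ ν : Measure (EN N)} [IsFiniteMeasure μ] [IsFiniteMeasure ν] {f : EN N → ℝ}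
    (hf : Measurable f) {C : ℝ}
    (hC : ∀ x, |f x| ≤ C) (x : EN N) :
    ∫ y, ∫ z, f (x - y - z) ∂ν ∂μ = ∫ z, ∫ y, f (x - z - y) ∂μ ∂ν := by
  rw [integral_integral_swap]
  · congr 1; ext z; congr 1; ext y; rw [sub_right_comm]
  · refine Integrable.of_bound (C := C) ?_ (Eventually.of_forall fun y => hC _)
    exact (hf.comp (by fun_prop : Measurable fun p : EN N × EN N => x - p.1 - p.2)).aestronglyMeasurable

theorem int_conv {μ ν : Measure (EN N)} [IsFiniteMeasure μ] [IsFiniteMeasure ν] {f : EN N → ℝ}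
    (hf : Measurable f) {C : ℝ} (hC : ∀ x, |f x| ≤ C) :
    ∫ y, f y ∂((μ.prod ν).map fun p => p.1 + p.2) = ∫ y, ∫ z, f (y + z) ∂ν ∂μ := by
  have mf : Measurable fun p : EN N × EN N => p.1 + p.2 := by fun_prop
  rw [integral_map mf.aemeasurable hf.aestronglyMeasurable, integral_prod]
  refine Integrable.of_bound (C := C) ?_ (Eventually.of_forall fun y => hC _)
  exact (hf.comp mf).aestronglyMeasurable

theorem Yk_MV_test {K : ℝ} (hK : 0 < K) {h : EN N → ℝ} (h1 : ContDiff ℝ 2 h)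
    (h2 : HasCompactSupport h) : MV univ (Yk K h) (fun x => h x - K * Yk K h x) := by
  intro x r hr _
  have := nuK_finite (N := N) hK
  obtain ⟨C, hC0, hC⟩ := bdd_of_cs (lap_cont h1) (lap_supp h2)
  obtain ⟨C', hC0', hC'⟩ := bdd_of_cs h1.continuous h2
  have ml := (lap_cont h1).measurable
  have mh := h1.continuous.measurable
  have e : ∀ y, h (x - y) = ∫ z, h (x - y - z) ∂(am N r) - ∫ z, lap h (x - y - z) ∂(pm N r) := by
    intro y
    have := MV_of_Cc h1 h2 univ (x - y) r hr (subset_univ _)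
    rw [integral_neg] at this
    rw [this]; ring
  have e1 : ∀ y, h y - K * Yk K h y = - Yk K (lap h) y := fun y => by
    rw [Yk_lap hK h1 h2]; ring
  simp_rw [e1]
  rw [integral_neg]
  have s1 := int_swap (μ := nuK N K) (ν := am N r) mh hC' x
  have s2 := int_swap (μ := nuK N K) (ν := pm N r) ml hC x
  unfold Yk at *
  rw [← s1, ← s2, ← sub_eq_add_neg, ← integral_sub]
  · congr 1; ext y; exact e y
  · refine Integrable.of_bound (C := C' * (am N r).real univ) ?_ (Eventually.of_forall fun y => ?_)
    · have : StronglyMeasurable (Function.uncurry fun (y z : EN N) => h (x - y - z)) :=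
        (mh.comp (by fun_prop : Measurable fun p : EN N × EN N => x - p.1 - p.2)).stronglyMeasurable
      exact this.integral_prod_right.aestronglyMeasurable
    · exact norm_integral_le_of_norm_le_const (Eventually.of_forall fun z => hC' _)
  · refine Integrable.of_bound (C := C * (pm N r).real univ) ?_ (Eventually.of_forall fun y => ?_)
    · have : StronglyMeasurable (Function.uncurry fun (y z : EN N) => lap h (x - y - z)) :=
        (ml.comp (by fun_prop : Measurable fun p : EN N × EN N => x - p.1 - p.2)).stronglyMeasurable
      exact this.integral_prod_right.aestronglyMeasurable
    · exact norm_integral_le_of_norm_le_const (Eventually.of_forall fun z => hC _)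

theorem meas_ext {μ ν : Measure (EN N)} [IsFiniteMeasure μ] [IsFiniteMeasure ν]
    (h : ∀ f : EN N → ℝ, ContDiff ℝ 2 f → HasCompactSupport f → ∫ x, f x ∂μ = ∫ x, f x ∂ν) :
    μ = ν := by
  refine Measure.ext_of_integral_eq_on_compactlySupported fun f => ?_
  have key : ∀ ε > 0, |∫ x, f x ∂μ - ∫ x, f x ∂ν| ≤ ε * (μ.real univ + ν.real univ) := by
    intro ε hε
    obtain ⟨g, g1, g2, g3⟩ := f.continuous.exists_contDiff_approx 2 (continuous_const (y := ε))
      fun _ => hε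
    have gs : HasCompactSupport g := f.hasCompactSupport.mono g3
    obtain ⟨C, -, hC⟩ := bdd_of_cs g1.continuous gs
    obtain ⟨C', -, hC'⟩ := bdd_of_cs f.continuous f.hasCompactSupport
    have ig : ∀ ρ : Measure (EN N), IsFiniteMeasure ρ → Integrable g ρ := fun ρ _ =>
      Integrable.of_bound g1.continuous.aestronglyMeasurable C (Eventually.of_forall hC)
    have iff : ∀ ρ : Measure (EN N), IsFiniteMeasure ρ → Integrable f ρ := fun ρ _ =>
      Integrable.of_bound f.continuous.aestronglyMeasurable C' (Eventually.of_forall hC')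
    have b : ∀ ρ : Measure (EN N), IsFiniteMeasure ρ →
        |∫ x, g x ∂ρ - ∫ x, f x ∂ρ| ≤ ε * ρ.real univ := by
      intro ρ _
      rw [← integral_sub (ig ρ ‹_›) (iff ρ ‹_›), ← Real.norm_eq_abs]
      refine norm_integral_le_of_norm_le_const (μ := ρ) (Eventually.of_forall fun z => ?_)
      have := g2 z
      rw [Real.dist_eq] at this
      exact this.le
    have b1 := abs_le.1 (b μ ‹_›)
    have b2 := abs_le.1 (b ν ‹_›)
    have := h g g1 gs
    rw [abs_le]
    constructor <;> nlinarith
  have h0 : |∫ x, f x ∂μ - ∫ x, f x ∂ν| ≤ 0 := by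
    have t : Tendsto (fun ε : ℝ => ε * (μ.real univ + ν.real univ)) (𝓝[>] 0) (𝓝 0) := by
      have : Tendsto (fun ε : ℝ => ε * (μ.real univ + ν.real univ)) (𝓝 0)
        (𝓝 (0 * (μ.real univ + ν.real univ))) := (continuous_id.mul continuous_const).tendsto 0
      rw [zero_mul] at this
      exact this.mono_left nhdsWithin_le_nhds
    exact ge_of_tendsto t (by filter_upwards [self_mem_nhdsWithin] with ε hε using key ε hε)
  exact sub_eq_zero.1 (abs_eq_zero.1 (le_antisymm h0 (abs_nonneg _)))

theorem Yk_MV {K : ℝ} (hK : 0 < K) {h : EN N → ℝ} (hm : Measurable h) {C : ℝ}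
    (hC : ∀ x, |h x| ≤ C) : MV univ (Yk K h) (fun x => h x - K * Yk K h x) := by
  intro x r hr _
  have := nuK_finite (N := N) hK
  have key : nuK N K + ENNReal.ofReal K • ((pm N r).prod (nuK N K)).map (fun p => p.1 + p.2) =
      ((am N r).prod (nuK N K)).map (fun p => p.1 + p.2) + pm N r := by
    have : IsFiniteMeasure (ENNReal.ofReal K • ((pm N r).prod (nuK N K)).map (fun p => p.1 + p.2)) :=
      Measure.smul_finite _ (by simp)
    refine meas_ext fun f f1 f2 => ?_
    obtain ⟨C, -, hC⟩ := bdd_of_cs f1.continuous f2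
    have mf := f1.continuous.measurable
    have ig : ∀ ρ : Measure (EN N), IsFiniteMeasure ρ → Integrable f ρ := fun ρ _ =>
      Integrable.of_bound f1.continuous.aestronglyMeasurable C (Eventually.of_forall hC)
    rw [integral_add_measure (ig _ ‹_›) (ig _ ‹_›), integral_add_measure (ig _ inferInstance)
      (ig _ inferInstance), integral_smul_measure, int_conv mf hC, int_conv mf hC]
    have t := Yk_MV_test hK (h := fun y => f (-y)) (f1.comp contDiff_neg)
      (f2.comp_homeomorph (Homeomorph.neg _)) 0 r hr (subset_univ _)
    have m2 : Measurable fun y => f (-y) := mf.comp measurable_neg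
    have m3 := Yk_meas K hK m2
    rw [integral_sub (bint m2 (fun y => hC _) _) ((bint m3 (Yk_bdd hK m2 fun y => hC _) 0).const_mul K),
      integral_const_mul] at t
    simp [Yk] at t
    simp [ENNReal.toReal_ofReal hK.le]
    simp only [add_comm] at t ⊢
    linarith
  have : IsFiniteMeasure (ENNReal.ofReal K • ((pm N r).prod (nuK N K)).map (fun p => p.1 + p.2)) :=
      Measure.smul_finite _ (by simp)
  have k2 := congrArg (fun ρ : Measure (EN N) => ∫ y, h (x - y) ∂ρ) key
  have mx : Measurable fun y => h (x - y) := hm.comp (by fun_prop)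
  have mY := Yk_meas K hK hm
  rw [integral_add_measure (bint hm hC x) (bint hm hC x), integral_add_measure (bint hm hC x)
      (bint hm hC x), integral_smul_measure, int_conv mx (fun y => hC _),
      int_conv mx (fun y => hC _)] at k2
  rw [integral_sub (bint hm hC _) ((bint mY (Yk_bdd hK hm hC) _).const_mul K), integral_const_mul]
  simp only [Yk, sub_sub]
  simp only [ENNReal.toReal_ofReal hK.le, smul_eq_mul] at k2
  linarith
end

open Set MeasureTheory Filter Topology
open scoped ContDiff
set_option linter.unusedSectionVars false

section
variable {N : ℕ} [NeZero N] {F : Type*} [NormedAddCommGroup F] [NormedSpace ℝ F]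

/-- scaled convolution -/
noncomputable def Jc (f : EN N → ℝ) (s : ℝ) (k : EN N → F) (x : EN N) : F :=
  ∫ z, f (x - s • z) • k z

open scoped Convolution in
theorem Jc_eq (f : EN N → ℝ) {s : ℝ} (hs : s ≠ 0) (k : EN N → F) :
    Jc f s k = fun x => |(s ^ Module.finrank ℝ (EN N))⁻¹| •
      (MeasureTheory.convolution f (fun y => k (s⁻¹ • y)) (ContinuousLinearMap.lsmul ℝ ℝ) volume) x := by
  ext x
  unfold Jc
  have e := Measure.integral_comp_smul volume (fun z => f (x - z) • k (s⁻¹ • z)) s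
  simp only [inv_smul_smul₀ hs] at e
  rw [e, ← integral_sub_left_eq_self _ volume x]
  simp [MeasureTheory.convolution]

theorem loc_int {f : EN N → ℝ} (hf : Measurable f) {C : ℝ} (hC : ∀ x, |f x| ≤ C) :
    LocallyIntegrable f := by
  rw [locallyIntegrable_iff]
  intro k hk
  exact Measure.integrableOn_of_bounded (M := C) hk.measure_lt_top.ne hf.aestronglyMeasurable
    (Eventually.of_forall hC)

theorem Jc_contDiff {n : ℕ∞} {f : EN N → ℝ} (hf : Measurable f) {C : ℝ} (hC : ∀ x, |f x| ≤ C)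
    {s : ℝ} (hs : s ≠ 0)
    {k : EN N → F} (hk : ContDiff ℝ n k) (hc : HasCompactSupport k) : ContDiff ℝ n (Jc f s k) := by
  rw [Jc_eq f hs]
  refine ContDiff.const_smul _ ?_
  refine HasCompactSupport.contDiff_convolution_right _ ?_ (loc_int hf hC) ?_
  · exact hc.comp_homeomorph (Homeomorph.smulOfNeZero s⁻¹ (inv_ne_zero hs))
  · exact hk.comp (contDiff_const_smul _)

theorem Jc_hasFDerivAt {f : EN N → ℝ} (hf : Measurable f) {C : ℝ} (hC : ∀ x, |f x| ≤ C)
    {s : ℝ} (hs : s ≠ 0)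
    {k : EN N → F} (hk : ContDiff ℝ 1 k) (hc : HasCompactSupport k) (x : EN N) :
    HasFDerivAt (Jc f s k) (s⁻¹ • Jc f s (fderiv ℝ k) x) x := by
  have d := HasCompactSupport.hasFDerivAt_convolution_right (ContinuousLinearMap.lsmul ℝ ℝ)
    (hc.comp_homeomorph (Homeomorph.smulOfNeZero s⁻¹ (inv_ne_zero hs))) (loc_int hf hC)
    (hk.comp (contDiff_const_smul s⁻¹)) x
  have d2 := d.const_smul |(s ^ Module.finrank ℝ (EN N))⁻¹|
  rw [Jc_eq f hs, Jc_eq f hs]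
  refine HasFDerivAt.congr_fderiv d2 ?_
  symm
  show s⁻¹ • |(s ^ Module.finrank ℝ (EN N))⁻¹| • _ = _
  rw [smul_comm]
  congr 1
  simp only [MeasureTheory.convolution]
  rw [← integral_smul]
  congr 1; ext1 t
  have e : fderiv ℝ (k ∘ fun y => s⁻¹ • y) (x - t) = s⁻¹ • fderiv ℝ k (s⁻¹ • (x - t)) := by
    have : HasFDerivAt (fun y : EN N => s⁻¹ • y) (s⁻¹ • ContinuousLinearMap.id ℝ (EN N)) (x - t) :=
      (hasFDerivAt_id (𝕜 := ℝ) (x - t)).const_smul s⁻¹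
    rw [(((hk.differentiable one_ne_zero _).hasFDerivAt).comp (x - t) this).fderiv]
    ext v; simp
  ext v
  have e' : fderiv ℝ (k ∘ ⇑(Homeomorph.smulOfNeZero s⁻¹ (inv_ne_zero hs))) (x - t) =
    s⁻¹ • fderiv ℝ k (s⁻¹ • (x - t)) := e
  rw [ContinuousLinearMap.precompR_apply, e']
  simp only [smul_apply, ContinuousLinearMap.lsmul_apply]
  rw [smul_comm]
  rfl

theorem cs_int {k : EN N → F} (hk : Continuous k) (hc : HasCompactSupport k) : Integrable k :=
  hk.integrable_of_hasCompactSupport hc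

theorem integral_fderiv_zero {k : EN N → F} (hk : ContDiff ℝ 1 k) (hc : HasCompactSupport k) :
    ∫ z, fderiv ℝ k z = 0 := by
  have h := Jc_hasFDerivAt (f := fun _ : EN N => (1:ℝ)) measurable_const (C := 1) (by simp)
    one_ne_zero hk hc 0
  have h2 : Jc (fun _ : EN N => (1:ℝ)) 1 k = fun _ => ∫ z, k z := by ext x; simp [Jc]
  rw [h2] at h
  have := h.unique (hasFDerivAt_const _ _)
  simpa [Jc] using this

theorem Jc_bdd {f : EN N → ℝ} {C : ℝ} (hC : ∀ x, |f x| ≤ C)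
    (s : ℝ) {k : EN N → F} (hk : Integrable k) (x : EN N) :
    ‖Jc f s k x‖ ≤ C * ∫ z, ‖k z‖ := by
  unfold Jc
  rw [← integral_const_mul]
  refine norm_integral_le_of_norm_le (hk.norm.const_mul C) (Eventually.of_forall fun z => ?_)
  rw [norm_smul]
  exact mul_le_mul_of_nonneg_right (hC _) (norm_nonneg _)

theorem Jc_meas {f : EN N → ℝ} (hf : Measurable f) {k : EN N → F} (hk : Continuous k) (x : EN N) :
    StronglyMeasurable fun s => Jc f s k x := by
  unfold Jc
  have : StronglyMeasurable (Function.uncurry fun (s : ℝ) (z : EN N) => f (x - s • z) • k z) := by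
    refine StronglyMeasurable.smul ?_ ?_
    · exact (hf.comp (by fun_prop : Measurable fun p : ℝ × EN N => x - p.1 • p.2)).stronglyMeasurable
    · exact hk.stronglyMeasurable.comp_measurable measurable_snd
  exact this.integral_prod_right

/-- local potential -/
noncomputable def Pot (f : EN N → ℝ) (r : ℝ) (x : EN N) : ℝ :=
  ∫ s in Ioc 0 r, s * Jc f s (thC N) x
/-- gradient of the local potential -/
noncomputable def DPot (f : EN N → ℝ) (r : ℝ) (x : EN N) : EN N →L[ℝ] ℝ :=
  ∫ s in Ioc 0 r, Jc f s (fderiv ℝ (thC N)) x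
theorem thC_supp : HasCompactSupport (thC N) := by
  refine HasCompactSupport.intro (isCompact_closedBall 0 1) fun x hx => ?_
  refine (thC_spec N).2.2.2.1 x ?_
  simp at hx
  exact hx.le
theorem etC_supp : HasCompactSupport (etC N) := by
  refine HasCompactSupport.intro (isCompact_closedBall 0 1) fun x hx => ?_
  refine (thC_spec N).2.2.2.2.1 x ?_
  simp at hx
  exact hx.le

theorem Pot_hasFDerivAt {f : EN N → ℝ} (hf : Measurable f) {C : ℝ} (hC : ∀ x, |f x| ≤ C)
    (r : ℝ) (x : EN N) : HasFDerivAt (Pot f r) (DPot f r x) x := by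
  have hθ := (thC_spec N).2.1
  have hθ1 : ContDiff ℝ 1 (thC N) := hθ.of_le (by exact_mod_cast le_top)
  have cθ := thC_supp (N := N)
  have cD : Continuous (fderiv ℝ (thC N)) := hθ1.continuous_fderiv one_ne_zero
  have iD := cs_int cD (cθ.fderiv (𝕜 := ℝ))
  unfold Pot DPot
  refine hasFDerivAt_integral_of_dominated_of_fderiv_le (s := univ)
    (F' := fun x s => Jc f s (fderiv ℝ (thC N)) x)
    (bound := fun _ => C * ∫ z, ‖fderiv ℝ (thC N) z‖) univ_mem ?_ ?_ ?_ ?_ ?_ ?_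
  · refine Eventually.of_forall fun y => ?_
    exact (stronglyMeasurable_id.mul (Jc_meas hf hθ1.continuous y)).aestronglyMeasurable
  · refine Measure.integrableOn_of_bounded (M := r * (C * ∫ z, ‖thC N z‖)) (by simp)
      (stronglyMeasurable_id.mul (Jc_meas hf hθ1.continuous x)).aestronglyMeasurable ?_
    filter_upwards [ae_restrict_mem measurableSet_Ioc] with s hs
    rw [norm_mul, Real.norm_of_nonneg hs.1.le]
    exact mul_le_mul hs.2 (Jc_bdd hC s (cs_int hθ1.continuous cθ) x) (norm_nonneg _)
      (hs.1.le.trans hs.2)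
  · exact (Jc_meas hf cD x).aestronglyMeasurable
  · exact Eventually.of_forall fun s y _ => Jc_bdd hC s iD y
  · exact integrableOn_const (by simp)
  · filter_upwards [ae_restrict_mem measurableSet_Ioc] with s hs
    intro y _
    have := (Jc_hasFDerivAt hf hC hs.1.ne' hθ1 cθ y).const_mul s
    rwa [smul_smul, mul_inv_cancel₀ hs.1.ne', one_smul] at this

theorem DPot_cont {f : EN N → ℝ} (hf : Measurable f) {C : ℝ} (hC : ∀ x, |f x| ≤ C)
    (r : ℝ) : Continuous (DPot f r) := by
  have hθ := (thC_spec N).2.1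
  have hθ1 : ContDiff ℝ 1 (thC N) := hθ.of_le (by exact_mod_cast le_top)
  have cθ := thC_supp (N := N)
  have cD : Continuous (fderiv ℝ (thC N)) := hθ1.continuous_fderiv one_ne_zero
  have iD := cs_int cD (cθ.fderiv (𝕜 := ℝ))
  unfold DPot
  refine continuous_of_dominated (bound := fun _ => C * ∫ z, ‖fderiv ℝ (thC N) z‖)
    (fun y => (Jc_meas hf cD y).aestronglyMeasurable)
    (fun y => Eventually.of_forall fun s => Jc_bdd hC s iD y) (integrableOn_const (by simp)) ?_
  filter_upwards [ae_restrict_mem measurableSet_Ioc] with s hs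
  refine (Jc_contDiff (n := 0) hf hC hs.1.ne' ?_ (cθ.fderiv (𝕜 := ℝ))).continuous
  exact contDiff_zero.2 cD

theorem Pot_C1 {f : EN N → ℝ} (hf : Measurable f) {C : ℝ} (hC : ∀ x, |f x| ≤ C)
    (r : ℝ) : ContDiff ℝ 1 (Pot f r) := by
  rw [contDiff_one_iff_fderiv]
  refine ⟨fun x => (Pot_hasFDerivAt hf hC r x).differentiableAt, ?_⟩
  rw [funext fun x => (Pot_hasFDerivAt hf hC r x).fderiv]
  exact DPot_cont hf hC r

theorem Jc_holder {f : EN N → ℝ} (hf : Measurable f) {C : ℝ} (hC : ∀ x, |f x| ≤ C)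
    {s : ℝ} (hs : 0 < s) {k : EN N → F} (iD : Integrable k) (i0 : ∫ z, k z = 0)
    (h1 : ∀ z, 1 < ‖z‖ → k z = 0) {H α : ℝ} (hα : 0 ≤ α) (hH : 0 ≤ H) {x : EN N}
    (hh : ∀ z : EN N, ‖z‖ ≤ 1 → |f (x - s • z) - f x| ≤ H * ‖s • z‖ ^ α) :
    ‖s⁻¹ • Jc f s k x‖ ≤ H * (∫ z, ‖k z‖) * s ^ (α - 1) := by
  have e : Jc f s k x = ∫ z, (f (x - s • z) - f x) • k z := by
    unfold Jc
    simp_rw [sub_smul]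
    rw [integral_sub, integral_smul, i0, smul_zero, sub_zero]
    · refine iD.bdd_smul (φ := fun z => f (x - s • z)) C ?_ (Eventually.of_forall fun z => hC _)
      exact (hf.comp (by fun_prop)).aestronglyMeasurable
    · exact iD.smul (f x)
  have key : ‖Jc f s k x‖ ≤ H * s ^ α * ∫ z, ‖k z‖ := by
    rw [e, ← integral_const_mul]
    refine norm_integral_le_of_norm_le (iD.norm.const_mul _) (Eventually.of_forall fun z => ?_)
    by_cases hz : 1 < ‖z‖
    · simp [h1 z hz]
    · rw [norm_smul]
      refine mul_le_mul_of_nonneg_right ?_ (norm_nonneg _)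
      refine (hh z (not_lt.1 hz)).trans ?_
      refine mul_le_mul_of_nonneg_left ?_ hH
      refine Real.rpow_le_rpow (norm_nonneg _) ?_ hα
      rw [norm_smul, Real.norm_of_nonneg hs.le]
      nlinarith [not_lt.1 hz]
  rw [norm_smul, norm_inv, Real.norm_of_nonneg hs.le]
  calc _ ≤ s⁻¹ * (H * s ^ α * ∫ z, ‖k z‖) := mul_le_mul_of_nonneg_left key (inv_nonneg.2 hs.le)
    _ = _ := by rw [Real.rpow_sub_one hs.ne']; field_simp

theorem contDiffOn_one_of {G : Type*} [NormedAddCommGroup G] [NormedSpace ℝ G]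
    {u : EN N → G} {u' : EN N → EN N →L[ℝ] G} {U : Set (EN N)} (hU : IsOpen U)
    (hd : ∀ x ∈ U, HasFDerivAt u (u' x) x) (hc : ContinuousOn u' U) : ContDiffOn ℝ 1 u U := by
  have e1 : (1 : WithTop ℕ∞) = 0 + 1 := by norm_num
  rw [e1, contDiffOn_succ_iff_fderiv_of_isOpen hU]
  refine ⟨fun x hx => (hd x hx).differentiableAt.differentiableWithinAt, by simp, ?_⟩
  rw [contDiffOn_zero]
  exact hc.congr fun x hx => (hd x hx).fderiv

theorem DJ_C1 {f : EN N → ℝ} (hf : Measurable f) {C : ℝ} (hC : ∀ x, |f x| ≤ C)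
    {r : ℝ} {x0 : EN N} {H α : ℝ} (hα : 0 < α) (hH : 0 ≤ H)
    (hh : ∀ x ∈ Metric.closedBall x0 (2 * r), ∀ y ∈ Metric.closedBall x0 (2 * r),
      |f x - f y| ≤ H * ‖x - y‖ ^ α) {k : EN N → F} (hD : ContDiff ℝ 1 k)
    (sD : HasCompactSupport k) (h1 : ∀ z, 1 < ‖z‖ → fderiv ℝ k z = 0) :
    ContDiffOn ℝ 1 (fun x => ∫ s in Ioc 0 r, Jc f s k x) (Metric.ball x0 r) := by
  have cDD : Continuous (fderiv ℝ k) := hD.continuous_fderiv one_ne_zero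
  have iDD := cs_int cDD (sD.fderiv (𝕜 := ℝ))
  set I := ∫ z, ‖fderiv ℝ k z‖ with hI
  have bnd : ∀ s ∈ Ioc 0 r, ∀ x ∈ Metric.ball x0 r,
      ‖s⁻¹ • Jc f s (fderiv ℝ k) x‖ ≤ H * I * s ^ (α - 1) := by
    intro s hs x hx
    have hx' : dist x x0 < r := hx
    refine Jc_holder hf hC hs.1 iDD (integral_fderiv_zero hD sD) h1 hα.le hH (x := x)
      (fun z hz => ?_)
    have := hh (x - s • z) ?_ x ?_
    · rwa [sub_sub_cancel_left, norm_neg] at this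
    · rw [Metric.mem_closedBall, dist_eq_norm]
      have e : x - s • z - x0 = (x - x0) - s • z := by abel
      rw [e]
      refine (norm_sub_le _ _).trans ?_
      rw [norm_smul, Real.norm_of_nonneg hs.1.le]
      rw [dist_eq_norm] at hx'
      nlinarith [hs.1, hs.2, norm_nonneg z]
    · rw [Metric.mem_closedBall]; linarith [hs.1, hs.2]
  have bint : Integrable (fun s => H * I * s ^ (α - 1)) (volume.restrict (Ioc 0 r)) := by
    refine Integrable.const_mul ?_ _
    by_cases hr : 0 ≤ r
    · have := intervalIntegral.intervalIntegrable_rpow' (a := 0) (b := r) (r := α - 1) (by linarith)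
      exact (intervalIntegrable_iff_integrableOn_Ioc_of_le hr).1 this
    · rw [Ioc_eq_empty (by linarith)]; simp
  have meas : ∀ x, AEStronglyMeasurable
      (fun s => s⁻¹ • Jc f s (fderiv ℝ k) x) (volume.restrict (Ioc 0 r)) :=
    fun x => (measurable_inv.stronglyMeasurable.smul (Jc_meas hf cDD x)).aestronglyMeasurable
  refine contDiffOn_one_of (u' := fun x => ∫ s in Ioc 0 r, s⁻¹ • Jc f s (fderiv ℝ k) x)
    Metric.isOpen_ball (fun x hx => ?_) ?_
  · refine hasFDerivAt_integral_of_dominated_of_fderiv_le (s := Metric.ball x0 r)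
      (F' := fun x s => s⁻¹ • Jc f s (fderiv ℝ k) x)
      (bound := fun s => H * I * s ^ (α - 1)) (Metric.isOpen_ball.mem_nhds hx) ?_ ?_ (meas x) ?_ bint ?_
    · exact Eventually.of_forall fun y => (Jc_meas hf hD.continuous y).aestronglyMeasurable
    · exact Measure.integrableOn_of_bounded (M := C * ∫ z, ‖k z‖) (by simp)
        (Jc_meas hf hD.continuous x).aestronglyMeasurable
        (Eventually.of_forall fun s => Jc_bdd hC s (cs_int hD.continuous sD) x)
    · filter_upwards [ae_restrict_mem measurableSet_Ioc] with s hs using bnd s hs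
    · filter_upwards [ae_restrict_mem measurableSet_Ioc] with s hs
      exact fun y _ => Jc_hasFDerivAt hf hC hs.1.ne' hD sD y
  · refine continuousOn_of_dominated (bound := fun s => H * I * s ^ (α - 1)) (fun x _ => meas x)
      (fun x hx => ?_) bint ?_
    · filter_upwards [ae_restrict_mem measurableSet_Ioc] with s hs using bnd s hs x hx
    · filter_upwards [ae_restrict_mem measurableSet_Ioc] with s hs
      have c := (Jc_contDiff (n := 0) hf hC hs.1.ne' (contDiff_zero.2 cDD)
        (sD.fderiv (𝕜 := ℝ))).continuous
      exact (c.const_smul s⁻¹).continuousOn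

theorem fderiv2_zero (z : EN N) (hz : 1 < ‖z‖) : fderiv ℝ (fderiv ℝ (thC N)) z = 0 := by
  have : thC N =ᶠ[𝓝 z] fun _ => 0 := by
    filter_upwards [(isOpen_lt continuous_const continuous_norm).mem_nhds hz] with y hy
    exact (thC_spec N).2.2.2.1 y (le_of_lt hy)
  have h2 := this.fderiv (𝕜 := ℝ)
  have h3 := (h2.fderiv (𝕜 := ℝ)).eq_of_nhds
  rw [h3]
  simp

theorem Pot_C2 {f : EN N → ℝ} (hf : Measurable f) {C : ℝ} (hC : ∀ x, |f x| ≤ C)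
    {r : ℝ} {x0 : EN N} {H α : ℝ} (hα : 0 < α) (hH : 0 ≤ H)
    (hh : ∀ x ∈ Metric.closedBall x0 (2 * r), ∀ y ∈ Metric.closedBall x0 (2 * r),
      |f x - f y| ≤ H * ‖x - y‖ ^ α) : ContDiffOn ℝ 2 (Pot f r) (Metric.ball x0 r) := by
  have hθ := (thC_spec N).2.1
  have hθ2 : ContDiff ℝ 2 (thC N) := hθ.of_le (WithTop.coe_le_coe.2 (le_top : (2:ℕ∞) ≤ ⊤))
  have hD : ContDiff ℝ 1 (fderiv ℝ (thC N)) := hθ2.fderiv_right (by norm_num)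
  have sD := (thC_supp (N := N)).fderiv (𝕜 := ℝ)
  have e2 : (2 : WithTop ℕ∞) = 1 + 1 := by norm_num
  rw [e2, contDiffOn_succ_iff_fderiv_of_isOpen Metric.isOpen_ball]
  refine ⟨fun x _ => (Pot_hasFDerivAt hf hC r x).differentiableAt.differentiableWithinAt,
    by simp, ?_⟩
  rw [funext fun x => (Pot_hasFDerivAt hf hC r x).fderiv]
  exact DJ_C1 hf hC hα hH hh hD sD fderiv2_zero
end

open Set MeasureTheory Filter Topology
open scoped ContDiff
set_option linter.unusedSectionVars false

section
variable {N : ℕ} [NeZero N]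

theorem Good.ind {U : Set (EN N)} {f : EN N → ℝ} (hf : Good U f) {x : EN N} {r : ℝ}
    (hx : Metric.closedBall x r ⊆ U) : Measurable ((Metric.closedBall x r).indicator f) ∧
      ∃ C, ∀ y, |(Metric.closedBall x r).indicator f y| ≤ C := by
  constructor
  · have := hf.1.indicator (Metric.isClosed_closedBall (x := x) (ε := r)).measurableSet
    rwa [indicator_indicator, inter_eq_left.2 hx] at this
  · obtain ⟨C, hC⟩ := hf.2 _ hx (isCompact_closedBall x r)
    refine ⟨max C 0, fun y => ?_⟩
    by_cases hy : y ∈ Metric.closedBall x r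
    · rw [indicator_of_mem hy]; exact (hC y hy).trans (le_max_left _ _)
    · rw [indicator_of_notMem hy]; simp

theorem MV.repr {U : Set (EN N)} {u f : EN N → ℝ} (h : MV U u f) (hu : Good U u) (hf : Good U f)
    {x0 : EN N} {r : ℝ} (hr : 0 < r) (hx : Metric.closedBall x0 (2 * r) ⊆ U) :
    ∀ x ∈ Metric.ball x0 r, u x = Jc ((Metric.closedBall x0 (2 * r)).indicator u) r (etC N) x +
      Pot ((Metric.closedBall x0 (2 * r)).indicator f) r x := by
  intro x hxb
  have hsub : Metric.closedBall x r ⊆ Metric.closedBall x0 (2 * r) := by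
    refine Metric.closedBall_subset_closedBall' ?_
    have : dist x x0 < r := hxb
    linarith
  obtain ⟨mu, Cu, hCu⟩ := hu.ind hx
  obtain ⟨mf, Cf, hCf⟩ := hf.ind hx
  have e := (h.mono hx).congr (u' := (Metric.closedBall x0 (2 * r)).indicator u)
    (f' := (Metric.closedBall x0 (2 * r)).indicator f)
    (fun y hy => by rw [indicator_of_mem hy]) (fun y hy => by rw [indicator_of_mem hy]) x r hr hsub
  rw [indicator_of_mem (hsub (Metric.mem_closedBall_self hr.le))] at e
  rw [e, integral_am r (f := fun y => (Metric.closedBall x0 (2 * r)).indicator u (x - y))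
    (mu.comp (by fun_prop)),
    integral_pm r (f := fun y => (Metric.closedBall x0 (2 * r)).indicator f (x - y))
    (mf.comp (by fun_prop)) (fun y => hCf _)]
  simp only [Jc, Pot, smul_eq_mul, mul_comm]

theorem MV.C1 {U : Set (EN N)} (hU : IsOpen U) {u f : EN N → ℝ} (h : MV U u f) (hu : Good U u)
    (hf : Good U f) : ContDiffOn ℝ 1 u U := by
  intro x0 hx0
  obtain ⟨r, hr, hb⟩ := Metric.nhds_basis_closedBall.mem_iff.1 (hU.mem_nhds hx0)
  have hb' : Metric.closedBall x0 (2 * (r / 2)) ⊆ U := by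
    rwa [mul_div_cancel₀ r two_ne_zero]
  have e := h.repr hu hf (half_pos hr) hb'
  obtain ⟨mu, Cu, hCu⟩ := hu.ind hb'
  obtain ⟨mf, Cf, hCf⟩ := hf.ind hb'
  have c1 := Jc_contDiff (n := 1) mu hCu (half_pos hr).ne'
    ((thC_spec N).2.2.1.of_le (by exact_mod_cast le_top)) etC_supp
  have c2 := Pot_C1 mf hCf (r / 2)
  refine ContDiffAt.contDiffWithinAt ?_
  refine (c1.add c2).contDiffAt.congr_of_eventuallyEq ?_
  filter_upwards [Metric.ball_mem_nhds x0 (half_pos hr)] with y hy using e y hy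

theorem MV.C2 {U : Set (EN N)} (hU : IsOpen U) {u f : EN N → ℝ} (h : MV U u f) (hu : Good U u)
    (hf : Good U f) (hh : ∀ x ∈ U, ∃ R > 0, ∃ H ≥ 0, ∃ α > 0, ∀ y ∈ Metric.closedBall x R,
      ∀ z ∈ Metric.closedBall x R, |f y - f z| ≤ H * ‖y - z‖ ^ (α : ℝ)) : ContDiffOn ℝ 2 u U := by
  intro x0 hx0
  obtain ⟨r', hr', hb⟩ := Metric.nhds_basis_closedBall.mem_iff.1 (hU.mem_nhds hx0)
  obtain ⟨R, hR, H, hH, α, hα, hol⟩ := hh x0 hx0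
  set r := min r' R with hrd
  have hr : 0 < r := lt_min hr' hR
  have e2 : 2 * (r / 2) = r := mul_div_cancel₀ r two_ne_zero
  have hb' : Metric.closedBall x0 (2 * (r / 2)) ⊆ U := by
    rw [e2]; exact (Metric.closedBall_subset_closedBall (min_le_left _ _)).trans hb
  have hbR : Metric.closedBall x0 (2 * (r / 2)) ⊆ Metric.closedBall x0 R := by
    rw [e2]; exact Metric.closedBall_subset_closedBall (min_le_right _ _)
  have e := h.repr hu hf (half_pos hr) hb'
  obtain ⟨mu, Cu, hCu⟩ := hu.ind hb'
  obtain ⟨mf, Cf, hCf⟩ := hf.ind hb'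
  have c1 := Jc_contDiff (n := 2) mu hCu (half_pos hr).ne'
    ((thC_spec N).2.2.1.of_le (WithTop.coe_le_coe.2 (le_top : (2:ℕ∞) ≤ ⊤))) etC_supp
  have c2 := Pot_C2 mf hCf (r := r / 2) (x0 := x0) hα hH (fun x hx y hy => by
    rw [indicator_of_mem hx, indicator_of_mem hy]
    exact hol x (hbR hx) y (hbR hy))
  refine ContDiffAt.contDiffWithinAt ?_
  have c2' := c2.contDiffAt (Metric.ball_mem_nhds x0 (half_pos hr))
  refine (c1.contDiffAt.add c2').congr_of_eventuallyEq ?_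
  filter_upwards [Metric.ball_mem_nhds x0 (half_pos hr)] with y hy using e y hy

theorem MV.lap_eq {U : Set (EN N)} (hU : IsOpen U) {u f : EN N → ℝ} (h : MV U u f)
    (hu : ContDiffOn ℝ 2 u U) (hf : ContinuousOn f U) : ∀ x ∈ U, - lap u x = f x := by
  have hl := (lap_continuousOn hU hu)
  have gu := hu.continuousOn.good hU
  have key : ∀ a : ℝ, ∀ x ∈ U, 0 ≤ a * f x + (-a) * - lap u x := by
    intro a x hx
    have m := h.comb (MV_of_C2 hU hu) gu (hf.good hU) gu (hl.neg.good hU) a (-a)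
    have c : ContinuousOn (fun x => a * f x + (-a) * - lap u x) U := by fun_prop
    refine MV.no_max (D := fun x => a * u x + (-a) * u x) hU m (ContinuousOn.good hU ?_)
      (c.good hU) hx (c.continuousAt (hU.mem_nhds hx)) ?_
    · have := hu.continuousOn
      fun_prop
    · intro y hy; simp
  intro x hx
  have h1 := key 1 x hx
  have h2 := key (-1) x hx
  linarith
end

open Set MeasureTheory Filter Topology
open scoped ContDiff
set_option linter.unusedSectionVars false

section
variable {N : ℕ} [NeZero N]

theorem good_bdd {U : Set (EN N)} (hU : IsOpen U) {h : EN N → ℝ} (hm : Measurable h) {C : ℝ}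
    (hC : ∀ x, |h x| ≤ C) : Good U h :=
  ⟨hm.indicator hU.measurableSet, fun _ _ _ => ⟨C, fun x _ => hC x⟩⟩

theorem Yk_cont {K : ℝ} (hK : 0 < K) {h : EN N → ℝ} (hm : Measurable h) {C : ℝ}
    (hC : ∀ x, |h x| ≤ C) : Continuous (Yk K h) := by
  have b := Yk_bdd hK hm hC
  have m := Yk_meas K hK hm
  have := (Yk_MV hK hm hC).C1 isOpen_univ (good_bdd isOpen_univ m b)
    (good_bdd (C := C + C) isOpen_univ (hm.sub (m.const_mul K)) ?_)
  · exact continuousOn_univ.1 this.continuousOn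
  · intro x
    refine (abs_sub _ _).trans (add_le_add (hC x) ?_)
    rw [abs_mul, abs_of_pos hK]
    calc _ ≤ K * (C / K) := mul_le_mul_of_nonneg_left (b x) hK.le
      _ = C := by field_simp

theorem Yk_loc {d : ℝ} (hd : 0 < d) : ∃ C, 0 ≤ C ∧ ∀ K, 0 < K → ∀ (h : EN N → ℝ) (M : ℝ),
    Measurable h → (∀ x, |h x| ≤ M) → ∀ x, (∀ y, ‖y - x‖ < d → h y = 0) →
    |Yk K h x| ≤ M * C / K ^ 2 := by
  let b : ContDiffBump (0 : EN N) := ⟨d / 2, d, by positivity, by linarith⟩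
  have b1 : ContDiff ℝ 2 b := b.contDiff
  have b2 : HasCompactSupport b := b.hasCompactSupport
  obtain ⟨C, hC0, hC⟩ := bdd_of_cs (lap_cont b1) (lap_supp b2)
  refine ⟨C, hC0, fun K hK h M hm hM x hx => ?_⟩
  have := nuK_finite (N := N) hK
  have hM0 : 0 ≤ M := (abs_nonneg _).trans (hM 0)
  have e1 := Yk_lap hK b1 b2 0
  have e2 := Yk_bdd hK (lap_cont b1).measurable hC 0
  have e3 : b 0 = 1 := b.one_of_mem_closedBall (by simp; exact b.rIn_pos.le)
  have bb : ∀ x, |b x| ≤ 1 := fun x => by rw [abs_of_nonneg b.nonneg]; exact b.le_one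
  have i1 := bint (μ := nuK N K) b1.continuous.measurable bb 0
  have e4 : |Yk K h x| ≤ ∫ y, M * (1 - b (0 - y)) ∂(nuK N K) := by
    unfold Yk
    rw [← Real.norm_eq_abs]
    refine norm_integral_le_of_norm_le (((integrable_const 1).sub i1).const_mul M)
      (Eventually.of_forall fun y => ?_)
    rw [Real.norm_eq_abs]
    by_cases hy : ‖y‖ < d
    · rw [hx (x - y) (by simpa using hy)]
      simp only [abs_zero]
      have := b.le_one (x := 0 - y)
      exact mul_nonneg hM0 (by linarith)
    · rw [b.zero_of_le_dist (by simp; linarith [not_lt.1 hy])]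
      simpa using hM _
  rw [integral_const_mul, integral_sub (integrable_const 1) i1] at e4
  have e5 : ∫ y, b (0 - y) ∂(nuK N K) = Yk K b 0 := rfl
  rw [e5] at e4
  simp only [integral_const, smul_eq_mul, mul_one, nuK_univ hK] at e4
  refine e4.trans ?_
  rw [e3] at e1
  have e6 : Yk K b 0 ≥ 1 / K - C / K ^ 2 := by
    have : K * Yk K b 0 ≥ 1 - C / K := by have := (abs_le.1 e2).1; linarith
    have h2 : 1 / K - C / K ^ 2 = (1 - C / K) / K := by field_simp
    rw [h2, ge_iff_le, div_le_iff₀ hK]; linarith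
  calc _ ≤ M * (C / K ^ 2) := mul_le_mul_of_nonneg_left (by linarith) hM0
    _ = _ := by ring

theorem Yk_lim {K : ℝ} (hK : 0 < K) {h : ℕ → EN N → ℝ} {v : EN N → ℝ} (hm : ∀ n, Measurable (h n))
    {C : ℝ} (hC : ∀ n x, |h n x| ≤ C) (hv : ∀ x, Tendsto (fun n => h n x) atTop (𝓝 (v x)))
    (x : EN N) : Tendsto (fun n => Yk K (h n) x) atTop (𝓝 (Yk K v x)) := by
  have := nuK_finite (N := N) hK
  refine tendsto_integral_of_dominated_convergence (fun _ => C)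
    (fun n => ((hm n).comp (by fun_prop)).aestronglyMeasurable) (integrable_const C)
    (fun n => Eventually.of_forall fun y => hC n _) (Eventually.of_forall fun y => hv _)

theorem Yk_nonneg {K : ℝ} {h : EN N → ℝ} (h0 : ∀ x, 0 ≤ h x) (x : EN N) : 0 ≤ Yk K h x :=
  integral_nonneg fun _ => h0 _
end

open Set MeasureTheory Filter Topology
open scoped ContDiff
set_option linter.unusedSectionVars false

section
variable {N : ℕ} [NeZero N]

/-- A bounded open set with a positive first eigenfunction (extended by zero). -/
structure Dom (Ω : Set (EN N)) (φ : EN N → ℝ) (l : ℝ) : Prop where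
  op : IsOpen Ω
  bd : Bornology.IsBounded Ω
  c : Continuous φ
  pos : ∀ x ∈ Ω, 0 < φ x
  zero : ∀ x, x ∉ Ω → φ x = 0
  mv : MV Ω φ (fun x => l * φ x)
  l0 : 0 < l

variable {Ω : Set (EN N)} {φ : EN N → ℝ} {l : ℝ}

theorem Dom.nn (h : Dom Ω φ l) (x : EN N) : 0 ≤ φ x := by
  by_cases hx : x ∈ Ω
  · exact (h.pos x hx).le
  · rw [h.zero x hx]

theorem frontier_notMem {U : Set (EN N)} (hU : IsOpen U) {x : EN N} (hx : x ∈ frontier U) : x ∉ U := by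
  rw [hU.frontier_eq] at hx; exact hx.2

theorem Dom.barrier (h : Dom Ω φ l) {κ B s : ℝ} (hκ0 : 0 ≤ κ) (hκ : κ < l) (hB : 0 ≤ B) (hs : 0 < s) :
    ∃ w f : EN N → ℝ, ∃ C, 0 ≤ C ∧ Continuous w ∧ ContinuousOn f Ω ∧ MV Ω w f ∧
      (∀ x ∈ Ω, κ * w x + B ≤ f x) ∧ (∀ x, s ≤ w x) ∧ ∀ x ∈ Ω, w x ≤ 2 * s + C * φ x := by
  let q : ℕ → EN N → ℝ := fun n => Ω.indicator fun x => max (1 - (n + 1) * φ x) 0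
  have qm : ∀ n, Measurable (q n) := fun n => by
    have := h.c
    exact (Continuous.measurable (by fun_prop)).indicator h.op.measurableSet
  have q0 : ∀ n x, 0 ≤ q n x := fun n x => indicator_nonneg (fun _ _ => le_max_right _ _) x
  have qa : ∀ x, Antitone fun n => q n x := fun x n m hnm => by
    refine indicator_le_indicator (max_le_max_right 0 ?_)
    have := h.nn x
    have hh : (n:ℝ) ≤ m := by exact_mod_cast hnm
    nlinarith
  have q1 : ∀ n x, |q n x| ≤ 1 := fun n x => by
    rw [abs_of_nonneg (q0 n x)]
    refine indicator_le' (fun y _ => max_le ?_ zero_le_one) (fun _ _ => zero_le_one) x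
    have := mul_nonneg (by positivity : (0:ℝ) ≤ n + 1) (h.nn y)
    linarith
  have ql : ∀ x, Tendsto (fun n => q n x) atTop (𝓝 0) := fun x => by
    by_cases hx : x ∈ Ω
    · refine tendsto_const_nhds.congr' ?_
      obtain ⟨m, hm⟩ := exists_nat_gt (1 / φ x)
      filter_upwards [eventually_ge_atTop m] with n hn
      simp only [q, indicator_of_mem hx]
      symm; refine max_eq_right ?_
      have p := h.pos x hx
      rw [div_lt_iff₀ p] at hm
      have : (m:ℝ) ≤ n := by exact_mod_cast hn
      nlinarith
    · simp [q, hx]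
  set Q := 2 * (s + 2 * κ * s + B) with hQ
  have hQ0 : 0 < Q := by positivity
  obtain ⟨n, hn⟩ : ∃ n, ∀ x ∈ closure Ω, Yk 1 (q n) x < s / Q := by
    have := Antitone.tendstoUniformlyOn_of_forall_tendsto h.bd.isCompact_closure
      (F := fun n => Yk 1 (q n)) (f := fun _ => (0:ℝ))
      (fun n => (Yk_cont one_pos (qm n) (q1 n)).continuousOn)
      (fun x _ n m hnm => Yk_mono one_pos (qm m) (q1 m) (qm n) (q1 n) (fun y => qa y hnm) x)
      continuousOn_const (fun x _ => by
        have := Yk_lim one_pos qm q1 (v := fun _ => 0) ql x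
        simpa [Yk] using this)
    obtain ⟨n, hn⟩ := (Metric.tendstoUniformlyOn_iff.1 this (s / Q) (by positivity)).exists
    refine ⟨n, fun x hx => ?_⟩
    have := hn x hx
    rw [dist_comm, Real.dist_eq, sub_zero] at this
    exact (le_abs_self _).trans_lt this
  set Y := Yk 1 (q n) with hY
  have Yc : Continuous Y := Yk_cont one_pos (qm n) (q1 n)
  have Y0 : ∀ x, 0 ≤ Y x := Yk_nonneg (q0 n)
  set C := Q * (n + 1) / (l - κ) with hC
  have lk : 0 < l - κ := by linarith
  have C0 : 0 ≤ C := by positivity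
  have Ylt : ∀ x ∈ Ω, Q * Y x ≤ s := fun x hx => by
    have := (hn x (subset_closure hx)).le
    rw [le_div_iff₀ hQ0] at this; linarith
  have qc : ContinuousOn (q n) Ω := by
    have := h.c
    refine ContinuousOn.congr (f := fun x => max (1 - (n + 1) * φ x) 0) (by fun_prop) fun x hx => ?_
    simp [q, hx]
  have mvY : MV Ω Y (fun x => q n x - Y x) := by
    have := (Yk_MV one_pos (qm n) (q1 n)).mono (subset_univ Ω)
    simpa using this
  refine ⟨fun x => s + (C * φ x + Q * Y x), fun x => C * (l * φ x) + Q * (q n x - Y x), C, C0,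
    ?_, ?_, ?_, ?_, ?_, ?_⟩
  · have := h.c; fun_prop
  · have := h.c; fun_prop
  · have hc := h.c
    have o := h.op
    have e1 := h.mv.comb mvY (h.c.continuousOn.good o)
      (ContinuousOn.good o (by fun_prop)) (Yc.continuousOn.good o) (ContinuousOn.good o (by fun_prop)) C Q
    have e2 := (MV.const Ω s).comb e1 (ContinuousOn.good o (by fun_prop))
      (ContinuousOn.good o (by fun_prop)) (ContinuousOn.good o (by fun_prop)) (ContinuousOn.good o (by fun_prop)) 1 1
    exact e2.congr (fun x _ => by ring) (fun x _ => by ring)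
  · intro x hx
    have p := h.pos x hx
    have y := Ylt x hx
    have y0 := mul_nonneg hQ0.le (Y0 x)
    have key : s + 2 * κ * s + B ≤ (l - κ) * C * φ x + Q * q n x := by
      have e : (l - κ) * C = Q * (n + 1) := by rw [hC]; field_simp
      rw [e]
      have e2 : q n x = max (1 - (n + 1) * φ x) 0 := by simp [q, hx]
      have e3 : 1 - (n + 1) * φ x ≤ q n x := by rw [e2]; exact le_max_left _ _
      nlinarith
    have : κ * (Q * Y x) ≤ κ * s := mul_le_mul_of_nonneg_left y hκ0
    nlinarith
  · intro x
    have := mul_nonneg C0 (h.nn x)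
    have := mul_nonneg hQ0.le (Y0 x)
    linarith
  · intro x hx
    linarith [Ylt x hx]
end

open Set MeasureTheory Filter Topology
open scoped ContDiff
set_option linter.unusedSectionVars false

section
variable {N : ℕ} [NeZero N]
variable {Ω : Set (EN N)} {φ : EN N → ℝ} {l : ℝ}

/-- Solve `u = Y_K (h + p u)` for `0 ≤ p ≤ k`, `0 ≤ h ≤ M`, `K = L + k`. -/
theorem fixpt {L k M : ℝ} (hL : 0 < L) (hk : 0 ≤ k) (hM : 0 ≤ M) {h p : EN N → ℝ} (hm : Measurable h)
    (pm : Measurable p) (h0 : ∀ x, 0 ≤ h x) (h1 : ∀ x, h x ≤ M) (p0 : ∀ x, 0 ≤ p x) (p1 : ∀ x, p x ≤ k) :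
    ∃ u : EN N → ℝ, Measurable u ∧ (∀ x, 0 ≤ u x) ∧ (∀ x, u x ≤ M / L) ∧
      ∀ x, u x = Yk (L + k) (fun y => h y + p y * u y) x := by
  have hK : 0 < L + k := by linarith
  let T : (EN N → ℝ) → EN N → ℝ := fun u => Yk (L + k) (fun y => h y + p y * u y)
  let P : (EN N → ℝ) → Prop := fun u => Measurable u ∧ (∀ x, 0 ≤ u x) ∧ (∀ x, u x ≤ M / L)
  have bd : ∀ u, P u → ∀ x, |h x + p x * u x| ≤ M + k * (M / L) := by
    rintro u ⟨_, u0, u1⟩ x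
    rw [abs_of_nonneg (add_nonneg (h0 x) (mul_nonneg (p0 x) (u0 x)))]
    exact add_le_add (h1 x) (mul_le_mul (p1 x) (u1 x) (u0 x) hk)
  have ms : ∀ u, P u → Measurable (fun x => h x + p x * u x) := fun u hu => hm.add (pm.mul hu.1)
  have TP : ∀ u, P u → P (T u) := by
    intro u hu
    refine ⟨Yk_meas _ hK (ms u hu), Yk_nonneg fun x => add_nonneg (h0 x) (mul_nonneg (p0 x) (hu.2.1 x)),
      fun x => ?_⟩
    have := (abs_le.1 (Yk_bdd hK (ms u hu) (bd u hu) x)).2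
    refine this.trans (le_of_eq ?_)
    field_simp
  have Tm : ∀ u v, P u → P v → (∀ x, u x ≤ v x) → ∀ x, T u x ≤ T v x := fun u v hu hv huv x =>
    Yk_mono hK (ms u hu) (bd u hu) (ms v hv) (bd v hv)
      (fun y => by have := mul_le_mul_of_nonneg_left (huv y) (p0 y); linarith) x
  let U : ℕ → EN N → ℝ := fun n => T^[n] (fun _ => 0)
  have US : ∀ n, U (n + 1) = T (U n) := fun n => Function.iterate_succ_apply' T n _
  have UP : ∀ n, P (U n) := by
    intro n
    induction n with
    | zero => exact ⟨measurable_const, fun _ => le_rfl, fun _ => by positivity⟩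
    | succ n ih => rw [US]; exact TP _ ih
  have Um : ∀ n x, U n x ≤ U (n + 1) x := by
    intro n
    induction n with
    | zero => exact fun x => (UP 1).2.1 x
    | succ n ih => intro x; rw [US, US (n + 1)]; exact Tm _ _ (UP n) (UP _) ih x
  have Umono : ∀ x, Monotone fun n => U n x := fun x => monotone_nat_of_le_succ fun n => Um n x
  have Ul : ∀ x, Tendsto (fun n => U n x) atTop (𝓝 (⨆ n, U n x)) := fun x =>
    tendsto_atTop_ciSup (Umono x) ⟨M / L, by rintro _ ⟨n, rfl⟩; exact (UP n).2.2 x⟩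
  refine ⟨fun x => ⨆ n, U n x, measurable_of_tendsto_metrizable (fun n => (UP n).1) (tendsto_pi_nhds.2 Ul),
    fun x => ge_of_tendsto' (Ul x) fun n => (UP n).2.1 x,
    fun x => le_of_tendsto' (Ul x) fun n => (UP n).2.2 x, fun x => ?_⟩
  have e1 := (Ul x).comp (tendsto_add_atTop_nat 1)
  have e2 := Yk_lim hK (fun n => ms _ (UP n)) (fun n => bd _ (UP n))
    (v := fun y => h y + p y * ⨆ n, U n y) (fun y => ((Ul y).const_mul _).const_add _) x
  refine tendsto_nhds_unique e1 (e2.congr fun n => ?_)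
  show T (U n) x = U (n + 1) x
  rw [US]

theorem Dom.approx (h : Dom Ω φ l) {L M : ℝ} (hL : 0 < L) (hM : 0 ≤ M) {f : EN N → ℝ}
    (fc : ContinuousOn f Ω) (f0 : ∀ x ∈ Ω, 0 ≤ f x) (f1 : ∀ x ∈ Ω, f x ≤ M) {ε : ℝ} (hε : 0 < ε) :
    ∃ u F : EN N → ℝ, Continuous u ∧ (∀ x, 0 ≤ u x) ∧ (∀ x, u x ≤ M / L) ∧ MV Ω u F ∧ ContinuousOn F Ω ∧
      (∀ x ∈ Ω, F x ≤ M) ∧ (∀ x, ε < φ x → F x = f x - L * u x) ∧ ∀ x, x ∉ Ω → u x ≤ ε := by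
  let χ : EN N → ℝ := fun x => min 1 (max 0 (2 / ε * φ x - 1))
  have hc := h.c
  have χc : Continuous χ := by fun_prop
  have χ0 : ∀ x, 0 ≤ χ x := fun x => le_min zero_le_one (le_max_left _ _)
  have χ1 : ∀ x, χ x ≤ 1 := fun x => min_le_left _ _
  have χz : ∀ x, φ x ≤ ε / 2 → χ x = 0 := fun x hx => by
    have : 2 / ε * φ x - 1 ≤ 0 := by
      have : 2 / ε * φ x ≤ 2 / ε * (ε / 2) := by gcongr
      have e : 2 / ε * (ε / 2) = 1 := by field_simp
      linarith
    simp [χ, max_eq_left this]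
  have χo : ∀ x, ε < φ x → χ x = 1 := fun x hx => by
    have : 1 ≤ 2 / ε * φ x - 1 := by
      have : 2 / ε * ε ≤ 2 / ε * φ x := by gcongr
      have e : 2 / ε * ε = 2 := by field_simp
      linarith
    exact min_eq_left (this.trans (le_max_right _ _))
  -- the compact set
  have cS : IsCompact {x | ε / 2 ≤ φ x} := by
    refine h.bd.isCompact_closure.of_isClosed_subset (isClosed_le continuous_const hc) fun x hx => ?_
    apply subset_closure
    by_contra hn
    have := h.zero x hn
    have hx' : ε / 2 ≤ φ x := hx
    linarith
  have sub : {x | ε / 2 ≤ φ x} ⊆ Ω := fun x hx => by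
    by_contra hn
    have := h.zero x hn
    have hx' : ε / 2 ≤ φ x := hx
    linarith
  obtain ⟨d, hd, hdt⟩ := cS.exists_thickening_subset_open h.op sub
  obtain ⟨C, C0, hC⟩ := Yk_loc (N := N) hd
  set k := M / L * C / ε with hk
  have k0 : 0 ≤ k := by positivity
  have hK : 0 < L + k := by linarith
  let H : EN N → ℝ := fun x => χ x * Ω.indicator f x
  have Hm : Measurable H := χc.measurable.mul (fc.good h.op).1
  have i0 : ∀ x, 0 ≤ Ω.indicator f x := fun x => indicator_nonneg f0 x
  have i1 : ∀ x, Ω.indicator f x ≤ M := fun x => indicator_le' f1 (fun _ _ => hM) x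
  have H0 : ∀ x, 0 ≤ H x := fun x => mul_nonneg (χ0 x) (i0 x)
  have H1 : ∀ x, H x ≤ M := fun x => by
    calc _ ≤ 1 * M := mul_le_mul (χ1 x) (i1 x) (i0 x) zero_le_one
      _ = M := one_mul M
  obtain ⟨u, um, u0, u1, ue⟩ := fixpt hL k0 hM Hm (χc.measurable.const_mul k) H0 H1
    (fun x => mul_nonneg k0 (χ0 x)) (fun x => by nlinarith [χ1 x])
  let G : EN N → ℝ := fun y => H y + k * χ y * u y
  have Gm : Measurable G := Hm.add ((χc.measurable.const_mul k).mul um)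
  have G1 : ∀ x, |G x| ≤ M + k * (M / L) := fun x => by
    have : 0 ≤ k * χ x := mul_nonneg k0 (χ0 x)
    rw [abs_of_nonneg (add_nonneg (H0 x) (mul_nonneg this (u0 x)))]
    exact add_le_add (H1 x) (mul_le_mul (by nlinarith [χ1 x]) (u1 x) (u0 x) k0)
  have ue' : u = Yk (L + k) G := funext ue
  have uc : Continuous u := by rw [ue']; exact Yk_cont hK Gm G1
  have mv := (Yk_MV hK Gm G1).mono (subset_univ Ω)
  rw [← ue'] at mv
  refine ⟨u, fun x => χ x * f x + k * χ x * u x - (L + k) * u x, uc, u0, u1, ?_, by fun_prop, ?_, ?_, ?_⟩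
  · refine mv.congr (fun _ _ => rfl) fun x hx => ?_
    simp [G, H, hx]
  · intro x hx
    have a1 : χ x * f x ≤ M := by nlinarith [χ0 x, χ1 x, f0 x hx, f1 x hx]
    have a2 : k * χ x * u x ≤ k * u x := by
      have := mul_nonneg k0 (u0 x)
      nlinarith [χ1 x]
    have := mul_nonneg hL.le (u0 x)
    simp only
    linarith
  · intro x hx
    simp only [χo x hx]
    ring
  · intro x hx
    rw [ue']
    refine (le_abs_self _).trans ((hC (L + k) hK G _ Gm G1 x fun y hy => ?_).trans ?_)
    · have : χ y = 0 := by
        apply χz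
        by_contra! hc
        apply hx
        apply hdt
        rw [Metric.mem_thickening_iff]
        exact ⟨y, hc.le, by rw [dist_comm, dist_eq_norm]; exact hy⟩
      simp [G, H, this]
    · have e : (M + k * (M / L)) * C / (L + k) ^ 2 = M / L * C / (L + k) := by field_simp
      rw [e, div_le_iff₀ hK]
      have : k * ε = M / L * C := by rw [hk]; field_simp
      nlinarith
end

open Set MeasureTheory Filter Topology
open scoped ContDiff
set_option linter.unusedSectionVars false

section
variable {N : ℕ} [NeZero N]
variable {Ω : Set (EN N)} {φ : EN N → ℝ} {l : ℝ}

/-- difference of two solutions -/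
theorem MV.sub {U : Set (EN N)} (hU : IsOpen U) {u f v g : EN N → ℝ} (h : MV U u f) (h' : MV U v g)
    (hu : ContinuousOn u U) (hf : ContinuousOn f U) (hv : ContinuousOn v U) (hg : ContinuousOn g U) (c : ℝ) :
    MV U (fun x => u x - v x - c) (fun x => f x - g x) := by
  have e := h.comb h' (hu.good hU) (hf.good hU) (hv.good hU) (hg.good hU) 1 (-1)
  have e2 := e.comb (MV.const U c) (ContinuousOn.good hU (by fun_prop)) (ContinuousOn.good hU (by fun_prop))
    (ContinuousOn.good hU (by fun_prop)) (ContinuousOn.good hU (by fun_prop)) 1 (-1)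
  exact e2.congr (fun x _ => by ring) (fun x _ => by ring)

/-- comparison of two functions continuous everywhere -/
theorem MV.le {U : Set (EN N)} (hU : IsOpen U) (hb : Bornology.IsBounded U) {u f v g : EN N → ℝ}
    (h : MV U u f) (h' : MV U v g)
    (hu : Continuous u) (hf : ContinuousOn f U) (hv : Continuous v) (hg : ContinuousOn g U) (c : ℝ)
    (hbd : ∀ x ∈ frontier U, u x ≤ v x + c) (hneg : ∀ x ∈ U, v x + c < u x → f x < g x) :
    ∀ x ∈ U, u x ≤ v x + c := by
  intro x hx
  have := MV.comparison hU hb (h.sub hU h' hu.continuousOn hf hv.continuousOn hg c)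
    (by fun_prop) (by fun_prop) (fun x hx => by linarith [hbd x hx])
    (fun x hx hp => by linarith [hneg x hx (by linarith)]) x hx
  linarith

theorem Dom.engine (h : Dom Ω φ l) {L M : ℝ} (hL : 0 < L) (hM : 0 ≤ M) {f : EN N → ℝ}
    (fc : ContinuousOn f Ω) (f0 : ∀ x ∈ Ω, 0 ≤ f x) (f1 : ∀ x ∈ Ω, f x ≤ M) :
    ∃ u : EN N → ℝ, Continuous u ∧ (∀ x, 0 ≤ u x) ∧ (∀ x, x ∉ Ω → u x = 0) ∧
      MV Ω u (fun x => f x - L * u x) := by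
  have hc := h.c
  have ep : ∀ n : ℕ, (0:ℝ) < 1 / (n + 1) := fun n => by positivity
  choose u F uc u0 u1 mv Fc FM Fe ub using fun n : ℕ => h.approx hL hM fc f0 f1 (ep n)
  -- upper bound
  have up : ∀ s > 0, ∃ C, 0 ≤ C ∧ ∀ n x, u n x ≤ 1 / (n + 1) + 2 * s + C * φ x := by
    intro s hs
    obtain ⟨w, fw, C, C0, wc, fwc, wmv, wf, ws, wC⟩ := h.barrier (B := M + 1) le_rfl h.l0 (by linarith) hs
    refine ⟨C, C0, fun n x => ?_⟩
    by_cases hx : x ∈ Ω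
    · have := MV.le h.op h.bd (mv n) wmv (uc n) (Fc n) wc fwc (1 / (n + 1)) (fun y hy => by
        have := ub n y (frontier_notMem h.op hy)
        linarith [ws y]) (fun y hy _ => by linarith [wf y hy, FM n y hy]) x hx
      linarith [wC x hx]
    · have := ub n x hx
      have := mul_nonneg C0 (h.nn x)
      linarith
  have one : ∀ s > 0, ∀ C, 0 ≤ C → (∀ n x, u n x ≤ 1 / (n + 1) + 2 * s + C * φ x) → ∀ η > 0,
      ∀ n m : ℕ, 1 / ((n:ℝ) + 1) ≤ η → 1 / ((m:ℝ) + 1) ≤ η → ∀ x, u n x ≤ u m x + (η + 2 * s + C * η) := by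
    intro s hs C C0 hC η hη n m hn hm x
    have triv : ∀ y, φ y ≤ η → u n y ≤ u m y + (η + 2 * s + C * η) := fun y hy => by
      have := hC n y
      have := mul_le_mul_of_nonneg_left hy C0
      linarith [u0 m y]
    by_cases hx : φ x ≤ η
    · exact triv x hx
    have Uo : IsOpen {y | η < φ y} := isOpen_lt continuous_const hc
    have UΩ : {y | η < φ y} ⊆ Ω := fun y hy => by
      by_contra hn
      have hy' : η < φ y := hy
      rw [h.zero y hn] at hy'; linarith
    refine MV.le Uo (h.bd.subset UΩ) ((mv n).mono UΩ) ((mv m).mono UΩ) (uc n) ((Fc n).mono UΩ)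
      (uc m) ((Fc m).mono UΩ) _ (fun y hy => triv y ?_) (fun y hy hlt => ?_) x (not_le.1 hx)
    · exact not_lt.1 (frontier_notMem Uo hy)
    · have hy' : η < φ y := hy
      rw [Fe n y (by linarith), Fe m y (by linarith)]
      have : 0 ≤ C * η := by positivity
      have : L * u m y < L * u n y := mul_lt_mul_of_pos_left (by linarith) hL
      linarith
  have cau : UniformCauchySeqOn u atTop univ := by
    rw [Metric.uniformCauchySeqOn_iff]
    intro ε hε
    obtain ⟨C, C0, hC⟩ := up (ε / 8) (by positivity)
    obtain ⟨n0, hn0⟩ := exists_nat_one_div_lt (show 0 < ε / (8 * (1 + C)) by positivity)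
    have small : ∀ n ≥ n0, 1 / ((n:ℝ) + 1) ≤ ε / (8 * (1 + C)) := fun n hn => by
      refine le_trans ?_ hn0.le
      have : (n0:ℝ) ≤ n := by exact_mod_cast hn
      gcongr
    have e : ε / (8 * (1 + C)) + 2 * (ε / 8) + C * (ε / (8 * (1 + C))) < ε := by
      have : ε / (8 * (1 + C)) + C * (ε / (8 * (1 + C))) = ε / 8 := by field_simp
      linarith
    refine ⟨n0, fun m hm n hn x _ => ?_⟩
    have e1 := one (ε / 8) (by positivity) C C0 hC _ (by positivity) n m (small n hn) (small m hm) x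
    have e2 := one (ε / 8) (by positivity) C C0 hC _ (by positivity) m n (small m hm) (small n hn) x
    rw [Real.dist_eq, abs_lt]
    constructor <;> linarith
  have ex : ∀ x, ∃ v, Tendsto (fun n => u n x) atTop (𝓝 v) := fun x =>
    cauchySeq_tendsto_of_complete (cau.cauchySeq (mem_univ x))
  choose v hv using ex
  have unif : TendstoUniformlyOn u v atTop univ := cau.tendstoUniformlyOn_of_tendsto fun x _ => hv x
  have vc : Continuous v := by
    rw [tendstoUniformlyOn_univ] at unif
    exact unif.continuous (Frequently.of_forall uc)
  have v0 : ∀ x, 0 ≤ v x := fun x => ge_of_tendsto' (hv x) fun n => u0 n x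
  refine ⟨v, vc, v0, fun x hx => le_antisymm ?_ (v0 x), ?_⟩
  · exact le_of_tendsto_of_tendsto' (hv x) tendsto_one_div_add_atTop_nhds_zero_nat fun n => ub n x hx
  · intro x r hr hxr
    obtain ⟨y, hy, hmin⟩ := (isCompact_closedBall x r).exists_isMinOn ⟨x, Metric.mem_closedBall_self hr.le⟩
      hc.continuousOn
    have hη : 0 < φ y / 2 := half_pos (h.pos y (hxr hy))
    set η := φ y / 2
    have Uo : IsOpen {y | η < φ y} := isOpen_lt continuous_const hc
    have UΩ : {y | η < φ y} ⊆ Ω := fun y hy => by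
      by_contra hn
      have hy' : η < φ y := hy
      rw [h.zero y hn] at hy'; linarith
    obtain ⟨n0, hn0⟩ := exists_nat_one_div_lt hη
    have small : ∀ n, 1 / (((n + n0 : ℕ):ℝ) + 1) ≤ η := fun n => by
      refine le_trans ?_ hn0.le
      have : (n0:ℝ) ≤ (n + n0 : ℕ) := by push_cast; linarith [Nat.cast_nonneg (α := ℝ) n]
      gcongr
    have bu : ∀ n x, |u n x| ≤ M / L := fun n x => by rw [abs_of_nonneg (u0 n x)]; exact u1 n x
    have := (MV.limit (U := {y | η < φ y}) (u := fun n => u (n + n0)) (v := v)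
      (f := fun n x => f x - L * u (n + n0) x) (g := fun x => f x - L * v x)
      (fun n => ((mv (n + n0)).mono UΩ).congr (fun _ _ => rfl) fun y hy => Fe _ y ((small n).trans_lt hy))
      (fun n => (uc _).continuousOn.good Uo)
      (fun n => ContinuousOn.good Uo ((fc.mono UΩ).sub (by have := uc (n + n0); fun_prop)))
      (fun K _ _ => ⟨M / L, fun n x _ => bu _ x⟩)
      (fun K hK _ => ⟨M + L * (M / L), fun n x hx => ?_⟩)
      (fun x _ => (hv x).comp (tendsto_add_atTop_nat n0))
      (fun x _ => (((hv x).comp (tendsto_add_atTop_nat n0)).const_mul L).const_sub _)).1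
    · refine this x r hr fun z hz => ?_
      have : φ y ≤ φ z := hmin hz
      show φ y / 2 < φ z
      have := h.pos y (hxr hy)
      linarith
    · refine (abs_sub _ _).trans (add_le_add ?_ ?_)
      · rw [abs_of_nonneg (f0 x (UΩ (hK hx)))]; exact f1 x (UΩ (hK hx))
      · rw [abs_mul, abs_of_pos hL]; exact mul_le_mul_of_nonneg_left (bu _ x) hL.le
end

open Set MeasureTheory Filter Topology
open scoped ContDiff
set_option linter.unusedSectionVars false

section
variable {N : ℕ} [NeZero N]
variable {Ω : Set (EN N)} {φ : EN N → ℝ} {l : ℝ}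

theorem Dom.cont_of_barrier (h : Dom Ω φ l) {v : EN N → ℝ} (vc : ContinuousOn v Ω) (v0 : ∀ x, 0 ≤ v x)
    (vz : ∀ x, x ∉ Ω → v x = 0) (hb : ∀ s > 0, ∃ C, 0 ≤ C ∧ ∀ x ∈ Ω, v x ≤ 2 * s + C * φ x) :
    Continuous v := by
  rw [continuous_iff_continuousAt]
  intro x
  by_cases hx : x ∈ Ω
  · exact vc.continuousAt (h.op.mem_nhds hx)
  rw [Metric.continuousAt_iff']
  intro ε hε
  obtain ⟨C, C0, hC⟩ := hb (ε / 4) (by positivity)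
  have hc := h.c
  have : ContinuousAt (fun y => 2 * (ε / 4) + C * φ y) x := by fun_prop
  have e := this.eventually_lt (continuousAt_const (y := ε)) (by rw [h.zero x hx]; linarith)
  filter_upwards [e] with y hy
  rw [vz x hx, Real.dist_eq, sub_zero, abs_of_nonneg (v0 y)]
  by_cases hyΩ : y ∈ Ω
  · exact (hC y hyΩ).trans_lt hy
  · rw [vz y hyΩ]; exact hε

/-- supersolutions above `ψ` -/
def IsSup (Ω : Set (EN N)) (ψ : EN N → ℝ) (G : ℝ → ℝ) (w f : EN N → ℝ) : Prop :=
  Continuous w ∧ ContinuousOn f Ω ∧ MV Ω w f ∧ (∀ x ∈ Ω, G (w x) ≤ f x) ∧ ∀ x, ψ x ≤ w x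

theorem Dom.level (h : Dom Ω φ l) {G : ℝ → ℝ} {k : ℝ} (hk : 0 < k) (G0 : ∀ t, 0 ≤ G t)
    (hGL : ∀ s t, |G s - G t| ≤ k * |s - t|) {ψ fψ : EN N → ℝ} (ψc : Continuous ψ) (ψ0 : ∀ x, 0 ≤ ψ x)
    (ψz : ∀ x, x ∉ Ω → ψ x = 0) (fψc : ContinuousOn fψ Ω) (ψmv : MV Ω ψ fψ)
    (ψs : ∀ x ∈ Ω, fψ x ≤ G (ψ x))
    (bar : ∀ s > 0, ∃ w f, ∃ C, 0 ≤ C ∧ IsSup Ω ψ G w f ∧ ∀ x ∈ Ω, w x ≤ 2 * s + C * φ x) :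
    ∃ v, Continuous v ∧ (∀ x, ψ x ≤ v x) ∧ (∀ x, x ∉ Ω → v x = 0) ∧ MV Ω v (fun x => G (v x)) ∧
      ∀ w f, IsSup Ω ψ G w f → ∀ x, v x ≤ w x := by
  have Gc : Continuous G := by
    refine (LipschitzWith.of_dist_le_mul (K := ⟨k, hk.le⟩) fun s t => ?_).continuous
    rw [Real.dist_eq, Real.dist_eq]; exact hGL s t
  have Gm : ∀ s t, s ≤ t → G s + k * s ≤ G t + k * t := fun s t hst => by
    have := (abs_le.1 (hGL s t)).2
    rw [abs_sub_comm, abs_of_nonneg (sub_nonneg.2 hst)] at this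
    linarith
  have step : ∀ v : EN N → ℝ, ∃ u : EN N → ℝ, Continuous v → (∀ x, 0 ≤ v x) → Continuous u ∧ (∀ x, 0 ≤ u x) ∧
      (∀ x, x ∉ Ω → u x = 0) ∧ MV Ω u (fun x => G (v x) + k * v x - k * u x) := by
    intro v
    by_cases hv : Continuous v ∧ ∀ x, 0 ≤ v x
    · obtain ⟨vc, v0⟩ := hv
      have c1 : Continuous fun x => G (v x) + k * v x := by fun_prop
      obtain ⟨M, hM⟩ := h.bd.isCompact_closure.exists_bound_of_continuousOn c1.continuousOn
      obtain ⟨u, hu⟩ := h.engine (M := |M|) hk (abs_nonneg M) c1.continuousOn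
        (fun x _ => add_nonneg (G0 _) (mul_nonneg hk.le (v0 x)))
        (fun x hx => (le_abs_self _).trans ((hM x (subset_closure hx)).trans (le_abs_self M)))
      exact ⟨u, fun _ _ => hu⟩
    · exact ⟨v, fun a b => absurd ⟨a, b⟩ hv⟩
  choose T hT using step
  let U : ℕ → EN N → ℝ := fun n => T^[n] ψ
  have US : ∀ n, U (n + 1) = T (U n) := fun n => Function.iterate_succ_apply' T n _
  have UP : ∀ n, Continuous (U n) ∧ (∀ x, 0 ≤ U n x) ∧ ∀ x, x ∉ Ω → U n x = 0 := by
    intro n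
    induction n with
    | zero => exact ⟨ψc, ψ0, ψz⟩
    | succ n ih =>
      rw [US]
      have := hT (U n) ih.1 ih.2.1
      exact ⟨this.1, this.2.1, this.2.2.1⟩
  have Uc := fun n => (UP n).1
  have mv : ∀ n, MV Ω (U (n + 1)) (fun x => G (U n x) + k * U n x - k * U (n + 1) x) := fun n => by
    rw [US]; exact (hT (U n) (UP n).1 (UP n).2.1).2.2.2
  have rc : ∀ n, ContinuousOn (fun x => G (U n x) + k * U n x - k * U (n + 1) x) Ω := fun n => by
    have := Uc n; have := Uc (n + 1); fun_prop
  have le0 : ∀ (u v : EN N → ℝ), (∀ x ∈ Ω, u x ≤ v x + 0) → (∀ x, x ∉ Ω → u x ≤ v x) → ∀ x, u x ≤ v x :=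
    fun u v h1 h2 x => by
      by_cases hx : x ∈ Ω
      · simpa using h1 x hx
      · exact h2 x hx
  have Um : ∀ n x, U n x ≤ U (n + 1) x := by
    intro n
    have off : ∀ x, x ∉ Ω → U n x ≤ U (n + 1) x := fun x hx => by
      rw [(UP n).2.2 x hx, (UP _).2.2 x hx]
    refine le0 _ _ ?_ off
    induction n with
    | zero =>
      refine MV.le h.op h.bd ψmv (mv 0) ψc fψc (Uc 1) (rc 0) 0
        (fun x hx => by rw [add_zero]; exact off x (frontier_notMem h.op hx)) fun x hx hlt => ?_
      have hlt' : U 1 x < ψ x := by simpa using hlt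
      have : k * U 1 x < k * ψ x := mul_lt_mul_of_pos_left hlt' hk
      have := ψs x hx
      show fψ x < G (ψ x) + k * ψ x - k * U 1 x
      linarith
    | succ n ih =>
      refine MV.le h.op h.bd (mv n) (mv (n + 1)) (Uc _) (rc n) (Uc _) (rc _) 0
        (fun x hx => by simpa using off x (frontier_notMem h.op hx)) fun x hx hlt => ?_
      have e := ih (fun x hx => by rw [(UP n).2.2 x hx, (UP _).2.2 x hx]) x hx
      have := Gm _ _ (show U n x ≤ U (n + 1) x by simpa using e)
      have : k * (U (n + 2) x) < k * U (n + 1) x := mul_lt_mul_of_pos_left (by simpa using hlt) hk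
      linarith
  have Uw : ∀ w f, IsSup Ω ψ G w f → ∀ n x, U n x ≤ w x := by
    rintro w f ⟨wc, fc, wmv, wG, wψ⟩ n
    induction n with
    | zero => exact wψ
    | succ n ih =>
      have off : ∀ x, x ∉ Ω → U (n + 1) x ≤ w x := fun x hx => by
        rw [(UP _).2.2 x hx]; exact (ψ0 x).trans (wψ x)
      refine le0 _ _ ?_ off
      refine MV.le h.op h.bd (mv n) wmv (Uc _) (rc n) wc fc 0
        (fun x hx => by simpa using off x (frontier_notMem h.op hx)) fun x hx hlt => ?_
      have := Gm _ _ (ih x)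
      have : k * w x < k * U (n + 1) x := mul_lt_mul_of_pos_left (by simpa using hlt) hk
      have := wG x hx
      linarith
  obtain ⟨w1, f1, C1, _, S1, -⟩ := bar 1 one_pos
  obtain ⟨R, hR⟩ := h.bd.isCompact_closure.exists_bound_of_continuousOn S1.1.continuousOn
  have Umono : ∀ x, Monotone fun n => U n x := fun x => monotone_nat_of_le_succ fun n => Um n x
  have Ul : ∀ x, Tendsto (fun n => U n x) atTop (𝓝 (⨆ n, U n x)) := fun x =>
    tendsto_atTop_ciSup (Umono x) ⟨w1 x, by rintro _ ⟨n, rfl⟩; exact Uw w1 f1 S1 n x⟩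
  set v : EN N → ℝ := fun x => ⨆ n, U n x with hv
  have v0 : ∀ x, 0 ≤ v x := fun x => ge_of_tendsto' (Ul x) fun n => (UP n).2.1 x
  have vz : ∀ x, x ∉ Ω → v x = 0 := fun x hx =>
    le_antisymm (le_of_tendsto' (Ul x) fun n => ((UP n).2.2 x hx).le) (v0 x)
  have vw : ∀ w f, IsSup Ω ψ G w f → ∀ x, v x ≤ w x := fun w f hw x =>
    le_of_tendsto' (Ul x) fun n => Uw w f hw n x
  have bU : ∀ n, ∀ x ∈ Ω, |U n x| ≤ R := fun n x hx => by
    rw [abs_of_nonneg ((UP n).2.1 x)]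
    exact (Uw w1 f1 S1 n x).trans ((le_abs_self _).trans (hR x (subset_closure hx)))
  obtain ⟨m1, m2, m3⟩ := MV.limit (U := Ω) (v := v) (g := fun x => G (v x)) mv
    (fun n => (Uc _).continuousOn.good h.op) (fun n => (rc n).good h.op)
    (fun K hK _ => ⟨R, fun n x hx => bU _ x (hK hx)⟩)
    (fun K hK _ => ⟨(G 0 + k * R) + k * R + k * R, fun n x hx => by
      have b1 := bU n x (hK hx)
      have b2 := bU (n + 1) x (hK hx)
      have b3 := hGL (U n x) 0
      rw [sub_zero] at b3
      have b4 : |G (U n x)| ≤ G 0 + k * R := by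
        have := abs_sub_abs_le_abs_sub (G (U n x)) (G 0)
        rw [abs_of_nonneg (G0 0)] at this
        have := mul_le_mul_of_nonneg_left b1 hk.le
        linarith
      refine (abs_sub _ _).trans (add_le_add ((abs_add_le _ _).trans (add_le_add b4 ?_)) ?_)
      · rw [abs_mul, abs_of_pos hk]; exact mul_le_mul_of_nonneg_left b1 hk.le
      · rw [abs_mul, abs_of_pos hk]; exact mul_le_mul_of_nonneg_left b2 hk.le⟩)
    (fun x _ => (Ul x).comp (tendsto_add_atTop_nat 1))
    (fun x _ => by
      have a := Ul x
      have b := (Ul x).comp (tendsto_add_atTop_nat 1)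
      have c := ((Gc.tendsto (v x)).comp a).add (a.const_mul k) |>.sub (b.const_mul k)
      refine (c.congr fun n => rfl).trans (le_of_eq ?_)
      congr 1
      simp only [hv]; ring)
  have vc : Continuous v := by
    refine h.cont_of_barrier (m1.C1 h.op m2 m3).continuousOn v0 vz fun s hs => ?_
    obtain ⟨w, f, C, C0, S, hw⟩ := bar s hs
    exact ⟨C, C0, fun x hx => (vw w f S x).trans (hw x hx)⟩
  exact ⟨v, vc, fun x => ge_of_tendsto' (Ul x) fun n => Umono x (Nat.zero_le n), vz, m1, vw⟩
end

open Set MeasureTheory Filter Topology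
open scoped ContDiff
set_option linter.unusedSectionVars false

/-- inf-convolution -/
noncomputable def icv (F : ℝ → ℝ) (k s : ℝ) : ℝ := ⨅ t : Ioi (0:ℝ), (F t + k * |s - t|)

section icv
variable {F : ℝ → ℝ}

theorem icv_bdd (F0 : ∀ t, 0 < t → 0 < F t) {k : ℝ} (hk : 0 ≤ k) (s : ℝ) :
    BddBelow (range fun t : Ioi (0:ℝ) => F t + k * |s - t|) :=
  ⟨0, by rintro _ ⟨t, rfl⟩; exact add_nonneg (F0 t t.2).le (mul_nonneg hk (abs_nonneg _))⟩

theorem icv_le (F0 : ∀ t, 0 < t → 0 < F t) {k : ℝ} (hk : 0 ≤ k) (s : ℝ) {t : ℝ} (ht : 0 < t) : icv F k s ≤ F t + k * |s - t| :=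
  ciInf_le (icv_bdd F0 hk s) (⟨t, ht⟩ : Ioi (0:ℝ))

theorem icv_le_self (F0 : ∀ t, 0 < t → 0 < F t) {k : ℝ} (hk : 0 ≤ k) {s : ℝ} (hs : 0 < s) : icv F k s ≤ F s := by
  simpa using icv_le F0 hk s hs

theorem le_icv {k s b : ℝ} (h : ∀ t, 0 < t → b ≤ F t + k * |s - t|) : b ≤ icv F k s :=
  have : Nonempty (Ioi (0:ℝ)) := ⟨⟨1, mem_Ioi.2 one_pos⟩⟩
  le_ciInf fun t => h t t.2

theorem icv_nonneg (F0 : ∀ t, 0 < t → 0 < F t) {k : ℝ} (hk : 0 ≤ k) (s : ℝ) : 0 ≤ icv F k s :=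
  le_icv fun t ht => add_nonneg (F0 t ht).le (mul_nonneg hk (abs_nonneg _))

theorem icv_mono (F0 : ∀ t, 0 < t → 0 < F t) {k k' : ℝ} (hk : 0 ≤ k) (h : k ≤ k') (s : ℝ) : icv F k s ≤ icv F k' s :=
  le_icv fun t ht => (icv_le F0 hk s ht).trans (by gcongr)

theorem icv_lip (F0 : ∀ t, 0 < t → 0 < F t) {k : ℝ} (hk : 0 ≤ k) (s t : ℝ) : |icv F k s - icv F k t| ≤ k * |s - t| := by
  have key : ∀ s t, icv F k s - icv F k t ≤ k * |s - t| := fun s t => by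
    have : icv F k s - k * |s - t| ≤ icv F k t := le_icv fun r hr => by
      have e1 := icv_le F0 hk s hr
      have e2 := mul_le_mul_of_nonneg_left (abs_sub_le s t r) hk
      linarith
    linarith
  rw [abs_le]
  constructor
  · have := key t s
    rw [abs_sub_comm] at this; linarith
  · exact key s t

theorem icv_lower (F0 : ∀ t, 0 < t → 0 < F t) (Fc : ContinuousOn F (Ioi 0)) {s : ℝ} (hs : 0 < s) {b : ℝ} (hb : b < F s) :
    ∃ k0, 0 ≤ k0 ∧ ∀ k ≥ k0, b ≤ icv F k s := by
  have c : ContinuousAt F s := Fc.continuousAt (Ioi_mem_nhds hs)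
  obtain ⟨δ, hδ, hd⟩ := Metric.eventually_nhds_iff.1 (continuousAt_const.eventually_lt c hb)
  refine ⟨F s / δ, div_nonneg (F0 s hs).le hδ.le, fun k hk => ?_⟩
  have k0 : 0 ≤ k := (div_nonneg (F0 s hs).le hδ.le).trans hk
  refine le_icv fun t ht => ?_
  by_cases h : |s - t| < δ
  · have := hd (y := t) (by rwa [dist_comm, Real.dist_eq])
    have := mul_nonneg k0 (abs_nonneg (s - t))
    linarith
  · push Not at h
    have e : F s ≤ k * |s - t| := by
      rw [ge_iff_le, div_le_iff₀ hδ] at hk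
      exact hk.trans (mul_le_mul_of_nonneg_left h k0)
    linarith [F0 t ht]
end icv

open Set MeasureTheory Filter Topology
open scoped ContDiff
set_option linter.unusedSectionVars false

section
variable {N : ℕ} [NeZero N]
variable {Ω : Set (EN N)} {φ : EN N → ℝ} {l : ℝ}

theorem Dom.nonlin (h : Dom Ω φ l) {F : ℝ → ℝ} {κ : ℝ} (F0 : ∀ t, 0 < t → 0 < F t)
    (Fc : ContinuousOn F (Ioi 0)) (Finf : Tendsto F (𝓝[>] 0) atTop) (κ0 : 0 ≤ κ) (κl : κ < l)
    (Fb : ∀ s > 0, ∃ B, 0 ≤ B ∧ ∀ t ≥ s, F t ≤ κ * t + B) :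
    ∃ v, Continuous v ∧ (∀ x ∈ Ω, 0 < v x) ∧ (∀ x, x ∉ Ω → v x = 0) ∧ MV Ω v (fun x => F (v x)) := by
  have hc := h.c
  have hl := h.l0
  obtain ⟨m, m0, hm⟩ : ∃ m, 0 < m ∧ ∀ x, φ x ≤ m := by
    obtain ⟨M, hM⟩ := h.bd.isCompact_closure.exists_bound_of_continuousOn hc.continuousOn
    refine ⟨|M| + 1, by positivity, fun x => ?_⟩
    by_cases hx : x ∈ Ω
    · have := (le_abs_self _).trans ((hM x (subset_closure hx)).trans (le_abs_self M))
      linarith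
    · rw [h.zero x hx]; positivity
  obtain ⟨τ, hτ, hF2⟩ : ∃ τ > 0, ∀ t, 0 < t → t < τ → 2 ≤ F t := by
    have := Finf.eventually_ge_atTop 2
    obtain ⟨τ, hτ, hs⟩ := mem_nhdsGT_iff_exists_Ioo_subset.1 this
    exact ⟨τ, hτ, fun t h0 h1 => hs ⟨h0, h1⟩⟩
  obtain ⟨c, c0, c1, c2⟩ : ∃ c, 0 < c ∧ 2 * (c * m) < τ ∧ l * (c * m) ≤ 1 := by
    refine ⟨min (τ / (4 * m)) (1 / (l * m)), by positivity, ?_, ?_⟩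
    · have : min (τ / (4 * m)) (1 / (l * m)) * m ≤ τ / (4 * m) * m := by
        gcongr; exact min_le_left _ _
      have e : τ / (4 * m) * m = τ / 4 := by field_simp
      linarith
    · have : l * (min (τ / (4 * m)) (1 / (l * m)) * m) ≤ l * (1 / (l * m) * m) := by
        gcongr; exact min_le_right _ _
      have e : l * (1 / (l * m) * m) = 1 := by field_simp
      linarith
  have cm : 0 < c * m := by positivity
  set β := min 2 (l * (c * m) + c * m) with hβ
  have β1 : l * (c * m) < β := lt_min (by linarith) (by linarith)
  have sub : ∀ k ≥ l + 1, ∀ s ≤ c * m, β ≤ icv F k s := by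
    intro k hk s hs
    refine le_icv fun t ht => ?_
    have k0 : 0 ≤ k := by linarith
    by_cases h2 : t < τ
    · have := hF2 t ht h2
      have := mul_nonneg k0 (abs_nonneg (s - t))
      have : β ≤ 2 := min_le_left _ _
      linarith
    · have e1 : c * m ≤ |s - t| := by rw [abs_sub_comm]; refine le_trans ?_ (le_abs_self _); linarith
      have e2 : (l + 1) * (c * m) ≤ k * |s - t| := by gcongr
      have : β ≤ l * (c * m) + c * m := min_le_right _ _
      linarith [F0 t ht]
  have cφ : ∀ x, c * φ x ≤ c * m := fun x => mul_le_mul_of_nonneg_left (hm x) c0.le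
  have ψmv : MV Ω (fun x => c * φ x) (fun x => l * (c * φ x)) := by
    have g1 : Good Ω φ := hc.continuousOn.good h.op
    have g2 : Good Ω fun x => l * φ x := ContinuousOn.good h.op (by fun_prop)
    exact (h.mv.comb h.mv g1 g2 g1 g2 c 0).congr (fun x _ => by ring) (fun x _ => by ring)
  have icvc : ∀ k, 0 ≤ k → Continuous (icv F k) := fun k hk => by
    refine (LipschitzWith.of_dist_le_mul (K := ⟨k, hk⟩) fun s t => ?_).continuous
    rw [Real.dist_eq, Real.dist_eq]; exact icv_lip F0 hk s t
  have bar : ∀ s > 0, ∃ w f, ∃ C, 0 ≤ C ∧ (∀ k ≥ l + 1, IsSup Ω (fun x => c * φ x) (icv F k) w f) ∧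
      ∀ x ∈ Ω, w x ≤ 2 * s + C * φ x := by
    intro s hs
    obtain ⟨B, B0, hB⟩ := Fb s hs
    obtain ⟨w, f, C, C0, wc, fc, wmv, wf, ws, wC⟩ := h.barrier κ0 κl B0 hs
    refine ⟨w, f, C, C0, fun k hk => ?_, wC⟩
    have k0 : 0 ≤ k := by linarith
    have wG : ∀ x ∈ Ω, icv F k (w x) ≤ f x := fun x hx =>
      (icv_le_self F0 k0 (hs.trans_le (ws x))).trans ((hB _ (ws x)).trans (wf x hx))
    have off : ∀ x, x ∉ Ω → c * φ x ≤ w x := fun x hx => by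
      rw [h.zero x hx]; linarith [ws x]
    refine ⟨wc, fc, wmv, wG, fun x => ?_⟩
    by_cases hx : x ∈ Ω
    · have := MV.le h.op h.bd ψmv wmv (by fun_prop) (by fun_prop) wc fc 0
        (fun y hy => by rw [add_zero]; exact off y (frontier_notMem h.op hy)) (fun y hy hlt => by
          rw [add_zero] at hlt
          have e1 := sub k hk (w y) (hlt.le.trans (cφ y))
          have e2 := wG y hy
          have e3 := mul_le_mul_of_nonneg_left (cφ y) hl.le
          linarith) x hx
      simpa using this
    · exact off x hx
  let κn : ℕ → ℝ := fun n => n + (l + 1)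
  have κn1 : ∀ n, l + 1 ≤ κn n := fun n => by simp [κn]
  have κn0 : ∀ n, 0 < κn n := fun n => by linarith [κn1 n]
  have κnm : Monotone κn := fun n p hnp => by
    have : (n:ℝ) ≤ p := by exact_mod_cast hnp
    simp only [κn]; linarith
  have lev := fun n => h.level (κn0 n) (icv_nonneg F0 (κn0 n).le) (icv_lip F0 (κn0 n).le)
    (ψ := fun x => c * φ x) (fψ := fun x => l * (c * φ x)) (by fun_prop)
    (fun x => mul_nonneg c0.le (h.nn x)) (fun x hx => by simp only [h.zero x hx, mul_zero]) (by fun_prop) ψmv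
    (fun x _ => by
      have e1 := sub (κn n) (κn1 n) (c * φ x) (cφ x)
      have e3 := mul_le_mul_of_nonneg_left (cφ x) hl.le
      linarith)
    (fun s hs => by
      obtain ⟨w, f, C, C0, S, hw⟩ := bar s hs
      exact ⟨w, f, C, C0, S _ (κn1 n), hw⟩)
  choose V Vc Vψ Vz Vmv Vw using lev
  have Vm : ∀ n x, V n x ≤ V (n + 1) x := fun n => by
    refine Vw n (V (n + 1)) (fun x => icv F (κn (n + 1)) (V (n + 1) x)) ⟨Vc _, ?_, Vmv _, ?_, Vψ _⟩
    · exact ((icvc _ (κn0 _).le).comp (Vc _)).continuousOn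
    · exact fun x _ => icv_mono F0 (κn0 n).le (κnm n.le_succ) _
  have Vmono : ∀ x, Monotone fun n => V n x := fun x => monotone_nat_of_le_succ fun n => Vm n x
  obtain ⟨w1, f1, C1, _, S1, -⟩ := bar 1 one_pos
  obtain ⟨R, hR⟩ := h.bd.isCompact_closure.exists_bound_of_continuousOn (S1 _ le_rfl).1.continuousOn
  have Ul : ∀ x, Tendsto (fun n => V n x) atTop (𝓝 (⨆ n, V n x)) := fun x =>
    tendsto_atTop_ciSup (Vmono x) ⟨w1 x, by rintro _ ⟨n, rfl⟩; exact Vw n w1 f1 (S1 _ (κn1 n)) x⟩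
  set v : EN N → ℝ := fun x => ⨆ n, V n x with hv
  have V0 : ∀ n x, 0 ≤ V n x := fun n x => (mul_nonneg c0.le (h.nn x)).trans (Vψ n x)
  have v0 : ∀ x, 0 ≤ v x := fun x => ge_of_tendsto' (Ul x) fun n => V0 n x
  have vψ : ∀ x, c * φ x ≤ v x := fun x => ge_of_tendsto' (Ul x) fun n => Vψ n x
  have vz : ∀ x, x ∉ Ω → v x = 0 := fun x hx =>
    le_antisymm (le_of_tendsto' (Ul x) fun n => (Vz n x hx).le) (v0 x)
  have vpos : ∀ x ∈ Ω, 0 < v x := fun x hx => (mul_pos c0 (h.pos x hx)).trans_le (vψ x)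
  have Vpos : ∀ n, ∀ x ∈ Ω, 0 < V n x := fun n x hx => (mul_pos c0 (h.pos x hx)).trans_le (Vψ n x)
  have bV : ∀ n, ∀ x ∈ Ω, V n x ≤ R := fun n x hx =>
    (Vw n w1 f1 (S1 _ (κn1 n)) x).trans ((le_abs_self _).trans (hR x (subset_closure hx)))
  obtain ⟨m1, m2, m3⟩ := MV.limit (U := Ω) (v := v) (g := fun x => F (v x)) Vmv
    (fun n => (Vc _).continuousOn.good h.op)
    (fun n => ContinuousOn.good h.op ((icvc _ (κn0 n).le).comp (Vc n)).continuousOn)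
    (fun K hK _ => ⟨R, fun n x hx => by rw [abs_of_nonneg (V0 n x)]; exact bV n x (hK hx)⟩)
    (fun K hK hKc => by
      rcases K.eq_empty_or_nonempty with rfl | hne
      · exact ⟨0, fun n x hx => absurd hx (notMem_empty x)⟩
      obtain ⟨y, hy, hmin⟩ := hKc.exists_isMinOn hne hc.continuousOn
      obtain ⟨B, B0, hB⟩ := Fb (c * φ y) (mul_pos c0 (h.pos y (hK hy)))
      refine ⟨κ * R + B, fun n x hx => ?_⟩
      rw [abs_of_nonneg (icv_nonneg F0 (κn0 n).le _)]
      have e1 : c * φ y ≤ V n x := (mul_le_mul_of_nonneg_left (hmin hx) c0.le).trans (Vψ n x)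
      have e2 := mul_le_mul_of_nonneg_left (bV n x (hK hx)) κ0
      have e3 := hB _ e1
      have e4 := icv_le_self F0 (κn0 n).le (Vpos n x (hK hx))
      linarith)
    (fun x _ => Ul x)
    (fun x hx => by
      have ca : ContinuousAt F (v x) := Fc.continuousAt (Ioi_mem_nhds (vpos x hx))
      refine tendsto_order.2 ⟨fun b hb => ?_, fun b hb => ?_⟩
      · obtain ⟨b', hb1, hb2⟩ := exists_between hb
        obtain ⟨k0, _, hk0⟩ := icv_lower F0 Fc (vpos x hx) hb2
        obtain ⟨j, hj⟩ := exists_nat_gt k0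
        have hj' : k0 ≤ κn j := by simp only [κn]; linarith
        have t := ((icvc (κn j) (κn0 j).le).tendsto (v x)).comp (Ul x)
        filter_upwards [t.eventually_const_lt (hb1.trans_le (hk0 _ hj')), eventually_ge_atTop j] with n h1 h2
        exact lt_of_lt_of_le h1 (icv_mono F0 (κn0 j).le (κnm h2) _)
      · have t := ca.tendsto.comp (Ul x)
        filter_upwards [t.eventually_lt_const hb] with n h1
        exact (icv_le_self F0 (κn0 n).le (Vpos n x hx)).trans_lt h1)
  refine ⟨v, ?_, vpos, vz, m1⟩
  refine h.cont_of_barrier (m1.C1 h.op m2 m3).continuousOn v0 vz fun s hs => ?_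
  obtain ⟨w, f, C, C0, S, hw⟩ := bar s hs
  exact ⟨C, C0, fun x hx => (le_of_tendsto' (Ul x) fun n => Vw n w f (S _ (κn1 n)) x).trans (hw x hx)⟩
end

open Set MeasureTheory Filter Topology
open scoped ContDiff
set_option linter.unusedSectionVars false

section
variable {N : ℕ} [NeZero N]
variable {Ω : Set (EN N)} {φ : EN N → ℝ} {l : ℝ}

theorem grad_sq (v : EN N → ℝ) (x : EN N) :
    ‖gradient v x‖ ^ 2 = ∑ i : Fin N, (fderiv ℝ v x (EuclideanSpace.single i 1)) ^ 2 := by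
  rw [EuclideanSpace.real_norm_sq_eq]
  refine Finset.sum_congr rfl fun i _ => ?_
  congr 1
  have : inner ℝ (gradient v x) (EuclideanSpace.single i (1:ℝ)) = fderiv ℝ v x (EuclideanSpace.single i 1) := by
    simp [gradient]
  rw [← this, inner_single]

theorem fderiv_comp_app {v : EN N → ℝ} {x : EN N} (hv : DifferentiableAt ℝ v x) {ψ : ℝ → ℝ} {p : ℝ}
    (hψ : HasDerivAt ψ p (v x)) (e : EN N) : fderiv ℝ (fun y => ψ (v y)) x e = p * fderiv ℝ v x e := by
  have := (hψ.comp_hasFDerivAt x hv.hasFDerivAt).fderiv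
  have h2 : (fun y => ψ (v y)) = ψ ∘ v := rfl
  rw [h2, this]; simp

theorem grad_sq_comp {v : EN N → ℝ} {x : EN N} (hv : DifferentiableAt ℝ v x) {ψ : ℝ → ℝ} {p : ℝ}
    (hψ : HasDerivAt ψ p (v x)) : ‖gradient (fun y => ψ (v y)) x‖ ^ 2 = p ^ 2 * ‖gradient v x‖ ^ 2 := by
  rw [grad_sq, grad_sq, Finset.mul_sum]
  refine Finset.sum_congr rfl fun i _ => ?_
  rw [fderiv_comp_app hv hψ]; ring

theorem lap_comp (hΩ : IsOpen Ω) {v : EN N → ℝ} (hv : ContDiffOn ℝ 2 v Ω) {x : EN N} (hx : x ∈ Ω)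
    {ψ ψ1 : ℝ → ℝ} {p : ℝ}
    (h1 : ∀ y ∈ Ω, HasDerivAt ψ (ψ1 (v y)) (v y)) (h2 : HasDerivAt ψ1 p (v x)) :
    lap (fun y => ψ (v y)) x = ψ1 (v x) * lap v x + p * ‖gradient v x‖ ^ 2 := by
  have hd : ∀ y ∈ Ω, DifferentiableAt ℝ v y := fun y hy =>
    (hv.contDiffAt (hΩ.mem_nhds hy)).differentiableAt two_ne_zero
  rw [grad_sq, Finset.mul_sum]
  unfold lap
  rw [Finset.mul_sum, ← Finset.sum_add_distrib]
  refine Finset.sum_congr rfl fun i _ => ?_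
  set e : EN N := EuclideanSpace.single i 1
  have ev : (fun y => fderiv ℝ (fun y => ψ (v y)) y e) =ᶠ[𝓝 x] fun y => ψ1 (v y) * fderiv ℝ v y e := by
    filter_upwards [hΩ.mem_nhds hx] with y hy using fderiv_comp_app (hd y hy) (h1 y hy) e
  rw [ev.fderiv_eq]
  have d1 : DifferentiableAt ℝ (fun y => fderiv ℝ v y e) x := by
    have := (hv.contDiffAt (hΩ.mem_nhds hx)).fderiv_right (m := 1) (by norm_num)
    exact (this.differentiableAt one_ne_zero).clm_apply (differentiableAt_const e)
  have d2 := (h2.comp_hasFDerivAt x (hd x hx).hasFDerivAt)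
  have d2' : DifferentiableAt ℝ (fun y => ψ1 (v y)) x := d2.differentiableAt
  rw [fderiv_fun_mul d2' d1]
  have := fderiv_comp_app (hd x hx) h2 e
  simp [this]; ring

/-- local Hölder at a point with exponent `r` -/
def LHr (r : ℝ) (f : EN N → ℝ) (x : EN N) : Prop :=
  ∃ R, 0 < R ∧ ∃ H, 0 ≤ H ∧ ∀ y ∈ Metric.closedBall x R, ∀ z ∈ Metric.closedBall x R,
    |f y - f z| ≤ H * ‖y - z‖ ^ r

theorem LHr.of_C1 {r : ℝ} (_ : 0 < r) (r1 : r ≤ 1) {f : EN N → ℝ} {x : EN N} (hf : ContDiffAt ℝ 1 f x) :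
    LHr r f x := by
  obtain ⟨K, t, ht, hL⟩ := hf.exists_lipschitzOnWith
  obtain ⟨R, hR, hb⟩ := Metric.nhds_basis_closedBall.mem_iff.1 ht
  refine ⟨min R (1 / 2), by positivity, K, K.2, fun y hy z hz => ?_⟩
  have sub : Metric.closedBall x (min R (1 / 2)) ⊆ t :=
    (Metric.closedBall_subset_closedBall (min_le_left _ _)).trans hb
  have e := hL.dist_le_mul y (sub hy) z (sub hz)
  rw [Real.dist_eq, dist_eq_norm] at e
  refine e.trans (mul_le_mul_of_nonneg_left ?_ K.2)
  have d : ‖y - z‖ ≤ 1 := by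
    rw [← dist_eq_norm]
    have a : dist y x ≤ 1 / 2 := (Metric.mem_closedBall.1 hy).trans (min_le_right _ _)
    have b : dist z x ≤ 1 / 2 := (Metric.mem_closedBall.1 hz).trans (min_le_right _ _)
    linarith [dist_triangle_right y z x]
  exact Real.self_le_rpow_of_le_one (norm_nonneg _) d r1

theorem LHr.mul {r : ℝ} (r0 : 0 < r) {f g : EN N → ℝ} {x : EN N} (hf : LHr r f x) (hg : LHr r g x) :
    LHr r (fun y => f y * g y) x := by
  obtain ⟨R, hR, H, H0, h⟩ := hf
  obtain ⟨R', hR', H', H0', h'⟩ := hg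
  set ρ := min R R'
  have ρ0 : 0 < ρ := lt_min hR hR'
  have s1 : Metric.closedBall x ρ ⊆ Metric.closedBall x R := Metric.closedBall_subset_closedBall (min_le_left _ _)
  have s2 : Metric.closedBall x ρ ⊆ Metric.closedBall x R' := Metric.closedBall_subset_closedBall (min_le_right _ _)
  have x1 := Metric.mem_closedBall_self (x := x) hR.le
  have x2 := Metric.mem_closedBall_self (x := x) hR'.le
  have bd : ∀ (f : EN N → ℝ) (H : ℝ) (y : EN N), 0 ≤ H → ‖y - x‖ ≤ ρ → |f y - f x| ≤ H * ‖y - x‖ ^ r →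
      |f y| ≤ |f x| + H * ρ ^ r := fun f H y H0 hy hh => by
    have := abs_sub_abs_le_abs_sub (f y) (f x)
    have : H * ‖y - x‖ ^ r ≤ H * ρ ^ r := by gcongr
    linarith
  refine ⟨ρ, ρ0, (|f x| + H * ρ ^ r) * H' + H * (|g x| + H' * ρ ^ r), by positivity, fun y hy z hz => ?_⟩
  have b1 := bd f H y H0 (by rw [← dist_eq_norm]; exact hy) (h y (s1 hy) x x1)
  have b2 := bd g H' z H0' (by rw [← dist_eq_norm]; exact hz) (h' z (s2 hz) x x2)
  have e : f y * g y - f z * g z = f y * (g y - g z) + (f y - f z) * g z := by ring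
  rw [e]
  refine (abs_add_le _ _).trans ?_
  rw [abs_mul, abs_mul]
  have c1 := mul_le_mul b1 (h' y (s2 hy) z (s2 hz)) (abs_nonneg _) (by positivity)
  have c2 := mul_le_mul (h y (s1 hy) z (s1 hz)) b2 (abs_nonneg _) (by positivity)
  linarith

theorem LHr.comp {g : ℝ → ℝ} {r C : NNReal} (r0 : 0 < r) {u : EN N → ℝ} {x : EN N} {t : Set ℝ}
    (hg : HolderOnWith C r g t) (ht : t ∈ 𝓝 (u x)) (hu : ContDiffAt ℝ 1 u x) (mu : ℝ) :
    LHr r (fun y => g (u y) + mu) x := by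
  obtain ⟨K, s, hs, hL⟩ := hu.exists_lipschitzOnWith
  have hpre := hu.continuousAt.preimage_mem_nhds ht
  obtain ⟨R, hR, hb⟩ := Metric.nhds_basis_closedBall.mem_iff.1 (inter_mem hs hpre)
  refine ⟨R, hR, C * (K:ℝ) ^ (r:ℝ), by positivity, fun y hy z hz => ?_⟩
  have e1 := hL.dist_le_mul y (hb hy).1 z (hb hz).1
  have e2 := hg.dist_le_of_le (hb hy).2 (hb hz).2 e1
  rw [Real.dist_eq, dist_eq_norm, Real.mul_rpow (NNReal.coe_nonneg K) (norm_nonneg _)] at e2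
  rw [mul_assoc]
  calc _ = |g (u y) - g (u z)| := by congr 1; ring
    _ ≤ _ := e2
end

open Set MeasureTheory Filter Topology
open scoped ContDiff
set_option linter.unusedSectionVars false

section
variable {N : ℕ} [NeZero N]
variable {Ω : Set (EN N)} {φ : EN N → ℝ} {l : ℝ}

theorem dom_of (hΩ : IsOpen Ω) (hb : Bornology.IsBounded Ω) (hl : 0 < l) {p : EN N → ℝ}
    (h1 : ContDiffOn ℝ 2 p Ω) (h2 : ContinuousOn p (closure Ω)) (h3 : ∀ x ∈ Ω, 0 < p x)
    (h4 : ∀ x ∈ frontier Ω, p x = 0) (h5 : ∀ x ∈ Ω, -(lap p x) = l * p x) :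
    Dom Ω (Ω.indicator p) l := by
  refine ⟨hΩ, hb, ?_, ?_, ?_, ?_, hl⟩
  · refine continuous_indicator h4 h2
  · intro x hx; simpa [hx] using h3 x hx
  · intro x hx; simp [hx]
  · refine (MV_of_C2 hΩ h1).congr (fun x hx => by simp [hx]) (fun x hx => by simp [hx, h5 x hx])

theorem LocHolderOn.contOn {g : ℝ → ℝ} (hg : LocHolderOn g (Ioi (0:ℝ))) : ContinuousOn g (Ioi 0) := by
  obtain ⟨r, r0, _, hr⟩ := hg
  intro x hx
  obtain ⟨t, ht, C, hC⟩ := hr x hx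
  have hx' : (Ioi (0:ℝ)) ∈ 𝓝 x := Ioi_mem_nhds hx
  rw [nhdsWithin_eq_nhds.2 hx'] at ht
  have := hC.continuousOn r0
  exact (this.continuousAt ht).continuousWithinAt

theorem reg (hΩ : IsOpen Ω) {g : ℝ → ℝ} (hg : LocHolderOn g (Ioi (0:ℝ))) {A θ : ℝ → ℝ} {mu : ℝ}
    (hA : ContDiffOn ℝ 1 A (Ioi 0)) (hθ : ContDiffOn ℝ 1 θ (Ioi 0)) (θ0 : ∀ t, 0 < t → 0 < θ t)
    {v : EN N → ℝ} (vc : Continuous v) (v0 : ∀ x ∈ Ω, 0 < v x)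
    (mv : MV Ω v (fun x => A (v x) * (g (θ (v x)) + mu))) :
    ContDiffOn ℝ 2 v Ω ∧ ∀ x ∈ Ω, - lap v x = A (v x) * (g (θ (v x)) + mu) := by
  have vm : MapsTo v Ω (Ioi 0) := v0
  have fc : ContinuousOn (fun x => A (v x) * (g (θ (v x)) + mu)) Ω :=
    (hA.continuousOn.comp vc.continuousOn vm).mul
      ((hg.contOn.comp (hθ.continuousOn.comp vc.continuousOn vm) fun x hx => θ0 _ (v0 x hx)).add
        continuousOn_const)
  have gv := vc.continuousOn.good hΩ
  have gf := fc.good hΩ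
  have v1 := mv.C1 hΩ gv gf
  obtain ⟨r, r0, r1, hr⟩ := hg
  have v2 := mv.C2 hΩ gv gf fun x hx => by
    have n := hΩ.mem_nhds hx
    have np : Ioi (0:ℝ) ∈ 𝓝 (v x) := Ioi_mem_nhds (v0 x hx)
    have vx := v1.contDiffAt n
    have a1 : ContDiffAt ℝ 1 (fun y => A (v y)) x := (hA.contDiffAt np).comp x vx
    have a2 : ContDiffAt ℝ 1 (fun y => θ (v y)) x := (hθ.contDiffAt np).comp x vx
    obtain ⟨t, ht, C, hC⟩ := hr (θ (v x)) (θ0 _ (v0 x hx))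
    rw [nhdsWithin_eq_nhds.2 (Ioi_mem_nhds (θ0 _ (v0 x hx)))] at ht
    have b1 : LHr (r:ℝ) (fun y => A (v y)) x := LHr.of_C1 (by exact_mod_cast r0) (by exact_mod_cast r1) a1
    have b2 := LHr.comp r0 hC ht a2 mu
    obtain ⟨R, hR, H, H0, h⟩ := b1.mul (by exact_mod_cast r0) b2
    exact ⟨R, hR, H, H0, r, by exact_mod_cast r0, h⟩
  exact ⟨v2, mv.lap_eq hΩ v2 fc⟩

theorem suff (h : Dom Ω φ l) {g : ℝ → ℝ} (hg : LocHolderOn g (Ioi (0:ℝ)))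
    (gp : ∀ s : ℝ, 0 < s → 0 < g s) (ga : ∀ s t : ℝ, 0 < s → s ≤ t → g t ≤ g s)
    (g1 : Tendsto g (𝓝[>] 0) atTop) {a : ℝ} (ha : 0 ≤ a) (gl : Tendsto g atTop (𝓝 a))
    {lam mu : ℝ} (hlam : 0 ≤ lam) (hmu : 0 ≤ mu) (hlt : lam * (a + mu) < l) :
    ∃ u, IsSolP' Ω g lam mu u := by
  have gc := hg.contOn
  rcases hlam.eq_or_lt with rfl | hpos
  · obtain ⟨v, vc, v0, vz, mv⟩ := h.nonlin (F := fun t => g t + mu) (κ := 0)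
      (fun t ht => add_pos_of_pos_of_nonneg (gp t ht) hmu) (gc.add continuousOn_const)
      (tendsto_atTop_add_const_right _ _ g1) le_rfl h.l0
      (fun s hs => ⟨g s + mu, add_nonneg (gp s hs).le hmu, fun t ht => by
        have := ga s t hs ht
        simpa using this⟩)
    obtain ⟨v2, hv⟩ := reg h.op hg (A := fun _ => 1) (θ := fun t => t) (mu := mu) contDiffOn_const contDiffOn_id
      (fun t ht => ht) vc v0 (mv.congr (fun _ _ => rfl) fun x _ => by simp)
    exact ⟨v, v2, vc.continuousOn, v0, fun x hx => vz x (frontier_notMem h.op hx), fun x hx => by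
      rw [hv x hx]; ring⟩
  · let θ : ℝ → ℝ := fun t => Real.log (1 + t) / lam
    let A : ℝ → ℝ := fun t => lam * (t + 1)
    have θ0 : ∀ t, 0 < t → 0 < θ t := fun t ht => div_pos (Real.log_pos (by linarith)) hpos
    have θm : ∀ s t, 0 < s → s ≤ t → θ s ≤ θ t := fun s t hs hst =>
      div_le_div_of_nonneg_right (Real.log_le_log (by linarith) (by linarith)) hpos.le
    have θ2 : ContDiffOn ℝ 2 θ (Ioi (-1)) := by
      refine ContDiffOn.div_const (ContDiffOn.log (by fun_prop) fun t ht => ?_) _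
      have : (-1:ℝ) < t := ht
      linarith
    have sub : Ioi (0:ℝ) ⊆ Ioi (-1) := Ioi_subset_Ioi (by norm_num)
    have θc := θ2.continuousOn
    have A1 : ContDiffOn ℝ 1 A (Ioi 0) := by fun_prop
    have gθc : ContinuousOn (fun t => g (θ t)) (Ioi 0) := gc.comp (θc.mono sub) fun t ht => θ0 t ht
    have θlim : Tendsto θ (𝓝[>] 0) (𝓝[>] 0) := by
      refine tendsto_nhdsWithin_iff.2 ⟨?_, eventually_nhdsWithin_of_forall fun t ht => θ0 t ht⟩
      have c : ContinuousAt θ 0 := θc.continuousAt (Ioi_mem_nhds (by norm_num))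
      have : Tendsto θ (𝓝 0) (𝓝 (θ 0)) := c
      simp only [θ, add_zero, Real.log_one, zero_div] at this
      exact this.mono_left nhdsWithin_le_nhds
    have θtop : Tendsto θ atTop atTop :=
      (Real.tendsto_log_atTop.comp (tendsto_atTop_add_const_left _ 1 tendsto_id)).atTop_div_const hpos
    set κ := (lam * (a + mu) + l) / 2 with hκ
    have am : 0 ≤ lam * (a + mu) := by positivity
    have κ0 : 0 ≤ κ := by have := h.l0; positivity
    have κ1 : lam * (a + mu) < κ := by rw [hκ]; linarith
    have κl : κ < l := by rw [hκ]; linarith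
    obtain ⟨v, vc, v0, vz, mv⟩ := h.nonlin (F := fun t => A t * (g (θ t) + mu)) (κ := κ)
      (fun t ht => mul_pos (mul_pos hpos (by linarith)) (add_pos_of_pos_of_nonneg (gp _ (θ0 t ht)) hmu))
      (A1.continuousOn.mul (gθc.add continuousOn_const))
      (by
        refine tendsto_atTop_mono' _ ?_ ((g1.comp θlim).const_mul_atTop hpos)
        refine eventually_nhdsWithin_of_forall fun t ht => ?_
        have ht' : 0 < t := ht
        have p := gp _ (θ0 t ht)
        show lam * g (θ t) ≤ lam * (t + 1) * (g (θ t) + mu)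
        rw [mul_assoc]
        refine mul_le_mul_of_nonneg_left ?_ hpos.le
        nlinarith [mul_nonneg ht'.le p.le, mul_nonneg ht'.le hmu])
      κ0 κl
      (fun s hs => by
        have t1 : Tendsto (fun t => lam * (g (θ t) + mu)) atTop (𝓝 (lam * (a + mu))) :=
          ((gl.comp θtop).add_const mu).const_mul lam
        obtain ⟨T, hT⟩ := eventually_atTop.1 (t1.eventually_lt_const κ1)
        have gs := gp _ (θ0 s hs)
        refine ⟨κ + lam * (|T| + 1) * (g (θ s) + mu), by positivity, fun t ht => ?_⟩
        have t0 : 0 < t := lt_of_lt_of_le hs ht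
        have gt := gp _ (θ0 t t0)
        have extra : 0 ≤ lam * (|T| + 1) * (g (θ s) + mu) := by positivity
        show lam * (t + 1) * (g (θ t) + mu) ≤ _
        by_cases hc : T ≤ t
        · have := (hT t hc).le
          have e : lam * (t + 1) * (g (θ t) + mu) = (lam * (g (θ t) + mu)) * (t + 1) := by ring
          rw [e]
          have : lam * (g (θ t) + mu) * (t + 1) ≤ κ * (t + 1) := by gcongr
          linarith
        · have tT : t ≤ |T| := (not_le.1 hc).le.trans (le_abs_self T)
          have gg := ga _ _ (θ0 s hs) (θm s t hs ht)
          have : lam * (t + 1) * (g (θ t) + mu) ≤ lam * (|T| + 1) * (g (θ s) + mu) := by gcongr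
          have : 0 ≤ κ * t := by positivity
          linarith)
    obtain ⟨v2, hv⟩ := reg h.op hg (A := A) (θ := θ) (mu := mu) A1
      ((θ2.mono sub).of_le (by norm_num)) θ0 vc v0 mv
    have vm : MapsTo v Ω (Ioi (-1)) := fun x hx => sub (v0 x hx)
    have vnn : ∀ x, 0 ≤ v x := fun x => by
      by_cases hx : x ∈ Ω
      · exact (v0 x hx).le
      · rw [vz x hx]
    refine ⟨fun x => θ (v x), θ2.comp v2 vm, ?_, fun x hx => θ0 _ (v0 x hx), fun x hx => ?_, fun x hx => ?_⟩
    · refine (θc.comp vc.continuousOn fun x _ => ?_)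
      show -1 < v x
      linarith [vnn x]
    · simp [θ, vz x (frontier_notMem h.op hx)]
    · have d1 : ∀ y, 0 < y → HasDerivAt θ ((1 + y)⁻¹ / lam) y := fun y hy => by
        have : HasDerivAt (fun t : ℝ => 1 + t) 1 y := (hasDerivAt_id y).const_add 1
        have := (this.log (by positivity)).div_const lam
        simpa using this
      have d2 : HasDerivAt (fun y : ℝ => (1 + y)⁻¹ / lam) (-1 / (1 + v x) ^ 2 / lam) (v x) := by
        have : HasDerivAt (fun t : ℝ => 1 + t) 1 (v x) := (hasDerivAt_id _).const_add 1
        exact (this.inv (by have := v0 x hx; positivity)).div_const lam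
      have dv : DifferentiableAt ℝ v x := (v2.contDiffAt (h.op.mem_nhds hx)).differentiableAt two_ne_zero
      rw [lap_comp h.op v2 hx (fun y hy => d1 _ (v0 y hy)) d2, grad_sq_comp dv (d1 _ (v0 x hx))]
      have e := hv x hx
      have e' : lap v x = - (lam * (v x + 1) * (g (θ (v x)) + mu)) := by rw [← e]; ring
      rw [e']
      have := v0 x hx
      have : 1 + v x ≠ 0 := by positivity
      field_simp
      ring

theorem nec (h : IsOpen Ω) (hb : Bornology.IsBounded Ω) (hne : Ω.Nonempty) (hl : 0 < l) {p : EN N → ℝ}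
    (h1 : ContDiffOn ℝ 2 p Ω) (h2 : ContinuousOn p (closure Ω)) (h3 : ∀ x ∈ Ω, 0 < p x)
    (h4 : ∀ x ∈ frontier Ω, p x = 0) (h5 : ∀ x ∈ Ω, -(lap p x) = l * p x) {g : ℝ → ℝ}
    (ga : ∀ s t : ℝ, 0 < s → s ≤ t → g t ≤ g s) {a : ℝ} (gl : Tendsto g atTop (𝓝 a))
    {lam mu : ℝ} (hlam : 0 ≤ lam) {u : EN N → ℝ} (hu : IsSolP' Ω g lam mu u) :
    lam * (a + mu) < l := by
  by_contra! hc
  have hpos : 0 < lam := by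
    rcases hlam.eq_or_lt with rfl | hp
    · simp at hc; linarith
    · exact hp
  obtain ⟨u2, uc, u0, uz, ue⟩ := hu
  have gge : ∀ s, 0 < s → a ≤ g s := fun s hs =>
    le_of_tendsto gl ((eventually_ge_atTop s).mono fun t ht => ga s t hs ht)
  let w : EN N → ℝ := fun x => Real.exp (lam * u x) - 1 / 2
  have w2 : ContDiffOn ℝ 2 w Ω := by
    have := Real.contDiff_exp (n := 2)
    exact (this.comp_contDiffOn (contDiffOn_const.mul u2)).sub contDiffOn_const
  have wc : ContinuousOn w (closure Ω) := by fun_prop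
  have unn : ∀ x ∈ closure Ω, 0 ≤ u x := fun x hx => by
    by_cases hxΩ : x ∈ Ω
    · exact (u0 x hxΩ).le
    · exact (uz x (by rw [h.frontier_eq]; exact ⟨hx, hxΩ⟩)).ge
  have wpos : ∀ x ∈ closure Ω, 0 < w x := fun x hx => by
    have := Real.one_le_exp (mul_nonneg hlam (unn x hx))
    simp only [w]; linarith
  have wl : ∀ x ∈ Ω, l * (w x + 1 / 2) ≤ - lap w x := fun x hx => by
    have d1 : ∀ y, HasDerivAt (fun t => Real.exp (lam * t) - 1 / 2) (lam * Real.exp (lam * y)) y := fun y => by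
      have : HasDerivAt (fun t : ℝ => lam * t) lam y := by simpa using (hasDerivAt_id y).const_mul lam
      exact (this.exp.sub_const _).congr_deriv (by ring)
    have d2 : HasDerivAt (fun t => lam * Real.exp (lam * t)) (lam ^ 2 * Real.exp (lam * u x)) (u x) := by
      have : HasDerivAt (fun t : ℝ => lam * t) lam (u x) := by simpa using (hasDerivAt_id (u x)).const_mul lam
      exact (this.exp.const_mul lam).congr_deriv (by ring)
    have e := lap_comp h u2 hx (fun y _ => d1 (u y)) d2
    have e2 := ue x hx
    have e3 : - lap w x = lam * Real.exp (lam * u x) * (g (u x) + mu) := by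
      have e4 : lap u x = - (g (u x) + lam * ‖gradient u x‖ ^ 2 + mu) := by rw [← e2]; ring
      show - lap (fun y => Real.exp (lam * u y) - 1 / 2) x = _
      rw [e, e4]; ring
    rw [e3]
    have : w x + 1 / 2 = Real.exp (lam * u x) := by simp only [w]; ring
    rw [this]
    have E := Real.exp_pos (lam * u x)
    have g3 := gge (u x) (u0 x hx)
    have : l ≤ lam * (g (u x) + mu) := hc.trans (by gcongr)
    nlinarith
  have dc : ContinuousOn (fun x => p x / w x) (closure Ω) := h2.div wc fun x hx => (wpos x hx).ne'
  obtain ⟨x1, hx1⟩ := hne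
  obtain ⟨x0, hx0, hmax⟩ := hb.isCompact_closure.exists_isMaxOn ⟨x1, subset_closure hx1⟩ dc
  set m := p x0 / w x0 with hm
  have m0 : 0 < m := (div_pos (h3 x1 hx1) (wpos x1 (subset_closure hx1))).trans_le (hmax (subset_closure hx1))
  have hx0Ω : x0 ∈ Ω := by
    by_contra hn
    have := h4 x0 (by rw [h.frontier_eq]; exact ⟨hx0, hn⟩)
    rw [hm, this, zero_div] at m0
    exact lt_irrefl _ m0
  have pc := h1.continuousOn
  have wc' := w2.continuousOn
  have lp := (lap_continuousOn h h1).neg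
  have lw := (lap_continuousOn h w2).neg
  have M := (MV_of_C2 h h1).comb (MV_of_C2 h w2) (pc.good h) (lp.good h) (wc'.good h) (lw.good h) 1 (-m)
  have kc : ContinuousOn (fun x => 1 * - lap p x + -m * - lap w x) Ω :=
    (continuousOn_const.mul lp).add (continuousOn_const.mul lw)
  have key := M.no_max h (ContinuousOn.good h (by fun_prop)) (kc.good h) hx0Ω
    (kc.continuousAt (h.mem_nhds hx0Ω)) (fun y hy => by
      have e1 : p y / w y ≤ m := hmax (subset_closure hy)
      rw [div_le_iff₀ (wpos y (subset_closure hy))] at e1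
      have e2 : p x0 = m * w x0 := by
        have := (wpos x0 hx0).ne'
        rw [hm]; field_simp
      linarith)
  rw [h5 x0 hx0Ω] at key
  have e2 : p x0 = m * w x0 := by
    have := (wpos x0 hx0).ne'
    rw [hm]; field_simp
  have := mul_le_mul_of_nonneg_left (wl x0 hx0Ω) m0.le
  rw [e2] at key
  nlinarith [mul_pos m0 hl]
end

theorem solvability_iff_quadratic_gradient
    {N : ℕ} (hN : 2 ≤ N) (Ω : Set (EuclideanSpace ℝ (Fin N)))
    (hΩopen : IsOpen Ω) (hΩbdd : Bornology.IsBounded Ω) (hΩne : Ω.Nonempty)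
    (g : ℝ → ℝ)
    (hg_holder : LocHolderOn g (Ioi (0:ℝ)))
    (hg_pos : ∀ s : ℝ, 0 < s → 0 < g s)
    (hg_anti : ∀ s t : ℝ, 0 < s → s ≤ t → g t ≤ g s)
    (hg1 : Tendsto g (nhdsWithin 0 (Ioi 0)) atTop)
    (aL : ℝ) (haL : 0 ≤ aL) (hglim : Tendsto g atTop (nhds aL))
    (lam1 : ℝ) (hlam1 : 0 < lam1) (phi1 : EuclideanSpace ℝ (Fin N) → ℝ)
    (hphi1 : ContDiffOn ℝ 2 phi1 Ω ∧ ContinuousOn phi1 (closure Ω) ∧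
      (∀ x ∈ Ω, 0 < phi1 x) ∧ (∀ x ∈ frontier Ω, phi1 x = 0) ∧
      (∀ x ∈ Ω, -(lap phi1 x) = lam1 * phi1 x))
    (lam mu : ℝ) (hlam : 0 ≤ lam) (hmu : 0 ≤ mu) :
    (∃ u, IsSolP' Ω g lam mu u) ↔ lam * (aL + mu) < lam1 := by
  haveI : NeZero N := ⟨by omega⟩
  obtain ⟨h1, h2, h3, h4, h5⟩ := hphi1
  constructor
  · rintro ⟨u, hu⟩
    exact nec hΩopen hΩbdd hΩne hlam1 h1 h2 h3 h4 h5 hg_anti hglim hlam hu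
  · intro hlt
    exact suff (dom_of hΩopen hΩbdd hlam1 h1 h2 h3 h4 h5) hg_holder hg_pos hg_anti hg1 haL hglim hlam hmu hlt
end

section
/- Assume g satisfies (g4), the potential p is negative in Ω, and the two-sided estimate c₁ d(x)^β ≤ |p(x)| ≤ c₂ d(x)^β holds in Ω. Then problem (Q) has no classical solution. -/
open Set MeasureTheory Filter Topology

/-- A classical solution of `−Δu = p(x) g(u) + q(x) |∇u|^a` in `Ω`, `u > 0` in `Ω`,
`u = 0` on `∂Ω`. -/
def IsSolQ {N : ℕ} (Ω : Set (EuclideanSpace ℝ (Fin N)))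
    (P q : EuclideanSpace ℝ (Fin N) → ℝ) (g : ℝ → ℝ) (a : ℝ)
    (u : EuclideanSpace ℝ (Fin N) → ℝ) : Prop :=
  ContDiffOn ℝ 2 u Ω ∧ ContinuousOn u (closure Ω) ∧
  (∀ x ∈ Ω, 0 < u x) ∧ (∀ x ∈ frontier Ω, u x = 0) ∧
  (∀ x ∈ Ω, -(lap u x) = P x * g (u x) + q x * ‖gradient u x‖ ^ a)

/-- At a local maximum the pure second directional derivatives are nonpositive. -/
theorem second_deriv_nonpos_of_isLocalMax {E : Type*} [NormedAddCommGroup E] [NormedSpace ℝ E]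
    {u : E → ℝ} {x : E} (hu : ContDiffAt ℝ 2 u x) (hmax : IsLocalMax u x) (e : E) :
    fderiv ℝ (fun y => fderiv ℝ u y e) x e ≤ 0 := by
  by_contra hcon
  push Not at hcon
  set L : ℝ → E := fun t => x + t • e with hL
  have hL0 : L 0 = x := by simp [hL]
  have hLd : ∀ t, HasDerivAt L e t := by
    intro t
    have h := ((hasDerivAt_id t).smul_const e).const_add x
    rw [one_smul] at h
    exact h
  have hLt : Tendsto L (𝓝 0) (𝓝 x) := by
    have := (hLd 0).continuousAt.tendsto
    rwa [hL0] at this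
  set φ : ℝ → ℝ := fun t => u (L t) with hφ
  have hdiff : ∀ᶠ y in 𝓝 x, DifferentiableAt ℝ u y := by
    have h1 : ∀ᶠ y in 𝓝 x, ContDiffAt ℝ 2 u y := hu.eventually (by simp)
    filter_upwards [h1] with y hy
    exact hy.differentiableAt (by simp)
  have hd1 : ∀ᶠ t in 𝓝 (0:ℝ), deriv φ t = fderiv ℝ u (L t) e := by
    filter_upwards [hLt.eventually hdiff] with t ht
    exact (ht.hasFDerivAt.comp_hasDerivAt t (hLd t)).deriv
  have hfd : DifferentiableAt ℝ (fderiv ℝ u) x :=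
    (hu.fderiv_right (m := 1) (by norm_num)).differentiableAt (by simp)
  have hf : DifferentiableAt ℝ (fun y => fderiv ℝ u y e) x :=
    hfd.clm_apply (differentiableAt_const e)
  have hd2 : deriv (deriv φ) 0 = fderiv ℝ (fun y => fderiv ℝ u y e) x e := by
    rw [Filter.EventuallyEq.deriv_eq hd1]
    have h := hf.hasFDerivAt
    rw [← hL0] at h
    have h2 := (h.comp_hasDerivAt (0:ℝ) (hLd 0)).deriv
    rw [hL0] at h2
    exact h2
  have hφmax : IsLocalMax φ 0 := by
    have : ∀ᶠ t in 𝓝 (0:ℝ), u (L t) ≤ u x := hLt.eventually hmax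
    filter_upwards [this] with t ht
    simpa [hφ, hL0] using ht
  have hφc : ContinuousAt φ 0 := by
    have : ContinuousAt u (L 0) := by rw [hL0]; exact hu.continuousAt
    exact ContinuousAt.comp this (hLd 0).continuousAt
  have hφmin : IsLocalMin φ 0 :=
    isLocalMin_of_deriv_deriv_pos (by rw [hd2]; exact hcon) hφmax.deriv_eq_zero hφc
  have hconst : φ =ᶠ[𝓝 0] fun _ => φ 0 := by
    filter_upwards [hφmax, hφmin] with t h1 h2
    exact le_antisymm h1 h2
  have h3 : deriv φ =ᶠ[𝓝 0] deriv (fun _ => φ 0) := hconst.deriv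
  have h4 := h3.deriv_eq
  rw [hd2] at h4
  simp at h4
  linarith

/-- If `g` satisfies (g4), `p < 0` in `Ω`, and
`c₁ d(x)^β ≤ |p(x)| ≤ c₂ d(x)^β` in `Ω`, then problem `(Q)` has no classical
solution. -/
theorem no_solution_negative_potential
    {N : ℕ} (hN : 2 ≤ N) (Ω : Set (EuclideanSpace ℝ (Fin N)))
    (hΩopen : IsOpen Ω) (hΩbdd : Bornology.IsBounded Ω) (hΩne : Ω.Nonempty)
    (a : ℝ) (ha₀ : 0 < a) (ha₁ : a < 1)
    (q : EuclideanSpace ℝ (Fin N) → ℝ)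
    (hq_holder : ∃ C r : NNReal, 0 < r ∧ r ≤ 1 ∧ HolderOnWith C r q (closure Ω))
    (hq_pos : ∀ x ∈ closure Ω, 0 < q x)
    (P : EuclideanSpace ℝ (Fin N) → ℝ) (hP : ContDiffOn ℝ 1 P Ω)
    (β c₁ c₂ : ℝ) (hc₁ : 0 < c₁) (hc₂ : 0 < c₂)
    (hPbound : ∀ x ∈ Ω, c₁ * Metric.infDist x (frontier Ω) ^ β ≤ |P x| ∧
      |P x| ≤ c₂ * Metric.infDist x (frontier Ω) ^ β)
    (g : ℝ → ℝ) (hg : ContDiffOn ℝ 1 g (Ioi 0))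
    (hg_pos : ∀ s : ℝ, 0 < s → 0 < g s)
    (hg_dec : ∀ s t : ℝ, 0 < s → s < t → g t < g s)
    (hg1 : Tendsto g (nhdsWithin 0 (Ioi 0)) atTop)
    (γ : ℝ) (hγ : max 1 (β + 1) < γ)
    (hg4 : ∃ ℓ > (0:ℝ), Tendsto (fun s : ℝ => s ^ γ * g s) (nhdsWithin 0 (Ioi 0)) (nhds ℓ))
    (hPneg : ∀ x ∈ Ω, P x < 0) :
    ¬ ∃ u : EuclideanSpace ℝ (Fin N) → ℝ, IsSolQ Ω P q g a u := by
  rintro ⟨u, hu2, huc, hupos, hu0, heq⟩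
  obtain ⟨y, hy⟩ := hΩne
  have hcomp : IsCompact (closure Ω) := hΩbdd.isCompact_closure
  obtain ⟨x, hx, hxmax⟩ := hcomp.exists_isMaxOn ⟨y, subset_closure hy⟩ huc
  have hux : 0 < u x := lt_of_lt_of_le (hupos y hy) (hxmax (subset_closure hy))
  have hxΩ : x ∈ Ω := by
    by_contra hn
    have : x ∈ frontier Ω := ⟨hx, by rwa [hΩopen.interior_eq]⟩
    rw [hu0 x this] at hux
    exact lt_irrefl _ hux
  have hnhds : Ω ∈ 𝓝 x := hΩopen.mem_nhds hxΩ
  have hmax : IsLocalMax u x := by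
    filter_upwards [hnhds] with z hz
    exact hxmax (subset_closure hz)
  have hcd : ContDiffAt ℝ 2 u x := hu2.contDiffAt hnhds
  have hlap : lap u x ≤ 0 :=
    Finset.sum_nonpos fun i _ => second_deriv_nonpos_of_isLocalMax hcd hmax _
  have hgrad : gradient u x = 0 := by
    simp [gradient, hmax.fderiv_eq_zero]
  have h := heq x hxΩ
  rw [hgrad, norm_zero, Real.zero_rpow ha₀.ne', mul_zero, add_zero] at h
  have := mul_neg_of_neg_of_pos (hPneg x hxΩ) (hg_pos _ hux)
  linarith
end

section
/- Assume g satisfies (g4), the potential p is positive in Ω, and the two-sided estimate c₁ d(x)^β ≤ |p(x)| ≤ c₂ d(x)^β holds in Ω. If β ≤ −2, then problem (Q) has no classical solution. -/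
open Set MeasureTheory Filter Topology

lemma second_deriv_nonneg_of_isLocalMin {f : ℝ → ℝ} (hf : ContinuousAt f 0)
    (h : IsLocalMin f 0) : 0 ≤ deriv (deriv f) 0 := by
  by_contra hneg
  push Not at hneg
  have hd : deriv f 0 = 0 := h.deriv_eq_zero
  have hmax : IsLocalMax f 0 := isLocalMax_of_deriv_deriv_neg hneg hd hf
  have hconst : f =ᶠ[𝓝 0] fun _ => f 0 := by
    filter_upwards [h, hmax] with t h1 h2
    exact le_antisymm h2 h1
  have h2 := hconst.deriv.deriv_eq
  simp at h2
  linarith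

lemma dir_second_deriv {E : Type*} [NormedAddCommGroup E] [NormedSpace ℝ E] {u : E → ℝ} {y e : E}
    (hu : ContDiffAt ℝ 2 u y) (A B k : ℝ)
    (h : IsLocalMin (fun t : ℝ => u (y + t • e) + (A + B * t + k * t ^ 2)) 0) :
    0 ≤ fderiv ℝ (fun z => fderiv ℝ u z e) y e + 2 * k := by
  have hline : ∀ t : ℝ, HasDerivAt (fun t : ℝ => y + t • e) e t := fun t => by
    simpa using ((hasDerivAt_id t).smul_const e).const_add y
  have hd : ∀ᶠ z in 𝓝 y, DifferentiableAt ℝ u z := by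
    filter_upwards [hu.eventually (by simp)] with z hz
    exact hz.differentiableAt (by norm_num)
  have hc : Tendsto (fun t : ℝ => y + t • e) (𝓝 0) (𝓝 y) := by
    have := (hline 0).continuousAt.tendsto
    simpa using this
  have hpoly : ∀ t : ℝ, HasDerivAt (fun t : ℝ => A + B * t + k * t ^ 2) (B + 2 * k * t) t := by
    intro t
    have h1 := (((hasDerivAt_id t).const_mul B).const_add A).add
      (((hasDerivAt_id t).pow 2).const_mul k)
    refine h1.congr_deriv ?_
    simp
    ring
  have hder : deriv (fun t : ℝ => u (y + t • e) + (A + B * t + k * t ^ 2)) =ᶠ[𝓝 0]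
      fun t => fderiv ℝ u (y + t • e) e + (B + 2 * k * t) := by
    filter_upwards [hc.eventually hd] with t ht
    exact ((ht.hasFDerivAt.comp_hasDerivAt t (hline t)).add (hpoly t)).deriv
  have hfd : DifferentiableAt ℝ (fun z => fderiv ℝ u z e) y := by
    have h1 : DifferentiableAt ℝ (fderiv ℝ u) y :=
      (hu.fderiv_right (m := 1) (by norm_num)).differentiableAt (by norm_num)
    exact h1.clm_apply (differentiableAt_const e)
  have h2 : HasDerivAt (fun t : ℝ => fderiv ℝ u (y + t • e) e + (B + 2 * k * t))
      (fderiv ℝ (fun z => fderiv ℝ u z e) y e + 2 * k) 0 := by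
    have h3 : HasFDerivAt (fun z => fderiv ℝ u z e) (fderiv ℝ (fun z => fderiv ℝ u z e) y)
      (y + (0:ℝ) • e) := by simpa using hfd.hasFDerivAt
    have h4 := h3.comp_hasDerivAt 0 (hline 0)
    refine h4.add ?_
    simpa using ((hasDerivAt_id (0:ℝ)).const_mul (2 * k)).const_add B
  have hcont : ContinuousAt (fun t : ℝ => u (y + t • e) + (A + B * t + k * t ^ 2)) 0 := by
    refine ContinuousAt.add ?_ (hpoly 0).continuousAt
    have : ContinuousAt u (y + (0:ℝ) • e) := by simpa using hu.continuousAt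
    exact ContinuousAt.comp (f := fun t : ℝ => y + t • e) this (hline 0).continuousAt
  have := second_deriv_nonneg_of_isLocalMin hcont h
  rw [hder.deriv_eq, h2.deriv] at this
  exact this

lemma ball_lower_bound {N : ℕ} {u : EuclideanSpace ℝ (Fin N) → ℝ} {x : EuclideanSpace ℝ (Fin N)}
    {r k : ℝ} (hr : 0 < r)
    (hu : ∀ y ∈ Metric.closedBall x r, ContDiffAt ℝ 2 u y)
    (hpos : ∀ y ∈ Metric.closedBall x r, 0 < u y)
    (hlap : ∀ y ∈ Metric.closedBall x r, 2 * N * k < -(lap u y)) :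
    k * r ^ 2 ≤ u x := by
  have hcont : ContinuousOn (fun y => u y + k * ‖y - x‖ ^ 2) (Metric.closedBall x r) := by
    refine ContinuousOn.add (fun y hy => (hu y hy).continuousAt.continuousWithinAt) ?_
    fun_prop
  obtain ⟨y, hy, hmin⟩ := (isCompact_closedBall x r).exists_isMinOn
    ⟨x, Metric.mem_closedBall_self hr.le⟩ hcont
  rcases (Metric.mem_closedBall.1 hy).lt_or_eq with hlt | heq
  · exfalso
    have hloc : IsLocalMin (fun y => u y + k * ‖y - x‖ ^ 2) y :=
      hmin.isLocalMin (Metric.closedBall_mem_nhds_of_mem hlt)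
    have key : ∀ i : Fin N, 0 ≤ fderiv ℝ (fun z => fderiv ℝ u z (EuclideanSpace.single i 1)) y
        (EuclideanSpace.single i 1) + 2 * k := by
      intro i
      set e : EuclideanSpace ℝ (Fin N) := EuclideanSpace.single i 1 with he
      have hnorm : ‖e‖ = 1 := by simp [he]
      refine dir_second_deriv (hu y hy) (k * ‖y - x‖ ^ 2) (2 * k * inner ℝ (y - x) e) k ?_
      have hc : Tendsto (fun t : ℝ => y + t • e) (𝓝 0) (𝓝 y) := by
        have : Continuous (fun t : ℝ => y + t • e) := by fun_prop
        simpa using this.tendsto 0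
      have := hc.eventually hloc
      have hexp : ∀ t : ℝ, u (y + t • e) + (k * ‖y - x‖ ^ 2 + 2 * k * inner ℝ (y - x) e * t
          + k * t ^ 2) = u (y + t • e) + k * ‖y + t • e - x‖ ^ 2 := by
        intro t
        have h1 : y + t • e - x = (y - x) + t • e := by abel
        rw [h1, norm_add_sq_real, inner_smul_right, norm_smul, hnorm]
        simp
        ring
      have h0 := hexp 0
      filter_upwards [this] with t ht
      rw [hexp t, h0]
      simpa using ht
    have hs := Finset.sum_nonneg (fun i (_ : i ∈ Finset.univ) => key i)
    rw [Finset.sum_add_distrib] at hs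
    simp only [Finset.sum_const, Finset.card_univ, Fintype.card_fin, nsmul_eq_mul] at hs
    have := hlap y hy
    unfold lap at this
    linarith
  · have h1 := hmin (Metric.mem_closedBall_self hr.le)
    simp only [Set.mem_ofPred_eq, sub_self, norm_zero] at h1
    rw [← dist_eq_norm, heq] at h1
    have := hpos y hy
    nlinarith

/-- If `g` satisfies (g4), `p > 0` in `Ω`,
`c₁ d(x)^β ≤ |p(x)| ≤ c₂ d(x)^β` in `Ω`, and `β ≤ −2`, then problem `(Q)` has no
classical solution. -/
theorem no_solution_strong_boundary_singularity
    {N : ℕ} (hN : 2 ≤ N) (Ω : Set (EuclideanSpace ℝ (Fin N)))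
    (hΩopen : IsOpen Ω) (hΩbdd : Bornology.IsBounded Ω) (hΩne : Ω.Nonempty)
    (a : ℝ) (ha₀ : 0 < a) (ha₁ : a < 1)
    (q : EuclideanSpace ℝ (Fin N) → ℝ)
    (hq_holder : ∃ C r : NNReal, 0 < r ∧ r ≤ 1 ∧ HolderOnWith C r q (closure Ω))
    (hq_pos : ∀ x ∈ closure Ω, 0 < q x)
    (P : EuclideanSpace ℝ (Fin N) → ℝ) (hP : ContDiffOn ℝ 1 P Ω)
    (β c₁ c₂ : ℝ) (hc₁ : 0 < c₁) (hc₂ : 0 < c₂)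
    (hPbound : ∀ x ∈ Ω, c₁ * Metric.infDist x (frontier Ω) ^ β ≤ |P x| ∧
      |P x| ≤ c₂ * Metric.infDist x (frontier Ω) ^ β)
    (g : ℝ → ℝ) (hg : ContDiffOn ℝ 1 g (Ioi 0))
    (hg_pos : ∀ s : ℝ, 0 < s → 0 < g s)
    (hg_dec : ∀ s t : ℝ, 0 < s → s < t → g t < g s)
    (hg1 : Tendsto g (nhdsWithin 0 (Ioi 0)) atTop)
    (γ : ℝ) (hγ : max 1 (β + 1) < γ)
    (hg4 : ∃ ℓ > (0:ℝ), Tendsto (fun s : ℝ => s ^ γ * g s) (nhdsWithin 0 (Ioi 0)) (nhds ℓ))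
    (hPpos : ∀ x ∈ Ω, 0 < P x) (hβ : β ≤ -2) :
    ¬ ∃ u : EuclideanSpace ℝ (Fin N) → ℝ, IsSolQ Ω P q g a u := by
  rintro ⟨u, hu2, huc, hupos, hu0, heq⟩
  have hNpos : (0:ℝ) < N := by
    have : 0 < N := by omega
    exact_mod_cast this
  have : Nonempty (Fin N) := ⟨⟨0, by omega⟩⟩
  have : Nontrivial (EuclideanSpace ℝ (Fin N)) := inferInstance
  -- the boundary is nonempty
  have hfr : (frontier Ω).Nonempty := by
    rw [nonempty_iff_ne_empty]
    intro h
    rcases isClopen_iff.1 (isClopen_iff_frontier_eq_empty.2 h) with h | h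
    · exact hΩne.ne_empty h
    · rw [h] at hΩbdd
      exact NormedSpace.unbounded_univ ℝ (EuclideanSpace ℝ (Fin N)) hΩbdd
  have hdisj : ∀ x ∈ Ω, x ∉ frontier Ω := by
    intro x hx hx'
    rw [hΩopen.frontier_eq] at hx'
    exact hx'.2 hx
  have hdpos : ∀ x ∈ Ω, 0 < Metric.infDist x (frontier Ω) := fun x hx =>
    (isClosed_frontier.notMem_iff_infDist_pos hfr).1 (hdisj x hx)
  -- an upper bound for u
  obtain ⟨M, hM⟩ := (hΩbdd.isCompact_closure).bddAbove_image huc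
  have hM' : ∀ x ∈ Ω, u x < max M 0 + 1 := by
    intro x hx
    have : u x ≤ M := hM ⟨x, subset_closure hx, rfl⟩
    have := le_max_left M 0
    linarith
  set m := g (max M 0 + 1) with hm
  have hmpos : 0 < m := hg_pos _ (by positivity)
  have hgm : ∀ x ∈ Ω, m ≤ g (u x) := fun x hx => (hg_dec _ _ (hupos x hx) (hM' x hx)).le
  -- the key lower bound
  have key : ∀ x ∈ Ω, 3 / 2 * Metric.infDist x (frontier Ω) ≤ 1 → c₁ * m / (36 * N) ≤ u x := by
    intro x hx hx1
    set d := Metric.infDist x (frontier Ω) with hd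
    have hd0 : 0 < d := hdpos x hx
    have hsub : Metric.closedBall x (d / 2) ⊆ Ω := by
      intro y hy
      by_contra hyΩ
      have hpre : IsPreconnected (Metric.closedBall x (d / 2)) :=
        (convex_closedBall x (d / 2)).isPreconnected
      have hfar : ∀ z ∈ Metric.closedBall x (d / 2), z ∉ frontier Ω := by
        intro z hz hzf
        have h1 : d ≤ dist x z := Metric.infDist_le_dist_of_mem hzf
        have h2 := Metric.mem_closedBall'.1 hz
        linarith
      have hcl : ∀ z ∈ Metric.closedBall x (d / 2), z ∉ Ω → z ∈ (closure Ω)ᶜ := by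
        intro z hz hzΩ hzc
        apply hfar z hz
        rw [hΩopen.frontier_eq]
        exact ⟨hzc, hzΩ⟩
      obtain ⟨z, hz, hz1, hz2⟩ := hpre Ω (closure Ω)ᶜ hΩopen isClosed_closure.isOpen_compl
        (fun z hz => or_iff_not_imp_left.2 (hcl z hz))
        ⟨x, Metric.mem_closedBall_self (by positivity), hx⟩ ⟨y, hy, hcl y hy hyΩ⟩
      exact hz2 (subset_closure hz1)
    have hb := ball_lower_bound (u := u) (x := x) (r := d / 2)
      (k := c₁ * m / (9 * N * d ^ 2)) (by positivity)
      (fun y hy => hu2.contDiffAt (hΩopen.mem_nhds (hsub hy)))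
      (fun y hy => hupos y (hsub hy)) ?_
    · convert hb using 1
      field_simp
      norm_num
    · intro y hy
      have hyΩ := hsub hy
      rw [heq y hyΩ]
      have hdy := hdpos y hyΩ
      have hdy2 : Metric.infDist y (frontier Ω) ≤ 3 / 2 * d := by
        have h1 : Metric.infDist y (frontier Ω) ≤ d + dist y x :=
          Metric.infDist_le_infDist_add_dist
        have h2 := Metric.mem_closedBall.1 hy
        linarith
      have hpow : (3 / 2 * d) ^ (-2 : ℝ) ≤ Metric.infDist y (frontier Ω) ^ β := by
        calc (3 / 2 * d) ^ (-2 : ℝ) ≤ Metric.infDist y (frontier Ω) ^ (-2 : ℝ) :=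
              Real.rpow_le_rpow_of_nonpos hdy hdy2 (by norm_num)
          _ ≤ _ := Real.rpow_le_rpow_of_exponent_ge hdy (hdy2.trans hx1) hβ
      have hpow2 : (3 / 2 * d) ^ (-2 : ℝ) = 4 / (9 * d ^ 2) := by
        rw [Real.rpow_neg (by positivity), Real.rpow_two]
        field_simp
        norm_num
      rw [hpow2] at hpow
      have hP1 := (hPbound y hyΩ).1
      rw [abs_of_pos (hPpos y hyΩ)] at hP1
      have hP2 : c₁ * (4 / (9 * d ^ 2)) ≤ P y :=
        (mul_le_mul_of_nonneg_left hpow hc₁.le).trans hP1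
      have hPg : c₁ * (4 / (9 * d ^ 2)) * m ≤ P y * g (u y) :=
        mul_le_mul hP2 (hgm y hyΩ) hmpos.le (hPpos y hyΩ).le
      have hq : 0 ≤ q y * ‖gradient u y‖ ^ a :=
        mul_nonneg (hq_pos y (subset_closure hyΩ)).le (Real.rpow_nonneg (norm_nonneg _) _)
      have hlt : 2 * N * (c₁ * m / (9 * N * d ^ 2)) < c₁ * (4 / (9 * d ^ 2)) * m := by
        have e1 : 2 * N * (c₁ * m / (9 * N * d ^ 2)) = 2 * (c₁ * m / (9 * d ^ 2)) := by
          field_simp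
        have e2 : c₁ * (4 / (9 * d ^ 2)) * m = 4 * (c₁ * m / (9 * d ^ 2)) := by ring
        have : 0 < c₁ * m / (9 * d ^ 2) := by positivity
        rw [e1, e2]
        linarith
      linarith
  -- contradiction at a boundary point
  obtain ⟨z, hz⟩ := hfr
  have hzc : z ∈ closure Ω := frontier_subset_closure hz
  have hne : (𝓝[Ω] z).NeBot := mem_closure_iff_nhdsWithin_neBot.1 hzc
  have ht : Tendsto u (𝓝[Ω] z) (𝓝 0) := by
    have := (huc z hzc).mono subset_closure
    rw [← hu0 z hz]
    exact this
  have htd : Tendsto (fun x => 3 / 2 * Metric.infDist x (frontier Ω)) (𝓝[Ω] z) (𝓝 0) := by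
    have hc : Continuous (fun x => 3 / 2 * Metric.infDist x (frontier Ω)) :=
      continuous_const.mul (Metric.continuous_infDist_pt _)
    have := hc.tendsto z
    rw [Metric.infDist_zero_of_mem hz, mul_zero] at this
    exact this.mono_left nhdsWithin_le_nhds
  have hδ : 0 < c₁ * m / (36 * N) := by positivity
  obtain ⟨x, ⟨h1, h2⟩, hx⟩ := (((ht.eventually (gt_mem_nhds hδ)).and
    (htd.eventually (gt_mem_nhds one_pos))).and self_mem_nhdsWithin).exists
  exact absurd (key x hx h2.le) (not_le.2 h1)
end
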